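/- Every flow network with spillback admits a Nash flow over time, i.e., there exists a feasible flow over time f such that for almost all θ ∈ [0,∞) and every arc e = uv: f⁺_e(θ) > 0 implies θ ∈ {ℓ_u(ϑ) | ϑ ≥ 0, e ∈ E'_ϑ}. -/

import Mathlib

open MeasureTheory Finset
open scoped Classical

noncomputable section

/-- A flow network with spillback: a finite directed (multi-)graph with source `s`,
sink `t`, transit times `τ`, outflow capacities `νout`, inflow capacities `νin`,
storage capacities `σ` (possibly infinite) and network inflow rate `r`. -/
structure SpillbackNetwork (V E : Type) [Fintype V] [Fintype E] where
  tail : E → V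
  head : E → V
  s : V
  t : V
  τ : E → ℝ
  νout : E → ℝ
  νin : E → ℝ
  σ : E → EReal
  r : ℝ
  τ_nonneg : ∀ e, 0 ≤ τ e
  νout_pos : ∀ e, 0 < νout e
  νin_pos : ∀ e, 0 < νin e
  σ_gt : ∀ e, ((νin e * τ e : ℝ) : EReal) < σ e
  r_nonneg : 0 ≤ r
  reachable : ∀ v, Relation.ReflTransGen (fun a b => ∃ e, tail e = a ∧ head e = b) s v
  no_zero_cycle : ∀ (l : List E) (hl : l ≠ []),
    l.Chain' (fun e e' => head e = tail e') →
    head (l.getLast hl) = tail (l.head hl) → 0 < (l.map τ).sum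
  no_into_source : ∀ e, head e ≠ s
  source_storage : ∀ e, tail e = s → σ e = ⊤
  source_inflow : ∀ e, tail e = s → r < νin e

namespace SpillbackNetwork

variable {V E : Type} [Fintype V] [Fintype E]

/-- A flow over time: in- and outflow rate functions, nonnegative, vanishing on
negative times, bounded and locally integrable. -/
structure Flow (N : SpillbackNetwork V E) where
  fin : E → ℝ → ℝ
  fout : E → ℝ → ℝ
  fin_nonneg : ∀ e θ, 0 ≤ fin e θ
  fout_nonneg : ∀ e θ, 0 ≤ fout e θ
  fin_zero_neg : ∀ e θ, θ < 0 → fin e θ = 0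
  fout_zero_neg : ∀ e θ, θ < 0 → fout e θ = 0
  fin_bdd : ∀ e, ∃ M, ∀ θ, fin e θ ≤ M
  fout_bdd : ∀ e, ∃ M, ∀ θ, fout e θ ≤ M
  fin_li : ∀ e, LocallyIntegrable (fin e)
  fout_li : ∀ e, LocallyIntegrable (fout e)

variable {N : SpillbackNetwork V E}

/-- Flow conservation at every node `v ≠ t`, for the network-inflow rate function `R`. -/
def Flow.Conserves (f : N.Flow) (R : ℝ → ℝ) : Prop :=
  ∀ v, v ≠ N.t → ∀ θ : ℝ, 0 ≤ θ →
    (∑ e ∈ univ.filter fun e => N.tail e = v, f.fin e θ)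
      - (∑ e ∈ univ.filter fun e => N.head e = v, f.fout e θ)
      = if v = N.s then R θ else 0

/-- Cumulative inflow `F⁺`. -/
def Flow.Fplus (f : N.Flow) (e : E) (θ : ℝ) : ℝ := ∫ ξ in (0:ℝ)..θ, f.fin e ξ

/-- Cumulative outflow `F⁻`. -/
def Flow.Fminus (f : N.Flow) (e : E) (θ : ℝ) : ℝ := ∫ ξ in (0:ℝ)..θ, f.fout e ξ

/-- The queue `z_e(θ) = F⁺_e(θ - τ_e) - F⁻_e(θ)`. -/
def Flow.z (f : N.Flow) (e : E) (θ : ℝ) : ℝ := f.Fplus e (θ - N.τ e) - f.Fminus e θ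

/-- The arc load `d_e(θ) = F⁺_e(θ) - F⁻_e(θ)`. -/
def Flow.d (f : N.Flow) (e : E) (θ : ℝ) : ℝ := f.Fplus e θ - f.Fminus e θ

/-- The arc `e` is full at time `θ` if `d_e(θ) ≥ σ_e`. -/
def Flow.Full (f : N.Flow) (e : E) (θ : ℝ) : Prop := N.σ e ≤ (f.d e θ : EReal)

/-- The inflow bound `b⁺_e(θ)`. -/
def Flow.bplus (f : N.Flow) (e : E) (θ : ℝ) : ℝ :=
  if f.Full e θ then min (f.fout e θ) (N.νin e) else N.νin e

/-- The push rate `b⁻_e(θ)`. -/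
def Flow.bminus (f : N.Flow) (e : E) (θ : ℝ) : ℝ :=
  if θ < N.τ e then 0
  else if 0 < f.z e θ then N.νout e
  else min (f.fin e (θ - N.τ e)) (N.νout e)

/-- The arc `e` is throttled at time `θ` if `f⁻_e(θ) < b⁻_e(θ)`. -/
def Flow.Throttled (f : N.Flow) (e : E) (θ : ℝ) : Prop := f.fout e θ < f.bminus e θ

/-- A set of arcs contains no directed cycle. -/
def CycleFree (N : SpillbackNetwork V E) (S : Set E) : Prop :=
  ∀ (l : List E) (hl : l ≠ []), (∀ e ∈ l, e ∈ S) →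
    l.Chain' (fun e e' => N.head e = N.tail e') →
    N.head (l.getLast hl) ≠ N.tail (l.head hl)

/-- Feasibility: the inflow condition, the fair allocation condition, the no slack
condition and the no deadlock condition. -/
def Flow.Feasible (f : N.Flow) : Prop :=
  (∀ e θ, f.fin e θ ≤ f.bplus e θ) ∧
  (∀ v (θ : ℝ), ∃ c, c ∈ Set.Ioc (0:ℝ) 1 ∧
    ∀ e, N.head e = v → f.fout e θ = min (f.bminus e θ) (N.νout e * c)) ∧
  (∀ v (θ : ℝ), (∃ e, N.head e = v ∧ f.Throttled e θ) →
    ∃ e, N.tail e = v ∧ f.fin e θ = f.bplus e θ) ∧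
  (∀ θ : ℝ, N.CycleFree {e | f.Full e θ})

/-- The spillback factor: the maximal value in `(0,1]` witnessing fair allocation. -/
def Flow.spillFactor (f : N.Flow) (v : V) (θ : ℝ) : ℝ :=
  sSup {c : ℝ | c ∈ Set.Ioc (0:ℝ) 1 ∧
    ∀ e, N.head e = v → f.fout e θ = min (f.bminus e θ) (N.νout e * c)}

/-- The waiting time `q_e(θ)`. -/
def Flow.q (f : N.Flow) (e : E) (θ : ℝ) : ℝ :=
  sInf {q : ℝ | 0 ≤ q ∧
    (∫ ξ in (θ + N.τ e)..(θ + N.τ e + q), f.fout e ξ) = f.z e (θ + N.τ e)}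

/-- The exit time `T_e(θ) = θ + τ_e + q_e(θ)`. -/
def Flow.T (f : N.Flow) (e : E) (θ : ℝ) : ℝ := θ + N.τ e + f.q e θ

/-- `IsWalk N u v l` : the list of arcs `l` is a walk from `u` to `v`. -/
def IsWalk (N : SpillbackNetwork V E) : V → V → List E → Prop
  | u, v, [] => u = v
  | u, v, e :: l => N.tail e = u ∧ N.IsWalk (N.head e) v l

/-- Traversal time of a walk: composition of the exit times along the walk. -/
def Flow.TWalk (f : N.Flow) (l : List E) (θ : ℝ) : ℝ :=
  l.foldl (fun ϑ e => f.T e ϑ) θ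

/-- Earliest arrival time `ℓ_v(θ)`: minimum of the traversal times over all `s`-`v` walks. -/
def Flow.ell (f : N.Flow) (v : V) (θ : ℝ) : ℝ :=
  sInf {x : ℝ | ∃ l : List E, N.IsWalk N.s v l ∧ f.TWalk l θ = x}

/-- `e` is active at `θ` (i.e. `e ∈ E'_θ`). -/
def Flow.Active (f : N.Flow) (e : E) (θ : ℝ) : Prop :=
  f.ell (N.head e) θ = f.T e (f.ell (N.tail e) θ)

/-- `e` is a resetting arc at `θ` (i.e. `e ∈ E*_θ`). -/
def Flow.Resetting (f : N.Flow) (e : E) (θ : ℝ) : Prop :=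
  0 < f.q e (f.ell (N.tail e) θ)

/-- `e` is a spillback arc at `θ` (i.e. `e ∈ Ē_θ`). -/
def Flow.Spillback (f : N.Flow) (e : E) (θ : ℝ) : Prop :=
  (f.d e (f.ell (N.tail e) θ) : EReal) = N.σ e

/-- The Nash flow condition: almost all flow entering an arc does so along
currently shortest paths. -/
def Flow.NashCondition (f : N.Flow) : Prop :=
  ∀ᵐ θ ∂(volume : Measure ℝ), 0 ≤ θ → ∀ e, 0 < f.fin e θ →
    ∃ ϑ, 0 ≤ ϑ ∧ f.Active e ϑ ∧ f.ell (N.tail e) ϑ = θ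

/-- A Nash flow over time: a feasible flow over time (with constant network inflow
rate `r`) satisfying the Nash flow condition. -/
def Flow.IsNash (f : N.Flow) : Prop :=
  f.Conserves (fun _ => N.r) ∧ f.Feasible ∧ f.NashCondition

/-- Spillback thin flow of value `r` on the subnetwork `E'` with resetting arcs
`Estar` and inflow bounds `b`. -/
def ThinFlow (N : SpillbackNetwork V E) (E' Estar : Set E) (b : E → ℝ)
    (x : E → ℝ) (ℓ c : V → ℝ) : Prop :=
  (∀ e ∈ E', 0 ≤ x e) ∧
  (∀ v, (∑ e ∈ univ.filter fun e => N.tail e = v ∧ e ∈ E', x e)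
      - (∑ e ∈ univ.filter fun e => N.head e = v ∧ e ∈ E', x e)
      = if v = N.s then N.r else if v = N.t then -N.r else 0) ∧
  (∀ v, 0 ≤ ℓ v) ∧
  (∀ v, c v ∈ Set.Ioc (0:ℝ) 1) ∧
  (ℓ N.s = 1 / c N.s) ∧
  (∀ v, v ≠ N.s →
    (∀ e ∈ E', N.head e = v →
      ℓ v ≤ (if e ∈ Estar then x e / (c v * N.νout e)
             else max (ℓ (N.tail e)) (x e / (c v * N.νout e)))) ∧
    (∃ e ∈ E', N.head e = v ∧
      ℓ v = (if e ∈ Estar then x e / (c v * N.νout e)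
             else max (ℓ (N.tail e)) (x e / (c v * N.νout e))))) ∧
  (∀ e ∈ E', 0 < x e →
    ℓ (N.head e) = (if e ∈ Estar then x e / (c (N.head e) * N.νout e)
                    else max (ℓ (N.tail e)) (x e / (c (N.head e) * N.νout e)))) ∧
  (∀ e ∈ E', x e / b e ≤ ℓ (N.tail e)) ∧
  (∀ v, c v < 1 → ∃ e ∈ E', N.tail e = v ∧ ℓ v = x e / b e)

end SpillbackNetwork

end

namespace KuhnCube

/-- A labelling of `n + 1` points by `{0, …, n}` that misses some label has an even number of
facets carrying exactly the labels `{0, …, n - 1}`. -/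
theorem even_card_doors {n : ℕ} {g : ℕ → ℕ} (hg : ∀ k ≤ n, g k ≤ n)
    (hnf : ¬ ∀ l ≤ n, ∃ k ≤ n, g k = l) :
    Even (#{k ∈ range (n + 1) | ∀ l < n, ∃ j ≤ n, j ≠ k ∧ g j = l}) := by
  by_cases hne : ∃ k ≤ n, ∀ l < n, ∃ j ≤ n, j ≠ k ∧ g j = l
  swap
  · rw [Finset.filter_eq_empty_iff.2]
    · simp
    · intro k hk hd
      exact hne ⟨k, by simpa [Nat.lt_succ_iff] using hk, hd⟩
  obtain ⟨k, hk, hd⟩ := hne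
  have hsub : range n ⊆ ((range (n + 1)).erase k).image g := by
    intro l hl
    obtain ⟨j, hj, hjk, rfl⟩ := hd l (by simpa using hl)
    exact mem_image_of_mem _ (by simp [hjk]; omega)
  have hcard : #((range (n + 1)).erase k) = n := by
    rw [card_erase_of_mem (by simp; omega)]; simp
  have himg : ((range (n + 1)).erase k).image g = range n :=
    by
    refine (eq_of_subset_of_card_le hsub ?_).symm
    have h := card_image_le (s := (range (n + 1)).erase k) (f := g)
    rw [hcard] at h
    simpa using h
  have hinj : Set.InjOn g ((range (n + 1)).erase k : Finset ℕ) := by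
    apply card_image_iff.1
    rw [himg, hcard]; simp
  have hgk : g k < n := by
    rcases (hg k hk).lt_or_eq with h | h
    · exact h
    · refine absurd (fun l hl => ?_) hnf
      rcases hl.lt_or_eq with h' | h'
      · obtain ⟨j, hj, -, e⟩ := hd l h'
        exact ⟨j, hj, e⟩
      · exact ⟨k, hk, h.trans h'.symm⟩
  obtain ⟨k', hk', hkk', hgk'⟩ := hd _ hgk
  have : ({j ∈ range (n + 1) | ∀ l < n, ∃ i ≤ n, i ≠ j ∧ g i = l}) = {k, k'} := by
    ext j
    simp only [mem_filter, mem_range, mem_insert, mem_singleton]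
    constructor
    · rintro ⟨hj, hdj⟩
      by_contra! hjk
      have hjn : g j ∈ range n := by
        rw [← himg]; exact mem_image_of_mem _ (by simp [hjk.1]; omega)
      obtain ⟨i, hi, hij, hgi⟩ := hdj (g j) (by simpa using hjn)
      by_cases hik : i = k
      · subst hik
        exact hjk.2 (hinj (by simp [hjk.1]; omega) (by simp [hkk']; omega) (by omega))
      · exact hij (hinj (by simp [hik]; omega) (by simp [hjk.1]; omega) hgi)
    · rintro (rfl | rfl)
      · exact ⟨by omega, hd⟩
      · refine ⟨by omega, fun l hl => ?_⟩
        obtain ⟨i, hi, hik, e⟩ := hd l hl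
        by_cases h : i = j
        · exact ⟨k, hk, hkk'.symm, by rw [← e, h, hgk']⟩
        · exact ⟨i, hi, h, e⟩
  rw [this, card_pair hkk'.symm]
  exact even_two

variable {m : ℕ}

/-- The `k`-th vertex of the Kuhn simplex with base point `p` and direction order `σ`. -/
def vertex (p : Fin (m + 1) → ℕ) (σ : Equiv.Perm (Fin (m + 1))) (k : ℕ) : Fin (m + 1) → ℕ :=
  fun i => p i + if (σ i : ℕ) < k then 1 else 0

/-- The neighbour of a Kuhn simplex across the facet opposite to its `k`-th vertex, inside the
grid `{0, …, N}`; boundary facets are their own neighbours. -/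
def neighbour (N : ℕ) (x : (Fin (m + 1) → ℕ) × Equiv.Perm (Fin (m + 1)) × ℕ) :
    (Fin (m + 1) → ℕ) × Equiv.Perm (Fin (m + 1)) × ℕ :=
  if x.2.2 = 0 then
    if x.1 (x.2.1.symm 0) + 1 < N then
      (Function.update x.1 (x.2.1.symm 0) (x.1 (x.2.1.symm 0) + 1),
        x.2.1.trans (finRotate (m + 1)).symm, m + 1)
    else x
  else if h : x.2.2 < m + 1 then
    (x.1, x.2.1.trans (Equiv.swap ⟨x.2.2 - 1, by omega⟩ ⟨x.2.2, h⟩), x.2.2)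
  else
    if 0 < x.1 (x.2.1.symm (Fin.last m)) then
      (Function.update x.1 (x.2.1.symm (Fin.last m)) (x.1 (x.2.1.symm (Fin.last m)) - 1),
        x.2.1.trans (finRotate (m + 1)), 0)
    else x

theorem val_finRotate (i : Fin (m + 1)) :
    (finRotate (m + 1) i : ℕ) = if (i : ℕ) = m then (0 : ℕ) else (i : ℕ) + 1 := by
  split_ifs with h
  · have : i = Fin.last m := Fin.ext h
    subst this
    rw [finRotate_last]; rfl
  · exact coe_finRotate_of_ne_last (fun h' => h (by simp [h']))

theorem val_finRotate_symm (i : Fin (m + 1)) :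
    ((finRotate (m + 1)).symm i : ℕ) = if (i : ℕ) = 0 then m else (i : ℕ) - 1 := by
  obtain ⟨j, rfl⟩ := (finRotate (m + 1)).surjective i
  have := j.2
  have h := val_finRotate j
  rw [Equiv.symm_apply_apply]
  by_cases hj : (j : ℕ) = m
  · rw [if_pos hj] at h; rw [if_pos h]; exact hj
  · rw [if_neg hj] at h; rw [if_neg (by omega)]; omega

theorem vertex_neighbour_zero (p : Fin (m + 1) → ℕ) (σ : Equiv.Perm (Fin (m + 1))) {k : ℕ}
    (hk : k < m + 1) :
    vertex (Function.update p (σ.symm 0) (p (σ.symm 0) + 1))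
      (σ.trans (finRotate (m + 1)).symm) k = vertex p σ (k + 1) := by
  ext i
  simp only [vertex, Equiv.trans_apply, val_finRotate_symm]
  by_cases hi : i = σ.symm 0
  · subst hi
    simp; omega
  · have h0 : (σ i : ℕ) ≠ 0 := fun h => hi (by rw [Equiv.eq_symm_apply]; exact Fin.ext h)
    rw [Function.update_of_ne hi, if_neg h0]
    congr 2
    simp only [eq_iff_iff]; omega

theorem vertex_neighbour_last (p : Fin (m + 1) → ℕ) (σ : Equiv.Perm (Fin (m + 1))) {k : ℕ}
    (hk : k < m + 1) (hp : 0 < p (σ.symm (Fin.last m))) :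
    vertex (Function.update p (σ.symm (Fin.last m)) (p (σ.symm (Fin.last m)) - 1))
      (σ.trans (finRotate (m + 1))) (k + 1) = vertex p σ k := by
  ext i
  simp only [vertex, Equiv.trans_apply, val_finRotate]
  by_cases hi : i = σ.symm (Fin.last m)
  · subst hi
    simp; split_ifs <;> omega
  · have h0 : (σ i : ℕ) ≠ m := fun h => hi (by rw [Equiv.eq_symm_apply]; exact Fin.ext h)
    rw [Function.update_of_ne hi, if_neg h0]
    congr 2
    simp only [eq_iff_iff]; omega

theorem vertex_swap (p : Fin (m + 1) → ℕ) (σ : Equiv.Perm (Fin (m + 1))) {k j : ℕ}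
    (hk : k < m + 1) (hj : j ≠ k) :
    vertex p (σ.trans (Equiv.swap ⟨k - 1, by omega⟩ ⟨k, hk⟩)) j = vertex p σ j := by
  ext i
  simp only [vertex, Equiv.trans_apply, Equiv.swap_apply_def, Fin.ext_iff]
  congr 2
  simp only [eq_iff_iff]
  split_ifs <;> simp_all <;> omega

/-- The facet opposite to the `k`-th vertex of the Kuhn simplex `(p, σ)` carries all labels
except possibly the last one. -/
def IsDoor (h : (Fin (m + 1) → ℕ) → ℕ)
    (x : (Fin (m + 1) → ℕ) × Equiv.Perm (Fin (m + 1)) × ℕ) : Prop :=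
  ∀ l < m + 1, ∃ j ≤ m + 1, j ≠ x.2.2 ∧ h (vertex x.1 x.2.1 j) = l

theorem finRotate_symm_zero : (finRotate (m + 1)).symm 0 = Fin.last m := by
  rw [Equiv.symm_apply_eq, finRotate_last]

section neighbour

variable {N : ℕ} {h : (Fin (m + 1) → ℕ) → ℕ}
  {p : Fin (m + 1) → ℕ} {σ : Equiv.Perm (Fin (m + 1))} {k : ℕ}

theorem neighbour_zero_eq (hp : p (σ.symm 0) + 1 < N) :
    neighbour N (p, σ, 0) = (Function.update p (σ.symm 0) (p (σ.symm 0) + 1),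
        σ.trans (finRotate (m + 1)).symm, m + 1) := by
  simp only [neighbour, if_true, if_pos hp]

theorem neighbour_last_eq (hp : 0 < p (σ.symm (Fin.last m))) :
    neighbour N (p, σ, m + 1) =
      (Function.update p (σ.symm (Fin.last m)) (p (σ.symm (Fin.last m)) - 1),
        σ.trans (finRotate (m + 1)), 0) := by
  simp only [neighbour, if_pos hp]
  rw [if_neg (by omega), dif_neg (by omega)]

theorem neighbour_mid_eq (h0 : k ≠ 0) (hk : k < m + 1) :
    neighbour N (p, σ, k) = (p, σ.trans (Equiv.swap ⟨k - 1, by omega⟩ ⟨k, hk⟩), k) := by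
  simp only [neighbour]
  rw [if_neg h0, dif_pos hk]

theorem neighbour_neighbour (hp : ∀ i, p i < N) (hk : k ≤ m + 1) :
    neighbour N (neighbour N (p, σ, k)) = (p, σ, k) := by
  rcases Nat.eq_zero_or_pos k with rfl | h0
  · by_cases hpN : p (σ.symm 0) + 1 < N
    · rw [neighbour_zero_eq hpN]
      have e : (σ.trans (finRotate (m + 1)).symm).symm (Fin.last m) = σ.symm 0 := by
        rw [Equiv.symm_trans_apply, Equiv.symm_symm, finRotate_last]
      rw [neighbour_last_eq (by rw [e]; simp), e]
      refine Prod.ext ?_ (Prod.ext ?_ rfl)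
      · simp
      · ext i; simp only [Equiv.trans_apply, Equiv.apply_symm_apply]
    · have e : neighbour N (p, σ, 0) = (p, σ, 0) := by
        simp only [neighbour, if_true, if_neg hpN]
      rw [e, e]
  · rcases hk.lt_or_eq with hk' | rfl
    · rw [neighbour_mid_eq h0.ne' hk', neighbour_mid_eq h0.ne' hk']
      refine Prod.ext rfl (Prod.ext ?_ rfl)
      ext i
      simp only [Equiv.trans_apply, Equiv.swap_apply_self]
    · by_cases hp0 : 0 < p (σ.symm (Fin.last m))
      · rw [neighbour_last_eq hp0]
        have e : (σ.trans (finRotate (m + 1))).symm 0 = σ.symm (Fin.last m) := by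
          rw [Equiv.symm_trans_apply, finRotate_symm_zero]
        have h1 := hp (σ.symm (Fin.last m))
        rw [neighbour_zero_eq (by rw [e, Function.update_self]; omega), e]
        refine Prod.ext ?_ (Prod.ext ?_ rfl)
        · simp only [Function.update_self, Function.update_idem]
          rw [Nat.sub_add_cancel hp0, Function.update_eq_self]
        · ext i; simp only [Equiv.trans_apply, Equiv.symm_apply_apply]
      · have e : neighbour N (p, σ, m + 1) = (p, σ, m + 1) := by
          simp only [neighbour, if_neg hp0]
          rw [if_neg (by omega), dif_neg (by omega)]
        rw [e, e]

theorem neighbour_mem (hp : ∀ i, p i < N) (hk : k ≤ m + 1) :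
    (∀ i, (neighbour N (p, σ, k)).1 i < N) ∧ (neighbour N (p, σ, k)).2.2 ≤ m + 1 := by
  rcases Nat.eq_zero_or_pos k with rfl | h0
  · by_cases hpN : p (σ.symm 0) + 1 < N
    · rw [neighbour_zero_eq hpN]
      refine ⟨fun i => ?_, le_rfl⟩
      by_cases hi : i = σ.symm 0
      · subst hi; simpa using hpN
      · simpa [Function.update_of_ne hi] using hp i
    · have e : neighbour N (p, σ, 0) = (p, σ, 0) := by
        simp only [neighbour, if_true, if_neg hpN]
      rw [e]; exact ⟨hp, hk⟩
  · rcases hk.lt_or_eq with hk' | rfl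
    · rw [neighbour_mid_eq h0.ne' hk']
      exact ⟨hp, hk⟩
    · by_cases hp0 : 0 < p (σ.symm (Fin.last m))
      · rw [neighbour_last_eq hp0]
        refine ⟨fun i => ?_, by simp⟩
        by_cases hi : i = σ.symm (Fin.last m)
        · subst hi
          have := hp (σ.symm (Fin.last m))
          simp only [Function.update_self]; omega
        · simpa [Function.update_of_ne hi] using hp i
      · have e : neighbour N (p, σ, m + 1) = (p, σ, m + 1) := by
          simp only [neighbour, if_neg hp0]
          rw [if_neg (by omega), dif_neg (by omega)]
        rw [e]; exact ⟨hp, hk⟩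

theorem isDoor_neighbour (hk : k ≤ m + 1) (hd : IsDoor h (p, σ, k)) :
    IsDoor h (neighbour N (p, σ, k)) := by
  rcases Nat.eq_zero_or_pos k with rfl | h0
  · by_cases hpN : p (σ.symm 0) + 1 < N
    · rw [neighbour_zero_eq hpN]
      intro l hl
      obtain ⟨j, hj, hj0, e⟩ := hd l hl
      dsimp only at hj0 e ⊢
      refine ⟨j - 1, by omega, by omega, ?_⟩
      rw [vertex_neighbour_zero _ _ (by omega), Nat.sub_add_cancel (by omega), e]
    · have e : neighbour N (p, σ, 0) = (p, σ, 0) := by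
        simp only [neighbour, if_true, if_neg hpN]
      rwa [e]
  · rcases hk.lt_or_eq with hk' | rfl
    · rw [neighbour_mid_eq h0.ne' hk']
      intro l hl
      obtain ⟨j, hj, hj0, e⟩ := hd l hl
      dsimp only at hj0 e ⊢
      exact ⟨j, hj, hj0, by rw [vertex_swap _ _ _ hj0, e]⟩
    · by_cases hp0 : 0 < p (σ.symm (Fin.last m))
      · rw [neighbour_last_eq hp0]
        intro l hl
        obtain ⟨j, hj, hj0, e⟩ := hd l hl
        dsimp only at hj0 e ⊢
        refine ⟨j + 1, by omega, by omega, ?_⟩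
        rw [vertex_neighbour_last _ _ (by omega) hp0, e]
      · have e : neighbour N (p, σ, m + 1) = (p, σ, m + 1) := by
          simp only [neighbour, if_neg hp0]
          rw [if_neg (by omega), dif_neg (by omega)]
        rwa [e]

theorem neighbour_ne (h_top : ∀ x (i : Fin (m + 1)), x i = N → h x ≠ (i : ℕ))
    (h_bot : ∀ x i, x i = 0 → ∃ j : Fin (m + 1), h x = j ∧ j ≤ i ∧ x j = 0)
    (hp : ∀ i, p i < N) (hk : k ≤ m + 1) (hd : IsDoor h (p, σ, k))
    (hne : (p, σ, k) ≠ (0, 1, m + 1)) : neighbour N (p, σ, k) ≠ (p, σ, k) := by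
  rcases Nat.eq_zero_or_pos k with rfl | h0
  · by_cases hpN : p (σ.symm 0) + 1 < N
    · rw [neighbour_zero_eq hpN]
      intro e
      have := congrArg (fun x => x.2.2) e
      simp at this
    · exfalso
      obtain ⟨j, hj, hj0, e⟩ := hd (σ.symm 0) (σ.symm 0).2
      dsimp only at hj0 e
      refine h_top _ (σ.symm 0) ?_ e
      have := hp (σ.symm 0)
      simp only [vertex, Equiv.apply_symm_apply]
      rw [if_pos (by simp; omega)]
      omega
  · rcases hk.lt_or_eq with hk' | rfl
    · rw [neighbour_mid_eq h0.ne' hk']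
      intro e
      have := congrArg (fun x => x.2.1 (σ.symm ⟨k, hk'⟩)) e
      simp [Fin.ext_iff] at this
      omega
    · by_cases hp0 : 0 < p (σ.symm (Fin.last m))
      · rw [neighbour_last_eq hp0]
        intro e
        have := congrArg (fun x => x.2.2) e
        simp at this
      · exfalso
        apply hne
        set i := σ.symm (Fin.last m) with hi
        have hz : ∀ j < m + 1, vertex p σ j i = 0 := by
          intro j hj
          simp only [vertex, hi, Equiv.apply_symm_apply, Fin.val_last]
          rw [← hi, if_neg (by omega)]; omega
        choose g hg hgi hg0 using fun j : Fin (m + 1) => h_bot _ i (hz j j.2)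
        have hanti : ∀ {a b : ℕ} (q), a ≤ b → vertex p σ b q = 0 → vertex p σ a q = 0 := by
          intro a b q hab hb
          simp only [vertex] at hb ⊢
          by_cases hlt : (σ q : ℕ) < a
          · rw [if_pos (by omega)] at hb; omega
          · rw [if_neg hlt]; omega
        have hmono : Monotone g := by
          intro a b hab
          obtain ⟨j, hj, hjle, -⟩ := h_bot _ (g b) (hanti (g b) hab (hg0 b))
          rw [hg a] at hj
          rw [Fin.ext hj]; exact hjle
        have hsurj : Function.Surjective g := by
          intro l
          obtain ⟨j, hj, hj0, e⟩ := hd l l.2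
          dsimp only at hj0 e
          refine ⟨⟨j, by omega⟩, ?_⟩
          apply Fin.ext
          rw [← e, ← hg]
        have hid : g = id := by
          refine ((hmono.strictMono_of_injective
            (Finite.injective_iff_surjective.2 hsurj)).range_inj strictMono_id).1 ?_
          rw [hsurj.range_eq, Set.range_id]
        have hlow : ∀ q : Fin (m + 1), p q = 0 ∧ (q : ℕ) ≤ σ q := by
          intro q
          have := hg0 q
          rw [hid] at this
          simp only [vertex, id] at this
          by_cases hlt : (σ q : ℕ) < q
          · rw [if_pos hlt] at this; omega
          · exact ⟨by omega, by omega⟩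
        have hup : ∀ q : Fin (m + 1), (σ q : ℕ) ≤ q := by
          intro q
          by_contra! hlt
          have hq : (q : ℕ) + 1 < m + 1 := by have := (σ q).2; omega
          have hv : vertex p σ (q + 1) q = 0 := by
            simp only [vertex, (hlow q).1]; rw [if_neg (by omega)]
          obtain ⟨j, hj, hjle, -⟩ := h_bot _ q hv
          have h2 := hg ⟨q + 1, hq⟩
          rw [hid] at h2
          simp only [id] at h2
          rw [hj] at h2
          have : (j : ℕ) ≤ q := hjle
          omega
        refine Prod.ext (funext fun q => (hlow q).1) (Prod.ext ?_ rfl)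
        ext q
        exact le_antisymm (hup q) (hlow q).2

end neighbour

/-- **Sperner's lemma** for Kuhn's triangulation of a cube. -/
theorem exists_full_simplex {N : ℕ} (hN : 0 < N) {h : (Fin (m + 1) → ℕ) → ℕ}
    (h_le : ∀ x, h x ≤ m + 1) (h_top : ∀ x (i : Fin (m + 1)), x i = N → h x ≠ (i : ℕ))
    (h_bot : ∀ x i, x i = 0 → ∃ j : Fin (m + 1), h x = j ∧ j ≤ i ∧ x j = 0) :
    ∃ (p : Fin (m + 1) → ℕ) (σ : Equiv.Perm (Fin (m + 1))), (∀ i, p i < N) ∧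
      ∀ l ≤ m + 1, ∃ k ≤ m + 1, h (vertex p σ k) = l := by
  by_contra! hcon
  let S := (Fintype.piFinset fun _ : Fin (m + 1) => range N)
    ×ˢ ((univ : Finset (Equiv.Perm (Fin (m + 1)))) ×ˢ range (m + 1 + 1))
  let D := S.filter (IsDoor h)
  have hS : ∀ p σ k, (p, σ, k) ∈ S ↔ (∀ i, p i < N) ∧ k ≤ m + 1 := by
    intro p σ k
    simp [S]
  have heven : Even #D := by
    rw [card_filter, sum_product]
    refine Finset.even_sum _ fun p hp => ?_
    rw [sum_product]
    refine Finset.even_sum _ fun σ _ => ?_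
    rw [← card_filter]
    have := even_card_doors (g := fun k => h (vertex p σ k)) (fun k (_ : k ≤ m + 1) => h_le _) ?_
    · convert this using 4
      · rfl
      · exact Iff.rfl
    intro hall
    obtain ⟨l, hl, hl'⟩ := hcon p σ (by simpa using hp)
    obtain ⟨k, hk, e⟩ := hall l hl
    exact hl' k hk e
  have hx0 : ((0, 1, m + 1) : (Fin (m + 1) → ℕ) × Equiv.Perm (Fin (m + 1)) × ℕ) ∈ D := by
    refine mem_filter.2 ⟨(hS _ _ _).2 ⟨fun _ => hN, le_rfl⟩, fun l hl => ⟨l, hl.le, hl.ne, ?_⟩⟩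
    obtain ⟨j, hj, hjl, hj0⟩ := h_bot (vertex 0 1 l) ⟨l, hl⟩ (by simp [vertex])
    dsimp only
    rw [hj]
    have h1 : (j : ℕ) ≤ l := hjl
    by_contra hne
    have hlt : (((1 : Equiv.Perm (Fin (m + 1))) j : Fin (m + 1)) : ℕ) < l := by
      rw [Equiv.Perm.one_apply]; omega
    rw [vertex, if_pos hlt] at hj0
    omega
  have hodd : ((#(D.erase (0, 1, m + 1)) : ℕ) : ZMod 2) = 0 := by
    rw [Finset.cast_card]
    have key : ∀ x ∈ D.erase (0, 1, m + 1), neighbour N x ∈ D ∧ neighbour N x ≠ x ∧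
        neighbour N (neighbour N x) = x := by
      rintro ⟨p, σ, k⟩ hx
      obtain ⟨hne, hD⟩ := mem_erase.1 hx
      obtain ⟨hxS, hd⟩ := mem_filter.1 hD
      obtain ⟨hp, hk⟩ := (hS _ _ _).1 hxS
      refine ⟨mem_filter.2 ⟨(hS _ _ _).2 (neighbour_mem hp hk), isDoor_neighbour hk hd⟩,
        neighbour_ne h_top h_bot hp hk hd hne, neighbour_neighbour hp hk⟩
    have hfix : neighbour N ((0, 1, m + 1) : (Fin (m + 1) → ℕ) × _ × ℕ) = (0, 1, m + 1) := by
      simp only [neighbour]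
      rw [if_neg (by omega), dif_neg (by omega), if_neg (by simp)]
    refine Finset.sum_involution (fun x _ => neighbour N x) ?_ ?_ ?_ ?_
    · intro x hx
      decide
    · intro x hx _
      exact (key x hx).2.1
    · intro x hx
      refine mem_erase.2 ⟨fun e => ?_, (key x hx).1⟩
      have := (key x hx).2.2
      rw [e, hfix] at this
      exact (mem_erase.1 hx).1 this.symm
    · intro x hx
      exact (key x hx).2.2
  rw [ZMod.natCast_eq_zero_iff_even, card_erase_of_mem hx0] at hodd
  have : 0 < #D := card_pos.2 ⟨_, hx0⟩
  rcases heven with ⟨a, ha⟩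
  rcases hodd with ⟨b, hb⟩
  omega

/-- The real point of the box `[a, b]` with grid coordinates `c ∈ {1, …, M + 1}`. -/
noncomputable def gridPoint (a b : Fin (m + 1) → ℝ) (M : ℕ) (c : Fin (m + 1) → ℕ) :
    Fin (m + 1) → ℝ :=
  fun i => a i + (b i - a i) * (((c i : ℝ) - 1) / M)

theorem gridPoint_mem {a b : Fin (m + 1) → ℝ} (hab : a ≤ b) {M : ℕ} (hM : 0 < M)
    {c : Fin (m + 1) → ℕ} (h1 : ∀ i, 1 ≤ c i) (h2 : ∀ i, c i ≤ M + 1) :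
    gridPoint a b M c ∈ Set.Icc a b := by
  have hM' : (0 : ℝ) < M := by exact_mod_cast hM
  refine ⟨fun i => ?_, fun i => ?_⟩
  · have := hab i
    have h : (0 : ℝ) ≤ ((c i : ℝ) - 1) / M :=
      div_nonneg (by have : (1 : ℝ) ≤ c i := by exact_mod_cast h1 i
                     linarith) hM'.le
    simp only [gridPoint]
    nlinarith
  · have := hab i
    have h : ((c i : ℝ) - 1) / M ≤ 1 := by
      rw [div_le_one hM']
      have : (c i : ℝ) ≤ M + 1 := by exact_mod_cast h2 i
      linarith
    simp only [gridPoint]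
    nlinarith

theorem exists_approx_solution {a b : Fin (m + 1) → ℝ} (hab : a ≤ b)
    (F : (Fin (m + 1) → ℝ) → Fin (m + 1) → ℝ) {M : ℕ} (hM : 0 < M) :
    ∃ x ∈ Set.Icc a b, (∀ i, x i = b i ∨ 0 ≤ F x i) ∧
      ∀ i, ∃ y ∈ Set.Icc a b, (∀ j, |y j - x j| ≤ (b j - a j) / M) ∧ (y i = a i ∨ F y i ≤ 0) := by
  let bit : (Fin (m + 1) → ℕ) → Fin (m + 1) → Prop := fun c i =>
    c i ≠ 0 ∧ ((∃ j, c j = 0) ∨ (c i ≠ 1 ∧ (c i = M + 1 ∨ 0 < F (gridPoint a b M c) i)))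
  let S : (Fin (m + 1) → ℕ) → Set ℕ := fun c =>
    {k | k = m + 1 ∨ ∃ i : Fin (m + 1), i.val = k ∧ ¬ bit c i}
  have hmem : ∀ c, sInf (S c) ∈ S c := fun c => Nat.sInf_mem ⟨m + 1, Or.inl rfl⟩
  obtain ⟨p, σ, hp, hall⟩ := exists_full_simplex (N := M + 1) (by omega)
    (h := fun c => sInf (S c)) (fun c => Nat.sInf_le (Or.inl rfl))
    (by
      intro c i hci he
      have := hmem c
      rw [he] at this
      rcases this with h | ⟨j, hj, hb⟩
      · have := i.2; omega
      · rw [Fin.ext hj] at hb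
        exact hb ⟨by omega, Or.inr ⟨by omega, Or.inl hci⟩⟩)
    (by
      intro c i hci
      have hle : sInf (S c) ≤ i := Nat.sInf_le (Or.inr ⟨i, rfl, fun h => h.1 hci⟩)
      rcases hmem c with h | ⟨j, hj, hb⟩
      · have := i.2; omega
      · refine ⟨j, hj.symm, by rw [Fin.le_def, hj]; exact hle, ?_⟩
        by_contra hcj
        exact hb ⟨hcj, Or.inl ⟨i, hci⟩⟩)
  obtain ⟨k₀, hk₀, hl₀⟩ := hall (m + 1) le_rfl
  have htrue : ∀ i, bit (vertex p σ k₀) i := by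
    intro i
    by_contra hb
    have : sInf (S (vertex p σ k₀)) ≤ i := Nat.sInf_le (Or.inr ⟨i, rfl, hb⟩)
    have := i.2
    omega
  have hnz : ∀ i, 2 ≤ vertex p σ k₀ i ∧
      (vertex p σ k₀ i = M + 1 ∨ 0 < F (gridPoint a b M (vertex p σ k₀)) i) := by
    intro i
    obtain ⟨h0, h | h⟩ := htrue i
    · obtain ⟨j, hj⟩ := h
      exact absurd hj (htrue j).1
    · exact ⟨by omega, h.2⟩
  have hone : ∀ k i, 1 ≤ vertex p σ k i := by
    intro k i
    have := (hnz i).1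
    simp only [vertex] at this ⊢
    split_ifs at this <;> omega
  have hup : ∀ k i, vertex p σ k i ≤ M + 1 := by
    intro k i
    have := hp i
    simp only [vertex]
    split_ifs <;> omega
  have hM' : (0 : ℝ) < M := by exact_mod_cast hM
  refine ⟨gridPoint a b M (vertex p σ k₀), gridPoint_mem hab hM (hone _) (hup _), ?_, ?_⟩
  · intro i
    rcases (hnz i).2 with h | h
    · left
      simp only [gridPoint, h]
      push_cast
      field_simp
      ring
    · exact Or.inr h.le
  · intro i
    obtain ⟨k, hk, hl⟩ := hall i i.2.le
    refine ⟨gridPoint a b M (vertex p σ k), gridPoint_mem hab hM (hone _) (hup _), ?_, ?_⟩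
    · intro j
      have h1 : gridPoint a b M (vertex p σ k) j - gridPoint a b M (vertex p σ k₀) j =
          (b j - a j) / M * ((vertex p σ k j : ℝ) - vertex p σ k₀ j) := by
        simp only [gridPoint]; ring
      have h2 : |(vertex p σ k j : ℝ) - vertex p σ k₀ j| ≤ 1 := by
        simp only [vertex]
        split_ifs <;> simp
      have h3 : 0 ≤ (b j - a j) / M := div_nonneg (sub_nonneg.2 (hab j)) hM'.le
      rw [h1, abs_mul, abs_of_nonneg h3]
      exact mul_le_of_le_one_right h3 h2
    · have := hmem (vertex p σ k)
      rw [hl] at this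
      rcases this with h | ⟨j, hj, hb⟩
      · have := i.2; omega
      · rw [Fin.ext hj] at hb
        have h1 := hone k i
        by_cases hc1 : vertex p σ k i = 1
        · left; simp [gridPoint, hc1]
        · right
          by_contra! hF
          exact hb ⟨by omega, Or.inr ⟨hc1, Or.inr hF⟩⟩

theorem exists_box_solution_fin {a b : Fin (m + 1) → ℝ} (hab : a ≤ b)
    {F : (Fin (m + 1) → ℝ) → Fin (m + 1) → ℝ} (hF : Continuous F) :
    ∃ x ∈ Set.Icc a b, ∀ i, (F x i < 0 → x i = b i) ∧ (0 < F x i → x i = a i) := by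
  choose x hx hxb y hy hyx hya using fun M : ℕ => exists_approx_solution hab F M.succ_pos
  obtain ⟨x₀, hx₀, φ, hφ, hlim⟩ := isCompact_Icc.tendsto_subseq hx
  have hyl : ∀ i, Filter.Tendsto (fun n => y (φ n) i) Filter.atTop (nhds x₀) := by
    intro i
    rw [tendsto_pi_nhds] at hlim ⊢
    intro j
    have h0 : Filter.Tendsto (fun n => y (φ n) i j - x (φ n) j) Filter.atTop (nhds 0) := by
      refine squeeze_zero_norm (fun n => hyx (φ n) i j) ?_
      have : Filter.Tendsto (fun n : ℕ => (b j - a j) / ((n.succ : ℕ) : ℝ)) Filter.atTop (nhds 0) :=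
        (tendsto_const_div_atTop_nhds_zero_nat (b j - a j)).comp (Filter.tendsto_add_atTop_nat 1)
      exact this.comp hφ.tendsto_atTop
    have := h0.add (hlim j)
    simpa using this
  have hFi : ∀ i, Continuous fun z => F z i := fun i => (continuous_apply i).comp hF
  refine ⟨x₀, hx₀, fun i => ⟨fun hneg => ?_, fun hpos => ?_⟩⟩
  · have h1 := (((hFi i).tendsto x₀).comp hlim).eventually_lt_const hneg
    have h2 : ∀ᶠ n in Filter.atTop, x (φ n) i = b i := by
      filter_upwards [h1] with n hn
      exact (hxb (φ n) i).resolve_right (not_le.2 hn)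
    exact tendsto_nhds_unique_of_eventuallyEq ((tendsto_pi_nhds.1 hlim) i) tendsto_const_nhds h2
  · have h1 := (((hFi i).tendsto x₀).comp (hyl i)).eventually_const_lt hpos
    have h2 : ∀ᶠ n in Filter.atTop, y (φ n) i i = a i := by
      filter_upwards [h1] with n hn
      exact (hya (φ n) i).resolve_right (not_le.2 hn)
    exact tendsto_nhds_unique_of_eventuallyEq ((tendsto_pi_nhds.1 (hyl i)) i) tendsto_const_nhds h2

/-- Variational inequalities on boxes have solutions. -/
theorem exists_box_solution {ι : Type*} [Finite ι] {a b : ι → ℝ} (hab : a ≤ b)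
    {F : (ι → ℝ) → ι → ℝ} (hF : Continuous F) :
    ∃ x ∈ Set.Icc a b, ∀ i, (F x i < 0 → x i = b i) ∧ (0 < F x i → x i = a i) := by
  obtain ⟨n, ⟨e⟩⟩ := Finite.exists_equiv_fin ι
  cases n with
  | zero => exact ⟨a, ⟨le_rfl, hab⟩, fun i => (e i).elim0⟩
  | succ m =>
    obtain ⟨x, ⟨hx1, hx2⟩, h⟩ := exists_box_solution_fin (a := a ∘ e.symm) (b := b ∘ e.symm)
      (fun i => hab _) (F := fun z => F (z ∘ e) ∘ e.symm) (by fun_prop)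
    refine ⟨x ∘ e, ⟨fun i => ?_, fun i => ?_⟩, fun i => ?_⟩
    · simpa using hx1 (e i)
    · simpa using hx2 (e i)
    · simpa using h (e i)

end KuhnCube

namespace SpillbackNetwork

variable {V E : Type} [Fintype V] [Fintype E] {N : SpillbackNetwork V E}

/-- Total value of `x` on the arcs entering `v`. -/
noncomputable def inSum (N : SpillbackNetwork V E) (x : E → ℝ) (v : V) : ℝ :=
  ∑ e ∈ univ.filter fun e => N.head e = v, x e

/-- Total value of `x` on the arcs leaving `v`. -/
noncomputable def outSum (N : SpillbackNetwork V E) (x : E → ℝ) (v : V) : ℝ :=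
  ∑ e ∈ univ.filter fun e => N.tail e = v, x e

/-- Derivatives of a Nash flow: flow rates `y`, label slopes `lam`, spillback factors `c`, for
active arcs `A`, resetting arcs `Q`, inflow bounds `b` and network inflow rate `R`. -/
structure Thin (N : SpillbackNetwork V E) (R : ℝ) (A Q : Set E) (b : E → ℝ)
    (y : E → ℝ) (lam c : V → ℝ) : Prop where
  nonneg : ∀ e, 0 ≤ y e
  eq_zero : ∀ e ∉ A, y e = 0
  cons : ∀ v ≠ N.s, N.inSum y v - N.outSum y v = if v = N.t then R else 0
  cons_source : N.s ≠ N.t → N.outSum y N.s = R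
  lam_nonneg : ∀ v, 0 ≤ lam v
  lam_source : lam N.s = 1
  c_mem : ∀ v, c v ∈ Set.Ioc (0 : ℝ) 1
  reset : ∀ e ∈ Q, y e = c (N.head e) * N.νout e * lam (N.head e)
  le_push : ∀ e, y e ≤ c (N.head e) * N.νout e * lam (N.head e)
  push : ∀ e ∈ A, lam (N.tail e) < lam (N.head e) →
    y e = c (N.head e) * N.νout e * lam (N.head e)
  unused : ∀ e ∈ A, e ∉ Q → lam (N.head e) < lam (N.tail e) → y e = 0
  stay : ∀ v ≠ N.s, ∃ e ∈ A, N.head e = v ∧ (e ∈ Q ∨ lam (N.tail e) ≤ lam v)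
  le_bound : ∀ e, y e ≤ b e * lam (N.tail e)
  tight : ∀ v, c v < 1 → ∃ e, N.tail e = v ∧ y e = b e * lam v

theorem outSum_nonneg {x : E → ℝ} (hx : ∀ e, 0 ≤ x e) (v : V) : 0 ≤ N.outSum x v :=
  sum_nonneg fun e _ => hx e

theorem le_inSum {x : E → ℝ} (hx : ∀ e, 0 ≤ x e) (e : E) : x e ≤ N.inSum x (N.head e) :=
  single_le_sum (f := x) (fun e _ => hx e) (by simp)

theorem le_outSum {x : E → ℝ} (hx : ∀ e, 0 ≤ x e) (e : E) : x e ≤ N.outSum x (N.tail e) :=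
  single_le_sum (f := x) (fun e _ => hx e) (by simp)

theorem sum_inSum (x : E → ℝ) (D : Finset V) :
    ∑ v ∈ D, N.inSum x v = ∑ e, if N.head e ∈ D then x e else 0 := by
  simp only [inSum, sum_filter]
  rw [sum_comm]
  refine sum_congr rfl fun e _ => ?_
  simp

theorem sum_outSum (x : E → ℝ) (D : Finset V) :
    ∑ v ∈ D, N.outSum x v = ∑ e, if N.tail e ∈ D then x e else 0 := by
  simp only [outSum, sum_filter]
  rw [sum_comm]
  refine sum_congr rfl fun e _ => ?_
  simp

/-- A flow on an acyclic set of arcs that loses at most `R` units, all of them at `t`, uses at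
most `R` units on every arc. -/
theorem le_of_net_le {x : E → ℝ} {A : Set E} {R : ℝ} (hx : ∀ e, 0 ≤ x e) (hR : 0 ≤ R)
    (hA : ∀ e ∉ A, x e = 0) {h : V → ℕ} (hh : ∀ e ∈ A, h (N.tail e) < h (N.head e))
    (hnet : ∀ v ≠ N.s, N.inSum x v - N.outSum x v ≤ if v = N.t then R else 0) (e : E) :
    x e ≤ R := by
  by_cases he : e ∈ A
  swap
  · rw [hA e he]; exact hR
  let D : Finset V := univ.filter fun w => w ≠ N.s ∧ h (N.head e) ≤ h w
  have h1 : ∑ v ∈ D, (N.inSum x v - N.outSum x v) ≤ R := by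
    calc _ ≤ ∑ v ∈ D, if v = N.t then R else 0 :=
          sum_le_sum fun v hv => hnet v (mem_filter.1 hv).2.1
      _ ≤ R := by
        rw [sum_ite_eq']; split_ifs <;> simp [hR]
  rw [sum_sub_distrib, sum_inSum, sum_outSum, ← sum_sub_distrib] at h1
  refine le_trans ?_ h1
  have hnn : ∀ e' : E, 0 ≤ (if N.head e' ∈ D then x e' else 0) -
      (if N.tail e' ∈ D then x e' else 0) := by
    intro e'
    by_cases he' : e' ∈ A
    swap
    · simp [hA e' he']
    by_cases ht : N.tail e' ∈ D
    · have : N.head e' ∈ D := by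
        have h1 := (mem_filter.1 ht).2.2
        have h2 := hh e' he'
        exact mem_filter.2 ⟨mem_univ _, N.no_into_source e', by omega⟩
      rw [if_pos ht, if_pos this]; simp
    · rw [if_neg ht]
      split_ifs <;> simp [hx e']
  have hval : x e = (if N.head e ∈ D then x e else 0) - (if N.tail e ∈ D then x e else 0) := by
    rw [if_pos (mem_filter.2 ⟨mem_univ _, N.no_into_source e, le_rfl⟩), if_neg, sub_zero]
    intro ht
    have h1 := (mem_filter.1 ht).2.2
    have h2 := hh e he
    omega
  calc x e = _ := hval
    _ ≤ _ := single_le_sum (f := fun e' => (if N.head e' ∈ D then x e' else 0) -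
      (if N.tail e' ∈ D then x e' else 0)) (fun e' _ => hnn e') (mem_univ e)

theorem outSum_source_eq {x : E → ℝ} {R : ℝ} (hst : N.s ≠ N.t)
    (hnet : ∀ v ≠ N.s, N.inSum x v - N.outSum x v = if v = N.t then R else 0) :
    N.outSum x N.s = R := by
  have h1 : ∑ v ∈ univ.erase N.s, (N.inSum x v - N.outSum x v) = R := by
    rw [sum_congr rfl fun v hv => hnet v (ne_of_mem_erase hv), sum_ite_eq',
      if_pos (mem_erase.2 ⟨hst.symm, mem_univ _⟩)]
  have h2 := add_sum_erase univ (fun v => N.inSum x v - N.outSum x v) (mem_univ N.s)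
  rw [h1, sum_sub_distrib, sum_inSum, sum_outSum] at h2
  have h3 : N.inSum x N.s = 0 := by
    rw [inSum, filter_false_of_mem fun e _ => N.no_into_source e]; simp
  simp only [mem_univ, if_true, sub_self] at h2
  linarith

/-- The fixed point problem behind thin flows: flow rates `x`, label slopes `l` and reciprocal
spillback factors `μ` solving the complementarity conditions, up to the labels of nodes that do
not receive any flow. -/
theorem exists_prethin {A Q : Set E} {b : E → ℝ} {R B : ℝ} 
    {h : V → ℕ} (hh : ∀ e ∈ A, h (N.tail e) < h (N.head e))
    (hin : ∀ v ≠ N.s, ∃ e ∈ A, N.head e = v) (hB : 0 < B) (hb : ∀ e, B ≤ b e)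
    (hν : ∀ e, B ≤ N.νout e) (hR : 0 ≤ R) (hs : ∀ e, N.tail e = N.s → R < b e) :
    ∃ (x : E → ℝ) (l μ : V → ℝ), (∀ e, 0 ≤ x e) ∧ (∀ e ∉ A, x e = 0) ∧
      (∀ v ≠ N.s, N.inSum x v - N.outSum x v = if v = N.t then R else 0) ∧
      (∀ v, 0 ≤ l v) ∧ (∀ v, l v ≤ 2 + R / B) ∧ l N.s = 1 ∧ (∀ v, 1 ≤ μ v) ∧ μ N.s = 1 ∧
      (∀ v, l v = 0 → N.inSum x v = 0) ∧
      (∀ e ∈ A, 0 < x e → l (N.head e) = if e ∈ Q then x e * μ (N.head e) / N.νout e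
        else max (l (N.tail e)) (x e * μ (N.head e) / N.νout e)) ∧
      (∀ e ∈ A, l (N.head e) ≤ if e ∈ Q then x e * μ (N.head e) / N.νout e
        else max (l (N.tail e)) (x e * μ (N.head e) / N.νout e)) ∧
      (∀ e, x e ≤ b e * l (N.tail e)) ∧
      (∀ v, 0 < l v → 1 < μ v → ∃ e, N.tail e = v ∧ x e = b e * l v) := by
  set L : ℝ := 2 + R / B with hL
  set M : ℝ := 2 + (∑ e, N.νout e) / B with hMdef
  have hRB : 0 ≤ R / B := div_nonneg hR hB.le
  have hsum0 : 0 ≤ ∑ e, N.νout e := sum_nonneg fun e _ => (N.νout_pos e).le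
  have hM1 : 1 < M := by have : 0 ≤ (∑ e, N.νout e) / B := div_nonneg hsum0 hB.le
                         linarith
  let lo : E ⊕ V ⊕ V → ℝ := Sum.elim (fun _ => 0)
    (Sum.elim (fun v => if v = N.s then 1 else 0) (fun _ => 1))
  let hi : E ⊕ V ⊕ V → ℝ := Sum.elim (fun e => if e ∈ A then R + 1 else 0)
    (Sum.elim (fun v => if v = N.s then 1 else L) (fun v => if v = N.s then 1 else M))
  let ρ : (E ⊕ V ⊕ V → ℝ) → E → ℝ := fun z e =>
    if e ∈ Q then z (.inl e) * z (.inr (.inr (N.head e))) / N.νout e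
    else max (z (.inr (.inl (N.tail e)))) (z (.inl e) * z (.inr (.inr (N.head e))) / N.νout e)
  let mx : (E ⊕ V ⊕ V → ℝ) → V → ℝ := fun z v =>
    (univ : Finset (Option E)).sup' ⟨none, mem_univ _⟩
      (fun o => o.elim 0 fun e => if N.tail e = v then z (.inl e) / b e else 0)
  let F : (E ⊕ V ⊕ V → ℝ) → E ⊕ V ⊕ V → ℝ := fun z => Sum.elim
    (fun e => ρ z e - z (.inr (.inl (N.head e))))
    (Sum.elim (fun v => N.inSum (fun e => z (.inl e)) v - N.outSum (fun e => z (.inl e)) v -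
        if v = N.t then R else 0)
      (fun v => z (.inr (.inl v)) - mx z v))
  have hF : Continuous F := by
    refine continuous_pi fun i => ?_
    rcases i with e | v | v
    · simp only [F, Sum.elim_inl, ρ]
      split_ifs <;> fun_prop
    · simp only [F, Sum.elim_inl, Sum.elim_inr, inSum, outSum]
      fun_prop
    · simp only [F, Sum.elim_inr, mx]
      refine Continuous.sub (by fun_prop) (Continuous.finset_sup'_apply _ fun o _ => ?_)
      cases o with
      | none => exact continuous_const
      | some e =>
        simp only [Option.elim]
        split_ifs <;> fun_prop
  have hlohi : lo ≤ hi := by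
    intro i
    rcases i with e | v | v <;> simp only [lo, hi, Sum.elim_inl, Sum.elim_inr] <;>
      split_ifs <;> linarith
  obtain ⟨z, ⟨hzlo, hzhi⟩, hz⟩ := KuhnCube.exists_box_solution hlohi hF
  set x : E → ℝ := fun e => z (.inl e) with hxdef
  set l : V → ℝ := fun v => z (.inr (.inl v)) with hldef
  set μ : V → ℝ := fun v => z (.inr (.inr v)) with hμdef
  have hx0 : ∀ e, 0 ≤ x e := fun e => hzlo (.inl e)
  have hxA : ∀ e ∉ A, x e = 0 := fun e he =>
    le_antisymm (by simpa [hi, he] using hzhi (.inl e)) (hx0 e)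
  have hls : l N.s = 1 :=
    le_antisymm (by simpa [hi] using hzhi (.inr (.inl N.s)))
      (by simpa [lo] using hzlo (.inr (.inl N.s)))
  have hl0 : ∀ v, 0 ≤ l v := by
    intro v
    refine le_trans ?_ (hzlo (.inr (.inl v)))
    simp only [lo, Sum.elim_inl, Sum.elim_inr]
    split_ifs <;> norm_num
  have hlL : ∀ v, l v ≤ L := by
    intro v
    refine (hzhi (.inr (.inl v))).trans ?_
    simp only [hi, Sum.elim_inl, Sum.elim_inr]
    split_ifs <;> linarith
  have hμ1 : ∀ v, 1 ≤ μ v := fun v => hzlo (.inr (.inr v))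
  have hμs : μ N.s = 1 :=
    le_antisymm (by simpa [hi] using hzhi (.inr (.inr N.s))) (hμ1 _)
  have hx : ∀ e, (ρ z e < l (N.head e) → x e = if e ∈ A then R + 1 else 0) ∧
      (l (N.head e) < ρ z e → x e = 0) := by
    intro e
    have := hz (.inl e)
    simp only [F, Sum.elim_inl, sub_neg, sub_pos, lo, hi] at this
    exact this
  have hl : ∀ v ≠ N.s, (N.inSum x v - N.outSum x v < (if v = N.t then R else 0) → l v = L) ∧
      ((if v = N.t then R else 0) < N.inSum x v - N.outSum x v → l v = 0) := by
    intro v hv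
    have := hz (.inr (.inl v))
    simp only [F, Sum.elim_inl, Sum.elim_inr, sub_neg, sub_pos, lo, hi, if_neg hv] at this
    exact this
  have hμ : ∀ v ≠ N.s, (l v < mx z v → μ v = M) ∧ (mx z v < l v → μ v = 1) := by
    intro v hv
    have := hz (.inr (.inr v))
    simp only [F, Sum.elim_inr, sub_neg, sub_pos, lo, hi, if_neg hv] at this
    exact this
  have hρdef : ∀ e, ρ z e = if e ∈ Q then x e * μ (N.head e) / N.νout e
    else max (l (N.tail e)) (x e * μ (N.head e) / N.νout e) := fun e => rfl
  have hρge : ∀ e, x e * μ (N.head e) / N.νout e ≤ ρ z e := by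
    intro e
    rw [hρdef]; split_ifs
    · exact le_rfl
    · exact le_max_right _ _
  have hin0 : ∀ v, l v = 0 → N.inSum x v = 0 := by
    intro v hv
    refine sum_eq_zero fun e he => ?_
    have hev : N.head e = v := (mem_filter.1 he).2
    by_contra hne
    have hpos : 0 < x e := lt_of_le_of_ne (hx0 e) (Ne.symm hne)
    refine hne ((hx e).2 ?_)
    rw [hev, hv]
    refine lt_of_lt_of_le ?_ (hρge e)
    exact div_pos (mul_pos hpos (by linarith [hμ1 (N.head e)])) (N.νout_pos e)
  have hnet : ∀ v ≠ N.s, N.inSum x v - N.outSum x v ≤ if v = N.t then R else 0 := by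
    intro v hv
    by_contra! hlt
    have h1 := hin0 v ((hl v hv).2 hlt)
    have h2 := outSum_nonneg (N := N) hx0 v
    have h3 : (0 : ℝ) ≤ if v = N.t then R else 0 := by split_ifs <;> simp [hR]
    linarith
  have hxR : ∀ e, x e ≤ R := le_of_net_le hx0 hR hxA hh hnet
  have hρl : ∀ e ∈ A, l (N.head e) ≤ ρ z e := by
    intro e he
    by_contra! hlt
    have := (hx e).1 hlt
    rw [if_pos he] at this
    linarith [hxR e]
  have hρl' : ∀ e ∈ A, 0 < x e → l (N.head e) = ρ z e := by
    intro e he hpos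
    refine le_antisymm (hρl e he) ?_
    by_contra! hlt
    linarith [(hx e).2 hlt]
  have hmx : ∀ v, 0 < mx z v → ∃ e, N.tail e = v ∧ x e = b e * mx z v := by
    intro v hv
    obtain ⟨o, -, ho⟩ := exists_mem_eq_sup' (s := (univ : Finset (Option E))) ⟨none, mem_univ _⟩
      (fun o => o.elim 0 fun e => if N.tail e = v then z (.inl e) / b e else 0)
    change mx z v = _ at ho
    cases o with
    | none => simp only [Option.elim] at ho; linarith
    | some e =>
      simp only [Option.elim] at ho
      split_ifs at ho with hev
      · refine ⟨e, hev, ?_⟩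
        rw [ho, mul_div_cancel₀]
        exact (hB.trans_le (hb e)).ne'
      · linarith
  have hlt : ∀ n v, h v = n → l v < L := by
    intro n
    induction n using Nat.strong_induction_on with
    | _ n ih =>
    intro v hvn
    by_cases hvs : v = N.s
    · rw [hvs, hls]; linarith
    refine lt_of_le_of_ne (hlL v) fun hvL => ?_
    obtain ⟨e, he, hev⟩ := hin v hvs
    have hu : l (N.tail e) < L := ih _ (by rw [← hvn, ← hev]; exact hh e he) _ rfl
    have h1 : L ≤ x e * μ v / N.νout e := by
      have := hρl e he
      rw [hρdef, hev, hvL] at this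
      split_ifs at this
      · exact this
      · exact (le_max_iff.1 this).resolve_left (not_le.2 hu)
    rw [le_div_iff₀ (N.νout_pos e)] at h1
    have hLB : ∀ q, B ≤ q → R < L * q := by
      intro q hq
      have : R / B * B = R := div_mul_cancel₀ _ hB.ne'
      have h2 : L * B ≤ L * q := mul_le_mul_of_nonneg_left hq (by linarith)
      nlinarith
    have h2 := hLB _ (hν e)
    have h3 := hxR e
    have hμv : 1 < μ v := by
      by_contra! hle
      have : x e * μ v ≤ x e * 1 := mul_le_mul_of_nonneg_left hle (hx0 e)
      linarith
    have h4 : L ≤ mx z v := by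
      by_contra! hlt
      rw [← hvL] at hlt
      linarith [(hμ v hvs).2 hlt]
    obtain ⟨e', -, he'⟩ := hmx v (by linarith)
    have h5 := hLB _ (hb e')
    have h6 : b e' * L ≤ b e' * mx z v :=
      mul_le_mul_of_nonneg_left h4 (hB.trans_le (hb e')).le
    linarith [hxR e']
  have hcons : ∀ v ≠ N.s, N.inSum x v - N.outSum x v = if v = N.t then R else 0 := by
    intro v hv
    refine le_antisymm (hnet v hv) ?_
    by_contra! h1
    exact (hlt _ v rfl).ne ((hl v hv).1 h1)
  have hpush : ∀ e, x e * μ (N.head e) ≤ N.νout e * l (N.head e) := by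
    intro e
    rcases (hx0 e).eq_or_lt with h0 | hpos
    · rw [← h0, zero_mul]; exact mul_nonneg (N.νout_pos e).le (hl0 _)
    · have heA : e ∈ A := by
        by_contra heA
        exact hpos.ne' (hxA e heA)
      have h1 := hρge e
      rw [← hρl' e heA hpos, div_le_iff₀ (N.νout_pos e)] at h1
      linarith
  have hout : ∀ v ≠ N.s, N.outSum x v ≤ N.inSum x v := by
    intro v hv
    have h3 : (0 : ℝ) ≤ if v = N.t then R else 0 := by split_ifs <;> simp [hR]
    linarith [hcons v hv]
  have hmxle : ∀ v ≠ N.s, mx z v ≤ l v := by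
    intro v hv
    by_contra! hlt'
    have hμM := (hμ v hv).1 hlt'
    obtain ⟨e, hev, he⟩ := hmx v ((hl0 v).trans_lt hlt')
    have hbe := hB.trans_le (hb e)
    have h1 : x e ≤ N.inSum x v := by
      rw [← hev]; exact (le_outSum hx0 e).trans (by rw [hev]; exact hout v hv)
    have h2 : N.inSum x v * M ≤ (∑ e, N.νout e) * l v := by
      rw [inSum, sum_mul, sum_mul]
      calc _ ≤ ∑ e ∈ univ.filter fun e => N.head e = v, N.νout e * l v := by
            refine sum_le_sum fun e' he' => ?_
            have := hpush e'
            rw [(mem_filter.1 he').2, hμM] at this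
            exact this
        _ ≤ _ := sum_le_sum_of_subset_of_nonneg (subset_univ _)
            fun e' _ _ => mul_nonneg (N.νout_pos e').le (hl0 _)
    have h3 : M * B = 2 * B + ∑ e, N.νout e := by
      rw [hMdef, add_mul, div_mul_cancel₀ _ hB.ne']
    have h4 : b e * mx z v * M ≤ (∑ e, N.νout e) * l v := by
      rw [← he]; exact (mul_le_mul_of_nonneg_right h1 (by linarith)).trans h2
    have h5 : B * mx z v * M ≤ b e * mx z v * M := by
      refine mul_le_mul_of_nonneg_right (mul_le_mul_of_nonneg_right (hb e) ?_) (by linarith)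
      linarith [hl0 v]
    have h6 : (∑ e, N.νout e) * l v ≤ (∑ e, N.νout e) * mx z v :=
      mul_le_mul_of_nonneg_left hlt'.le hsum0
    nlinarith [hl0 v]
  refine ⟨x, l, μ, hx0, hxA, hcons, hl0, hlL, hls, hμ1, hμs, hin0, hρl', hρl, ?_, ?_⟩
  · intro e
    by_cases hes : N.tail e = N.s
    · rw [hes, hls]; linarith [hxR e, hs e hes]
    · have h1 : x e / b e ≤ mx z (N.tail e) := by
        have := le_sup' (s := (univ : Finset (Option E)))
          (fun o => o.elim 0 fun e' => if N.tail e' = N.tail e then z (.inl e') / b e' else 0)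
          (mem_univ (some e))
        simp only [Option.elim, if_true] at this
        exact this
      have h2 := h1.trans (hmxle _ hes)
      rw [div_le_iff₀ (hB.trans_le (hb e))] at h2
      linarith
  · intro v hv hμv
    by_cases hvs : v = N.s
    · rw [hvs, hμs] at hμv; exact absurd hμv (lt_irrefl _)
    have h1 : l v ≤ mx z v := by
      by_contra! hlt'
      linarith [(hμ v hvs).2 hlt']
    have h2 := le_antisymm h1 (hmxle v hvs)
    rw [h2]
    exact hmx v (by linarith)

/-- Labels can be reassigned, from the sources of an acyclic arc set `A` on, at all nodes of `D`:
to `0` where `Q` requires it, and to the minimum of the labels of the predecessors elsewhere. -/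
theorem exists_label_reassignment {A Q : Set E} {h : V → ℕ}
    (hh : ∀ e ∈ A, h (N.tail e) < h (N.head e))
    (hin : ∀ v ≠ N.s, ∃ e ∈ A, N.head e = v) (l : V → ℝ) (D : Set V) (hD : N.s ∉ D) :
    ∃ g : V → ℝ, (∀ v ∉ D, g v = l v) ∧
      ∀ v ∈ D, (g v = 0 ∧ ∃ e ∈ A, N.head e = v ∧ e ∈ Q) ∨
        ((∀ e ∈ A, N.head e = v → e ∉ Q ∧ g v ≤ g (N.tail e)) ∧
          ∃ e ∈ A, N.head e = v ∧ g v = g (N.tail e)) := by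
  let Φ : (v : V) → ((u : V) → h u < h v → ℝ) → ℝ := fun v G =>
    if v ∈ D then
      if ∃ e ∈ A, N.head e = v ∧ e ∈ Q then 0
      else sInf {z | ∃ (u : V) (hu : h u < h v),
        (∃ e ∈ A, N.head e = v ∧ N.tail e = u) ∧ z = G u hu}
    else l v
  let g : V → ℝ := (measure h).wf.fix Φ
  have hg : ∀ v, g v = Φ v fun u _ => g u := fun v => (measure h).wf.fix_eq Φ v
  refine ⟨g, fun v hv => ?_, fun v hv => ?_⟩
  · rw [hg]; simp only [Φ, if_neg hv]
  · by_cases hQ : ∃ e ∈ A, N.head e = v ∧ e ∈ Q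
    · left
      refine ⟨?_, hQ⟩
      rw [hg]; simp only [Φ, if_pos hv, if_pos hQ]
    · right
      have hgv : g v = sInf {z | ∃ (u : V) (_ : h u < h v),
          (∃ e ∈ A, N.head e = v ∧ N.tail e = u) ∧ z = g u} := by
        rw [hg]; simp only [Φ, if_pos hv, if_neg hQ]
      set S := {z | ∃ (u : V) (_ : h u < h v),
          (∃ e ∈ A, N.head e = v ∧ N.tail e = u) ∧ z = g u} with hS
      have hfin : S.Finite := by
        refine (Set.finite_range g).subset ?_
        rintro z ⟨u, -, -, rfl⟩
        exact ⟨u, rfl⟩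
      have hne : S.Nonempty := by
        obtain ⟨e, he, hev⟩ := hin v (by rintro rfl; exact hD hv)
        exact ⟨_, N.tail e, by rw [← hev]; exact hh e he, ⟨e, he, hev, rfl⟩, rfl⟩
      constructor
      · intro e he hev
        refine ⟨fun heQ => hQ ⟨e, he, hev, heQ⟩, ?_⟩
        rw [hgv]
        exact csInf_le hfin.bddBelow
          ⟨N.tail e, by rw [← hev]; exact hh e he, ⟨e, he, hev, rfl⟩, rfl⟩
      · obtain ⟨u, -, ⟨e, he, hev, rfl⟩, hz⟩ := hne.csInf_mem hfin
        exact ⟨e, he, hev, hgv.trans hz⟩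

/-- Existence of spillback thin flows, with a bound on the label slopes. -/
theorem exists_thin {A Q : Set E} {b : E → ℝ} {R B : ℝ} (hQA : Q ⊆ A)
    {h : V → ℕ} (hh : ∀ e ∈ A, h (N.tail e) < h (N.head e))
    (hin : ∀ v ≠ N.s, ∃ e ∈ A, N.head e = v) (hB : 0 < B) (hb : ∀ e, B ≤ b e)
    (hν : ∀ e, B ≤ N.νout e) (hR : 0 ≤ R) (hs : ∀ e, N.tail e = N.s → R < b e) :
    ∃ y lam c, N.Thin R A Q b y lam c ∧ ∀ v, lam v ≤ 2 + R / B := by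
  obtain ⟨x, l, μ, hx0, hxA, hcons, hl0, hlL, hls, hμ1, hμs, hin0, hρeq, hρle, hxb, htight⟩ :=
    exists_prethin (N := N) (Q := Q) hh hin hB hb hν hR hs
  let D : Set V := {v | v ≠ N.s ∧ N.inSum x v = 0}
  have hDin : ∀ e, N.head e ∈ D → x e = 0 := fun e he =>
    le_antisymm ((le_inSum hx0 e).trans he.2.le) (hx0 e)
  have hDout : ∀ e, N.tail e ∈ D → x e = 0 := by
    intro e he
    have h1 := hcons _ he.1
    have h3 : (0 : ℝ) ≤ if N.tail e = N.t then R else 0 := by split_ifs <;> simp [hR]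
    have h4 := le_outSum (N := N) hx0 e
    have h5 := he.2
    linarith [hx0 e]
  obtain ⟨g, hgD, hg⟩ := exists_label_reassignment (Q := Q) hh hin l D (fun hD => hD.1 rfl)
  have hQin : ∀ e ∈ Q, N.head e ∈ D → l (N.head e) = 0 := by
    intro e he hD
    have := hρle e (hQA he)
    rw [if_pos he, hDin e hD, zero_mul, zero_div] at this
    exact le_antisymm this (hl0 _)
  have hbounds : ∀ n v, h v = n → l v ≤ g v ∧ g v ≤ 2 + R / B := by
    intro n
    induction n using Nat.strong_induction_on with
    | _ n ih =>
    intro v hvn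
    by_cases hv : v ∈ D
    · rcases hg v hv with ⟨h0, e, he, hev, heQ⟩ | ⟨h1, e, he, hev, heq⟩
      · have := hQin e heQ (hev ▸ hv)
        rw [hev] at this
        rw [h0, this]
        exact ⟨le_rfl, (hl0 v).trans (hlL v)⟩
      · obtain ⟨h2, h3⟩ := ih (h (N.tail e)) (by rw [← hvn, ← hev]; exact hh e he) _ rfl
        rw [heq]
        refine ⟨?_, h3⟩
        have h4 := hρle e he
        rw [if_neg (h1 e he hev).1, hDin e (hev ▸ hv), zero_mul, zero_div,
          max_eq_left (hl0 _), hev] at h4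
        exact h4.trans h2
    · rw [hgD v hv]; exact ⟨le_rfl, hlL v⟩
  have hlg : ∀ v, l v ≤ g v := fun v => (hbounds _ v rfl).1
  have hsD : N.s ∉ D := fun hD => hD.1 rfl
  let c : V → ℝ := fun v => if v ∈ D then 1 else (μ v)⁻¹
  have hcD : ∀ v ∉ D, c v = (μ v)⁻¹ := fun v hv => if_neg hv
  have hpush : ∀ e, N.head e ∉ D → (x e ≤ c (N.head e) * N.νout e * g (N.head e) ↔
      x e * μ (N.head e) / N.νout e ≤ l (N.head e)) ∧
      (c (N.head e) * N.νout e * g (N.head e) ≤ x e ↔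
        l (N.head e) ≤ x e * μ (N.head e) / N.νout e) := by
    intro e he
    have hμ := zero_lt_one.trans_le (hμ1 (N.head e))
    have hn := N.νout_pos e
    rw [hcD _ he, hgD _ he, div_le_iff₀ hn, le_div_iff₀ hn, mul_assoc, inv_mul_eq_div,
      le_div_iff₀ hμ, div_le_iff₀ hμ, mul_comm (l _)]
    exact ⟨Iff.rfl, Iff.rfl⟩
  have hle_push : ∀ e, x e ≤ c (N.head e) * N.νout e * g (N.head e) := by
    intro e
    have hnn : 0 ≤ c (N.head e) * N.νout e * g (N.head e) := by
      refine mul_nonneg (mul_nonneg ?_ (N.νout_pos e).le) ((hl0 _).trans (hlg _))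
      simp only [c]
      split_ifs
      · exact zero_le_one
      · exact inv_nonneg.2 (zero_le_one.trans (hμ1 _))
    rcases (hx0 e).eq_or_lt with h0 | hpos
    · rw [← h0]; exact hnn
    · have heA : e ∈ A := by
        by_contra heA; exact hpos.ne' (hxA e heA)
      have heD : N.head e ∉ D := fun hD => hpos.ne' (hDin e hD)
      rw [(hpush e heD).1, hρeq e heA hpos]
      split_ifs
      · exact le_rfl
      · exact le_max_right _ _
  refine ⟨x, g, c, ⟨hx0, hxA, hcons, fun hst => outSum_source_eq hst hcons,
    fun v => (hl0 v).trans (hlg v), ?_, ?_, ?_, hle_push, ?_, ?_, ?_, ?_, ?_⟩,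
    fun v => (hbounds _ v rfl).2⟩
  · rw [hgD _ hsD, hls]
  · intro v
    simp only [c]
    split_ifs
    · exact ⟨one_pos, le_rfl⟩
    · exact ⟨inv_pos.2 (zero_lt_one.trans_le (hμ1 v)), inv_le_one_of_one_le₀ (hμ1 v)⟩
  · intro e he
    refine le_antisymm (hle_push e) ?_
    by_cases hD : N.head e ∈ D
    · have h0 : g (N.head e) = 0 := by
        rcases hg _ hD with ⟨h0, -⟩ | ⟨h1, -⟩
        · exact h0
        · exact absurd he (h1 e (hQA he) rfl).1
      rw [h0, mul_zero]; exact hx0 e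
    · have := hρle e (hQA he)
      rw [if_pos he] at this
      exact (hpush e hD).2.2 this
  · intro e he hlt
    refine le_antisymm (hle_push e) ?_
    by_cases hD : N.head e ∈ D
    · rcases hg _ hD with ⟨h0, -⟩ | ⟨h1, -⟩
      · rw [h0, mul_zero]; exact hx0 e
      · exact absurd (h1 e he rfl).2 (not_le.2 hlt)
    · refine (hpush e hD).2.2 ?_
      have := hρle e he
      split_ifs at this
      · exact this
      · refine (le_max_iff.1 this).resolve_left ?_
        rw [hgD _ hD] at hlt
        exact not_le.2 ((hlg _).trans_lt hlt)
  · intro e he heQ hlt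
    by_contra hne
    have hpos := lt_of_le_of_ne (hx0 e) (Ne.symm hne)
    have heD : N.head e ∉ D := fun hD => hne (hDin e hD)
    have htD : N.tail e ∉ D := fun hD => hne (hDout e hD)
    have := hρeq e he hpos
    rw [if_neg heQ] at this
    rw [hgD _ heD, hgD _ htD, this] at hlt
    exact absurd (le_max_left _ _) (not_le.2 hlt)
  · intro v hv
    by_cases hD : v ∈ D
    · rcases hg _ hD with ⟨-, e, he, hev, heQ⟩ | ⟨-, e, he, hev, heq⟩
      · exact ⟨e, he, hev, Or.inl heQ⟩
      · exact ⟨e, he, hev, Or.inr heq.ge⟩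
    · have hne : N.inSum x v ≠ 0 := fun h0 => hD ⟨hv, h0⟩
      obtain ⟨e, he, hxe⟩ := exists_ne_zero_of_sum_ne_zero hne
      have hev := (mem_filter.1 he).2
      have hpos := lt_of_le_of_ne (hx0 e) (Ne.symm hxe)
      have heA : e ∈ A := by
        by_contra heA; exact hpos.ne' (hxA e heA)
      refine ⟨e, heA, hev, ?_⟩
      have htD : N.tail e ∉ D := fun hD => hpos.ne' (hDout e hD)
      have := hρeq e heA hpos
      split_ifs at this with hQ
      · exact Or.inl hQ
      · right
        rw [hgD _ hD, hgD _ htD, ← hev, this]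
        exact le_max_left _ _
  · intro e
    by_cases hD : N.tail e ∈ D
    · rw [hDout e hD]
      exact mul_nonneg (hB.le.trans (hb e)) ((hl0 _).trans (hlg _))
    · rw [hgD _ hD]; exact hxb e
  · intro v hv
    have hD : v ∉ D := by
      intro hD
      simp only [c, if_pos hD] at hv
      exact lt_irrefl _ hv
    rw [hcD _ hD] at hv
    have hμ : 1 < μ v := by
      by_contra! hle
      rw [le_antisymm hle (hμ1 v)] at hv
      norm_num at hv
    have hvs : v ≠ N.s := by
      rintro rfl
      rw [hμs] at hμ; exact lt_irrefl _ hμ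
    rw [hgD _ hD]
    refine htight v (lt_of_le_of_ne (hl0 v) fun h0 => hD ⟨hvs, hin0 v h0.symm⟩) hμ

/-- Lower bound on the spillback factors of a thin flow. -/
theorem Thin.exists_bound_le {R : ℝ} {A Q : Set E} {b y : E → ℝ} {lam c : V → ℝ}
    (hT : N.Thin R A Q b y lam c) (hR : 0 ≤ R) (hb : ∀ e, 0 < b e) {v : V} (hv : v ≠ N.s)
    (hlam : 0 < lam v) (hc : c v < 1) :
    ∃ e ∈ A, N.tail e = v ∧ b e ≤ c v * ∑ e, N.νout e := by
  obtain ⟨e, hev, he⟩ := hT.tight v hc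
  have hpos : 0 < y e := by rw [he]; exact mul_pos (hb e) hlam
  refine ⟨e, ?_, hev, ?_⟩
  · by_contra heA
    exact hpos.ne' (hT.eq_zero e heA)
  · have h1 : y e ≤ N.inSum y v := by
      have h2 := le_outSum (N := N) hT.nonneg e
      rw [hev] at h2
      have h3 : (0 : ℝ) ≤ if v = N.t then R else 0 := by split_ifs <;> simp [hR]
      linarith [hT.cons v hv]
    have h2 : N.inSum y v ≤ c v * (∑ e, N.νout e) * lam v := by
      rw [inSum, mul_sum, sum_mul]
      calc _ ≤ ∑ e ∈ univ.filter fun e => N.head e = v, c v * N.νout e * lam v := by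
            refine sum_le_sum fun e' he' => ?_
            have := hT.le_push e'
            rwa [(mem_filter.1 he').2] at this
        _ ≤ _ := sum_le_sum_of_subset_of_nonneg (subset_univ _)
            fun e' _ _ => mul_nonneg (mul_nonneg (hT.c_mem v).1.le (N.νout_pos e').le) hlam.le
    rw [he] at h1
    exact le_of_mul_le_mul_right (h1.trans h2) hlam

/-! ### Acyclicity and distances -/

/-- Arcs along which the potential `φ` grows by at least the transit time cannot be combined to a
directed cycle, so they have a topological numbering. -/
theorem exists_topological_numbering (N : SpillbackNetwork V E) (φ : V → ℝ) :
    ∃ h : V → ℕ, ∀ e, φ (N.tail e) + N.τ e ≤ φ (N.head e) → h (N.tail e) < h (N.head e) := by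
  let r : V → V → Prop := fun u v => ∃ e, N.tail e = u ∧ N.head e = v ∧ φ u + N.τ e ≤ φ v
  have key : ∀ u v, Relation.TransGen r u v → ∃ (l : List E) (hl : l ≠ []),
      l.IsChain (fun e e' => N.head e = N.tail e') ∧ N.tail (l.head hl) = u ∧
      N.head (l.getLast hl) = v ∧ φ u + (l.map N.τ).sum ≤ φ v := by
    intro u v huv
    induction huv using Relation.TransGen.head_induction_on with
    | single h =>
      obtain ⟨e, he, he', hle⟩ := h
      exact ⟨[e], by simp, by simp, by simpa using he, by simpa using he', by simpa using hle⟩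
    | head h _ ih =>
      obtain ⟨e, he, he', hle⟩ := h
      obtain ⟨l, hl, hch, hh, hlast, hs⟩ := ih
      refine ⟨e :: l, by simp, ?_, by simpa using he, ?_, ?_⟩
      · rw [List.isChain_cons]
        refine ⟨fun y hy => ?_, hch⟩
        rw [List.head?_eq_some_head hl] at hy
        simp only [Option.mem_some_iff] at hy
        rw [← hy, he', hh]
      · rw [List.getLast_cons hl, hlast]
      · simp only [List.map_cons, List.sum_cons]; linarith
  have hirr : ∀ u, ¬ Relation.TransGen r u u := by
    intro u hu
    obtain ⟨l, hl, hch, hh, hlast, hs⟩ := key u u hu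
    have := N.no_zero_cycle l hl hch (by rw [hlast, hh])
    linarith
  refine ⟨fun v => #{u | Relation.TransGen r u v}, fun e he => ?_⟩
  have hr : Relation.TransGen r (N.tail e) (N.head e) := .single ⟨e, rfl, rfl, he⟩
  refine card_lt_card ⟨fun u hu => ?_, fun hsub => ?_⟩
  · simp only [mem_filter, mem_univ, true_and] at hu ⊢
    exact hu.trans hr
  · have : N.tail e ∈ ({u | Relation.TransGen r u (N.tail e)} : Finset V) :=
      hsub (by simpa using hr)
    simp only [mem_filter, mem_univ, true_and] at this
    exact hirr _ this

theorem isWalk_append {l l' : List E} {u w : V} :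
    N.IsWalk u w (l ++ l') ↔ ∃ v, N.IsWalk u v l ∧ N.IsWalk v w l' := by
  induction l generalizing u with
  | nil => simp [IsWalk]
  | cons e l ih => simp [IsWalk, ih, and_assoc]

theorem isWalk_concat {l : List E} {e : E} {u w : V} :
    N.IsWalk u w (l ++ [e]) ↔ N.IsWalk u (N.tail e) l ∧ N.head e = w := by
  rw [isWalk_append]
  simp [IsWalk]

theorem exists_walk (N : SpillbackNetwork V E) (v : V) : ∃ l, N.IsWalk N.s v l := by
  induction N.reachable v with
  | refl => exact ⟨[], rfl⟩
  | tail _ h ih =>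
    obtain ⟨l, hl⟩ := ih
    obtain ⟨e, rfl, rfl⟩ := h
    exact ⟨l ++ [e], isWalk_concat.2 ⟨hl, rfl⟩⟩

/-- Distances from the source with respect to the transit times. -/
theorem exists_dist (N : SpillbackNetwork V E) : ∃ d : V → ℝ, d N.s = 0 ∧
    (∀ v, 0 ≤ d v) ∧ (∀ e, d (N.head e) ≤ d (N.tail e) + N.τ e) ∧
    ∀ v ≠ N.s, ∃ e, N.head e = v ∧ d (N.tail e) + N.τ e ≤ d v := by
  let S : V → Set ℝ := fun v => {z | ∃ l, N.IsWalk N.s v l ∧ (l.map N.τ).sum = z}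
  have hnn : ∀ l : List E, 0 ≤ (l.map N.τ).sum := fun l =>
    List.sum_nonneg (by simpa using fun e _ => N.τ_nonneg e)
  have hS : ∀ v, (S v).Nonempty := fun v => by
    obtain ⟨l, hl⟩ := N.exists_walk v
    exact ⟨_, l, hl, rfl⟩
  have hbdd : ∀ v, BddBelow (S v) := fun v => ⟨0, by rintro _ ⟨l, -, rfl⟩; exact hnn l⟩
  have hd0 : ∀ v, 0 ≤ sInf (S v) := fun v => le_csInf (hS v) (by rintro _ ⟨l, -, rfl⟩; exact hnn l)
  refine ⟨fun v => sInf (S v), ?_, hd0, fun e => ?_, fun v hv => ?_⟩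
  · exact le_antisymm (csInf_le (hbdd _) ⟨[], rfl, by simp⟩) (hd0 _)
  · rw [← sub_le_iff_le_add]
    refine le_csInf (hS _) ?_
    rintro _ ⟨l, hl, rfl⟩
    rw [sub_le_iff_le_add]
    exact csInf_le (hbdd _) ⟨l ++ [e], isWalk_concat.2 ⟨hl, rfl⟩, by simp⟩
  · by_contra! hcon
    have hlast : ∀ l, N.IsWalk N.s v l → ∃ l' e, l = l' ++ [e] ∧ N.IsWalk N.s (N.tail e) l' ∧
        N.head e = v := by
      intro l hl
      rcases List.eq_nil_or_concat' l with rfl | ⟨l', e, rfl⟩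
      · exact absurd hl.symm hv
      · exact ⟨l', e, rfl, isWalk_concat.1 hl⟩
    let T := (univ.filter fun e => N.head e = v).image fun e => sInf (S (N.tail e)) + N.τ e
    have hT : T.Nonempty := by
      obtain ⟨l, hl⟩ := N.exists_walk v
      obtain ⟨l', e, -, -, he⟩ := hlast l hl
      exact ⟨_, mem_image_of_mem _ (mem_filter.2 ⟨mem_univ _, he⟩)⟩
    obtain ⟨e, he, hmin⟩ := mem_image.1 (T.min'_mem hT)
    have h1 : T.min' hT ≤ sInf (S v) := by
      refine le_csInf (hS v) ?_
      rintro _ ⟨l, hl, rfl⟩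
      obtain ⟨l', e', rfl, hl', he'⟩ := hlast l hl
      have h2 : sInf (S (N.tail e')) ≤ (l'.map N.τ).sum := csInf_le (hbdd _) ⟨l', hl', rfl⟩
      have h3 := T.min'_le _ (mem_image_of_mem _ (mem_filter.2 ⟨mem_univ _, he'⟩))
      simp only [List.map_append, List.sum_append, List.map_cons, List.map_nil, List.sum_cons,
        List.sum_nil]
      linarith
    have h2 := hcon e (mem_filter.1 he).2
    rw [hmin] at h2
    linarith

/-- The distance of a node from the source with respect to the transit times. -/
noncomputable def dist (N : SpillbackNetwork V E) : V → ℝ := N.exists_dist.choose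

theorem dist_source : N.dist N.s = 0 := N.exists_dist.choose_spec.1

theorem dist_head_le (e : E) : N.dist (N.head e) ≤ N.dist (N.tail e) + N.τ e :=
  N.exists_dist.choose_spec.2.2.1 e

theorem exists_le_dist {v : V} (hv : v ≠ N.s) :
    ∃ e, N.head e = v ∧ N.dist (N.tail e) + N.τ e ≤ N.dist v :=
  N.exists_dist.choose_spec.2.2.2 v hv

/-! ### Right inverses of label functions -/

/-- The largest point at which the label function `ℓ` takes the value `θ`. -/
noncomputable def lastPreimage (ℓ : ℝ → ℝ) (θ : ℝ) : ℝ := sSup {ϑ | ℓ ϑ ≤ θ}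

/-- The properties of label functions needed for the calculus of their right inverses. -/
structure IsLabel (ℓ : ℝ → ℝ) : Prop where
  mono : Monotone ℓ
  cont : Continuous ℓ
  le_self : ∀ ϑ, ϑ ≤ ℓ ϑ
  unbounded : ∀ θ, ∃ ϑ, ℓ ϑ ≤ θ

namespace IsLabel

variable {ℓ : ℝ → ℝ} (h : IsLabel ℓ)
include h

theorem le_lastPreimage_iff {ϑ θ : ℝ} : ϑ ≤ lastPreimage ℓ θ ↔ ℓ ϑ ≤ θ := by
  have hb : BddAbove {ϑ | ℓ ϑ ≤ θ} := ⟨θ, fun ϑ hϑ => (h.le_self ϑ).trans hϑ⟩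
  have hc : IsClosed {ϑ | ℓ ϑ ≤ θ} := isClosed_le h.cont continuous_const
  have hm : ℓ (lastPreimage ℓ θ) ≤ θ := hc.csSup_mem (h.unbounded θ) hb
  exact ⟨fun hle => (h.mono hle).trans hm, fun hle => le_csSup hb hle⟩

theorem lastPreimage_lt_iff {ϑ θ : ℝ} : lastPreimage ℓ θ < ϑ ↔ θ < ℓ ϑ := by
  rw [← not_le, h.le_lastPreimage_iff, not_le]

theorem apply_lastPreimage (θ : ℝ) : ℓ (lastPreimage ℓ θ) = θ := by
  refine le_antisymm (h.le_lastPreimage_iff.1 le_rfl) ?_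
  refine ge_of_tendsto ((h.cont.tendsto _).mono_left nhdsWithin_le_nhds :
    Filter.Tendsto ℓ (nhdsWithin (lastPreimage ℓ θ) (Set.Ioi (lastPreimage ℓ θ))) _) ?_
  filter_upwards [self_mem_nhdsWithin] with ϑ hϑ
  exact (h.lastPreimage_lt_iff.1 hϑ).le

theorem lastPreimage_strictMono : StrictMono (lastPreimage ℓ) := fun θ θ' hlt => by
  rw [h.lastPreimage_lt_iff, h.apply_lastPreimage]; exact hlt

theorem lastPreimage_mono : Monotone (lastPreimage ℓ) := h.lastPreimage_strictMono.monotone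

theorem apply_eq_of_affine {ϑ ε lam : ℝ} (hlam : 0 < lam)
    (haff : ∀ δ ∈ Set.Icc 0 ε, ℓ (ϑ + δ) = ℓ ϑ + lam * δ) {η : ℝ} (hη : 0 ≤ η)
    (hη' : η < lam * ε) : lastPreimage ℓ (ℓ ϑ + η) = ϑ + η / lam := by
  have hlt : η / lam < ε := by rwa [div_lt_iff₀ hlam, mul_comm]
  have h0 : 0 ≤ η / lam := div_nonneg hη hlam.le
  refine le_antisymm ?_ ?_
  · refine le_of_forall_gt_imp_ge_of_dense fun z hz => ?_
    refine le_trans ?_ (min_le_left z (ϑ + ε))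
    refine (h.lastPreimage_lt_iff.2 ?_).le
    have hz' : ϑ + η / lam < min z (ϑ + ε) := lt_min hz (by linarith)
    have := haff (min z (ϑ + ε) - ϑ) ⟨by linarith, by linarith [min_le_right z (ϑ + ε)]⟩
    rw [add_sub_cancel] at this
    rw [this]
    have h3 : lam * (η / lam) = η := mul_div_cancel₀ _ hlam.ne'
    nlinarith
  · rw [h.le_lastPreimage_iff, haff _ ⟨h0, hlt.le⟩, mul_div_cancel₀ _ hlam.ne']

end IsLabel

/-! ### Trajectories -/

/-- Node labels and arc flows as functions of the departure time from the source. -/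
structure Traj (V E : Type) where
  /-- The arrival time at a node. -/
  ell : V → ℝ → ℝ
  /-- The amount of flow entering an arc until the arrival time at its tail. -/
  x : E → ℝ → ℝ

/-- Admissible increments of labels and flows over a period of length `h`. -/
structure Incr (N : SpillbackNetwork V E) (K : ℝ) (dl : V → ℝ) (dx : E → ℝ) (h : ℝ) : Prop where
  nonneg : ∀ v, 0 ≤ dl v
  le : ∀ v, dl v ≤ K * h
  source : dl N.s = h
  flow_nonneg : ∀ e, 0 ≤ dx e
  flow_le_in : ∀ e, dx e ≤ N.νin e * dl (N.tail e)
  flow_le_out : ∀ e, dx e ≤ N.νout e * dl (N.head e)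

theorem Incr.add {K : ℝ} {dl dl' : V → ℝ} {dx dx' : E → ℝ} {h h' : ℝ} (H : N.Incr K dl dx h)
    (H' : N.Incr K dl' dx' h') : N.Incr K (dl + dl') (dx + dx') (h + h') where
  nonneg v := add_nonneg (H.nonneg v) (H'.nonneg v)
  le v := by rw [mul_add]; exact add_le_add (H.le v) (H'.le v)
  source := by rw [Pi.add_apply, H.source, H'.source]
  flow_nonneg e := add_nonneg (H.flow_nonneg e) (H'.flow_nonneg e)
  flow_le_in e := by
    rw [Pi.add_apply, Pi.add_apply, mul_add]; exact add_le_add (H.flow_le_in e) (H'.flow_le_in e)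
  flow_le_out e := by
    rw [Pi.add_apply, Pi.add_apply, mul_add]; exact add_le_add (H.flow_le_out e) (H'.flow_le_out e)

theorem Incr.smul {K : ℝ} {dl : V → ℝ} {dx : E → ℝ} {h : ℝ} (H : N.Incr K dl dx h) {k : ℝ}
    (hk : 0 ≤ k) : N.Incr K (k • dl) (k • dx) (k * h) where
  nonneg v := mul_nonneg hk (H.nonneg v)
  le v := by
    have := mul_le_mul_of_nonneg_left (H.le v) hk
    simp only [Pi.smul_apply, smul_eq_mul]; linarith
  source := by rw [Pi.smul_apply, H.source, smul_eq_mul]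
  flow_nonneg e := mul_nonneg hk (H.flow_nonneg e)
  flow_le_in e := by
    have := mul_le_mul_of_nonneg_left (H.flow_le_in e) hk
    simp only [Pi.smul_apply, smul_eq_mul]; linarith
  flow_le_out e := by
    have := mul_le_mul_of_nonneg_left (H.flow_le_out e) hk
    simp only [Pi.smul_apply, smul_eq_mul]; linarith

theorem isClosed_incr (N : SpillbackNetwork V E) (K : ℝ) :
    IsClosed {p : (V → ℝ) × (E → ℝ) × ℝ | N.Incr K p.1 p.2.1 p.2.2} := by
  have : {p : (V → ℝ) × (E → ℝ) × ℝ | N.Incr K p.1 p.2.1 p.2.2} =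
      (⋂ v, {p | 0 ≤ p.1 v}) ∩ (⋂ v, {p | p.1 v ≤ K * p.2.2}) ∩ {p | p.1 N.s = p.2.2} ∩
      (⋂ e, {p | 0 ≤ p.2.1 e}) ∩ (⋂ e, {p | p.2.1 e ≤ N.νin e * p.1 (N.tail e)}) ∩
      (⋂ e, {p | p.2.1 e ≤ N.νout e * p.1 (N.head e)}) := by
    ext p
    simp only [Set.mem_inter_iff, Set.mem_iInter, Set.mem_ofPred_eq]
    exact ⟨fun H => ⟨⟨⟨⟨⟨H.1, H.2⟩, H.3⟩, H.4⟩, H.5⟩, H.6⟩,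
      fun ⟨⟨⟨⟨⟨h1, h2⟩, h3⟩, h4⟩, h5⟩, h6⟩ => ⟨h1, h2, h3, h4, h5, h6⟩⟩
  rw [this]
  refine ((((IsClosed.inter ?_ ?_).inter ?_).inter ?_).inter ?_).inter ?_
  · exact isClosed_iInter fun v => isClosed_le (by fun_prop) (by fun_prop)
  · exact isClosed_iInter fun v => isClosed_le (by fun_prop) (by fun_prop)
  · exact isClosed_eq (by fun_prop) (by fun_prop)
  · exact isClosed_iInter fun v => isClosed_le (by fun_prop) (by fun_prop)
  · exact isClosed_iInter fun v => isClosed_le (by fun_prop) (by fun_prop)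
  · exact isClosed_iInter fun v => isClosed_le (by fun_prop) (by fun_prop)

/-- The increment of a trajectory between two times is admissible. -/
def Traj.IncrOn (γ : Traj V E) (N : SpillbackNetwork V E) (K : ℝ) (a b : ℝ) : Prop :=
  N.Incr K (fun v => γ.ell v b - γ.ell v a) (fun e => γ.x e b - γ.x e a) (b - a)

/-- Trajectories with admissible increments and the correct initial values, all of whose nodes
are reached, on a set of times. -/
structure Traj.IsOn (γ : Traj V E) (N : SpillbackNetwork V E) (K : ℝ) (S : Set ℝ) : Prop where
  incr : ∀ a ∈ S, ∀ b ∈ S, a ≤ b → γ.IncrOn N K a b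
  init_ell : ∀ a ∈ S, a ≤ 0 → ∀ v, γ.ell v a = N.dist v + a
  init_x : ∀ a ∈ S, a ≤ 0 → ∀ e, γ.x e a = 0
  enter : ∀ a ∈ S, ∀ v ≠ N.s, ∃ e, N.head e = v ∧ γ.ell (N.tail e) a + N.τ e ≤ γ.ell v a

namespace Traj

/-- Two trajectories agree before time `Θ`. -/
def Agree (Θ : ℝ) (γ γ' : Traj V E) : Prop :=
  ∀ ϑ < Θ, (∀ v, γ.ell v ϑ = γ'.ell v ϑ) ∧ ∀ e, γ.x e ϑ = γ'.x e ϑ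

/-- Continue a trajectory linearly after time `Θ`. -/
noncomputable def append (γ : Traj V E) (Θ : ℝ) (lam : V → ℝ) (y : E → ℝ) : Traj V E where
  ell v ϑ := γ.ell v (min ϑ Θ) + max (ϑ - Θ) 0 * lam v
  x e ϑ := γ.x e (min ϑ Θ) + max (ϑ - Θ) 0 * y e

variable {γ : Traj V E} {K : ℝ}

omit [Fintype V] [Fintype E] in
theorem append_ell_of_le {Θ ϑ : ℝ} {lam : V → ℝ} {y : E → ℝ} (h : ϑ ≤ Θ) (v : V) :
    (γ.append Θ lam y).ell v ϑ = γ.ell v ϑ := by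
  simp [append, h]

omit [Fintype V] [Fintype E] in
theorem append_x_of_le {Θ ϑ : ℝ} {lam : V → ℝ} {y : E → ℝ} (h : ϑ ≤ Θ) (e : E) :
    (γ.append Θ lam y).x e ϑ = γ.x e ϑ := by
  simp [append, h]

omit [Fintype V] [Fintype E] in
theorem append_ell_add {Θ δ : ℝ} {lam : V → ℝ} {y : E → ℝ} (h : 0 ≤ δ) (v : V) :
    (γ.append Θ lam y).ell v (Θ + δ) = γ.ell v Θ + lam v * δ := by
  simp [append, h, mul_comm]

omit [Fintype V] [Fintype E] in
theorem append_x_add {Θ δ : ℝ} {lam : V → ℝ} {y : E → ℝ} (h : 0 ≤ δ) (e : E) :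
    (γ.append Θ lam y).x e (Θ + δ) = γ.x e Θ + y e * δ := by
  simp [append, h, mul_comm]

theorem append_incrOn {Θ : ℝ} {lam : V → ℝ} {y : E → ℝ} (hγ : γ.IsOn N K (Set.Iic Θ))
    (hl : N.Incr K lam y 1) {a b : ℝ} (hab : a ≤ b) : (γ.append Θ lam y).IncrOn N K a b := by
  have h1 := hγ.incr (min a Θ) (Set.mem_Iic.2 (min_le_right _ _)) (min b Θ)
    (Set.mem_Iic.2 (min_le_right _ _))
    (min_le_min_right _ hab)
  have h2 : 0 ≤ max (b - Θ) 0 - max (a - Θ) 0 := sub_nonneg.2 (max_le_max_right _ (by linarith))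
  have h3 := Incr.add h1 (hl.smul h2)
  have hm : ∀ z : ℝ, min z Θ + max (z - Θ) 0 = z := by
    intro z
    rcases le_total z Θ with h | h
    · rw [min_eq_left h, max_eq_right (by linarith)]; ring
    · rw [min_eq_right h, max_eq_left (by linarith)]; ring
  have e1 : min b Θ - min a Θ + (max (b - Θ) 0 - max (a - Θ) 0) * 1 = b - a := by
    linarith [hm a, hm b]
  rw [e1] at h3
  unfold IncrOn
  convert h3 using 1
  · funext v; simp only [append, Pi.add_apply, Pi.smul_apply, smul_eq_mul]; ring
  · funext v; simp only [append, Pi.add_apply, Pi.smul_apply, smul_eq_mul]; ring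

theorem IsOn.append {Θ : ℝ} {lam : V → ℝ} {y : E → ℝ} (hγ : γ.IsOn N K (Set.Iic Θ))
    (hl : N.Incr K lam y 1) (hΘ : 0 ≤ Θ) {S : Set ℝ} (henter : ∀ δ > 0, Θ + δ ∈ S → ∀ v ≠ N.s, ∃ e,
      N.head e = v ∧ γ.ell (N.tail e) Θ + lam (N.tail e) * δ + N.τ e ≤ γ.ell v Θ + lam v * δ) :
    (γ.append Θ lam y).IsOn N K S where
  incr a _ b _ hab := append_incrOn hγ hl hab
  init_ell a ha ha0 v := by
    rw [append_ell_of_le (ha0.trans hΘ)]; exact hγ.init_ell a (ha0.trans hΘ) ha0 v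
  init_x a ha ha0 e := by
    rw [append_x_of_le (ha0.trans hΘ)]; exact hγ.init_x a (ha0.trans hΘ) ha0 e
  enter a ha v hv := by
    rcases le_or_gt a Θ with h | h
    · obtain ⟨e, he, hle⟩ := hγ.enter a h v hv
      exact ⟨e, he, by rwa [append_ell_of_le h, append_ell_of_le h]⟩
    · obtain ⟨δ, hδ, rfl⟩ : ∃ δ, 0 < δ ∧ a = Θ + δ := ⟨a - Θ, by linarith, by ring⟩
      obtain ⟨e, he, hle⟩ := henter δ hδ ha v hv
      refine ⟨e, he, ?_⟩
      rw [append_ell_add hδ.le, append_ell_add hδ.le]; linarith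

theorem IsOn.mono {S S' : Set ℝ} (h : γ.IsOn N K S) (hS : S' ⊆ S) : γ.IsOn N K S' where
  incr a ha b hb := h.incr a (hS ha) b (hS hb)
  init_ell a ha := h.init_ell a (hS ha)
  init_x a ha := h.init_x a (hS ha)
  enter a ha := h.enter a (hS ha)

theorem incr_const (hK : 1 ≤ K) : N.Incr K (fun _ => 1) (fun _ => 0) 1 where
  nonneg _ := zero_le_one
  le _ := by simpa using hK
  source := rfl
  flow_nonneg _ := le_rfl
  flow_le_in e := by simpa using (N.νin_pos e).le
  flow_le_out e := by simpa using (N.νout_pos e).le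

theorem IsOn.extend_univ (hK : 1 ≤ K) {Θ : ℝ} (hΘ : 0 ≤ Θ) (hγ : γ.IsOn N K (Set.Iic Θ)) :
    (γ.append Θ (fun _ => 1) (fun _ => 0)).IsOn N K Set.univ := by
  refine hγ.append (incr_const hK) hΘ fun δ _ _ v hv => ?_
  obtain ⟨e, he, hle⟩ := hγ.enter Θ (Set.mem_Iic.2 le_rfl) v hv
  exact ⟨e, he, by linarith⟩

theorem exists_continuous_extension {f : ℝ → ℝ} {S : Set ℝ} {C : ℝ}
    (h : ∀ a ∈ S, ∀ b ∈ S, a ≤ b → 0 ≤ f b - f a ∧ f b - f a ≤ C * (b - a)) :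
    ∃ g, Continuous g ∧ Set.EqOn f g S := by
  have : LipschitzOnWith (Real.toNNReal C) f S := by
    refine LipschitzOnWith.of_dist_le_mul fun a ha b hb => ?_
    wlog hab : a ≤ b generalizing a b
    · rw [_root_.dist_comm, _root_.dist_comm a b]; exact this b hb a ha (le_of_not_ge hab)
    have := h a ha b hb hab
    rw [_root_.dist_comm, _root_.dist_comm a b, Real.dist_eq, Real.dist_eq, abs_of_nonneg this.1,
      abs_of_nonneg (sub_nonneg.2 hab)]
    exact this.2.trans (mul_le_mul_of_nonneg_right (Real.le_coe_toNNReal C) (sub_nonneg.2 hab))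
  obtain ⟨g, hg, hfg⟩ := this.extend_real
  exact ⟨g, hg.continuous, hfg⟩

theorem IsOn.ell_lip {S : Set ℝ} (hγ : γ.IsOn N K S) (v : V) : ∀ a ∈ S, ∀ b ∈ S, a ≤ b →
    0 ≤ γ.ell v b - γ.ell v a ∧ γ.ell v b - γ.ell v a ≤ K * (b - a) := fun a ha b hb hab =>
  ⟨(hγ.incr a ha b hb hab).nonneg v, (hγ.incr a ha b hb hab).le v⟩

theorem IsOn.x_lip {S : Set ℝ} (hγ : γ.IsOn N K S) (e : E) : ∀ a ∈ S, ∀ b ∈ S, a ≤ b →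
    0 ≤ γ.x e b - γ.x e a ∧ γ.x e b - γ.x e a ≤ N.νin e * K * (b - a) := fun a ha b hb hab => by
  have H := hγ.incr a ha b hb hab
  refine ⟨H.flow_nonneg e, (H.flow_le_in e).trans ?_⟩
  rw [mul_assoc]
  exact mul_le_mul_of_nonneg_left (H.le _) (N.νin_pos e).le

/-- A trajectory on an open ray extends to all times. -/
theorem IsOn.exists_extension (hK : 1 ≤ K) {Θ : ℝ} (hΘ : 0 ≤ Θ) (hγ : γ.IsOn N K (Set.Iio Θ)) :
    ∃ γ' : Traj V E, γ'.IsOn N K Set.univ ∧ Agree Θ γ γ' := by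
  choose ell hc heq using fun v => exists_continuous_extension (hγ.ell_lip v)
  choose x hcx heqx using fun e => exists_continuous_extension (hγ.x_lip e)
  let γ' : Traj V E := ⟨ell, x⟩
  have hag : Agree Θ γ γ' := fun ϑ hϑ => ⟨fun v => heq v hϑ, fun e => heqx e hϑ⟩
  have hlim : ∀ a : ℝ, Filter.Tendsto (fun δ : ℝ => a - δ) (nhdsWithin 0 (Set.Ioi 0)) (nhds a) := by
    intro a
    have : Continuous fun δ : ℝ => a - δ := by fun_prop
    simpa using (this.tendsto 0).mono_left (nhdsWithin_le_nhds (s := Set.Ioi 0))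
  have hclosed : IsClosed {a | ∀ v ≠ N.s, ∃ e, N.head e = v ∧
      ell (N.tail e) a + N.τ e ≤ ell v a} := by
    have : {a | ∀ v ≠ N.s, ∃ e, N.head e = v ∧ ell (N.tail e) a + N.τ e ≤ ell v a} =
      ⋂ v, ⋂ (_ : v ≠ N.s), ⋃ e, ⋃ (_ : N.head e = v),
        {a | ell (N.tail e) a + N.τ e ≤ ell v a} := by
      ext a; simp
    rw [this]
    refine isClosed_iInter fun v => isClosed_iInter fun _ => isClosed_iUnion_of_finite fun e =>
      isClosed_iUnion_of_finite fun _ => isClosed_le ((hc _).add continuous_const) (hc _)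
  have h0 : ∀ a ≤ Θ, ∀ᶠ δ in nhdsWithin (0 : ℝ) (Set.Ioi 0), a - δ < Θ := fun a ha => by
    filter_upwards [self_mem_nhdsWithin] with δ hδ
    have : 0 < δ := hδ
    linarith
  have hin : γ'.IsOn N K (Set.Iic Θ) := by
    refine ⟨fun a ha b hb hab => ?_, fun a ha ha0 v => ?_, fun a ha ha0 e => ?_, fun a ha => ?_⟩
    · let F : ℝ → (V → ℝ) × (E → ℝ) × ℝ := fun δ => (fun v => ell v (b - δ) - ell v (a - δ),
        fun e => x e (b - δ) - x e (a - δ), b - a)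
      let p : (V → ℝ) × (E → ℝ) × ℝ := (fun v => ell v b - ell v a, fun e => x e b - x e a, b - a)
      have hF : Filter.Tendsto F (nhdsWithin 0 (Set.Ioi 0)) (nhds p) := ?_
      · refine (isClosed_incr N K).mem_of_tendsto hF ?_
        filter_upwards [h0 a ha, h0 b hb] with δ h1 h2
        have := hγ.incr (a - δ) h1 (b - δ) h2 (by linarith)
        unfold IncrOn at this
        simp only [(hag _ h1).1, (hag _ h2).1, (hag _ h1).2, (hag _ h2).2] at this
        rw [sub_sub_sub_cancel_right] at this
        exact this
      · refine Filter.Tendsto.prodMk_nhds (tendsto_pi_nhds.2 fun v => ?_)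
          (Filter.Tendsto.prodMk_nhds (tendsto_pi_nhds.2 fun e => ?_) tendsto_const_nhds)
        · exact (((hc v).tendsto b).comp (hlim b)).sub (((hc v).tendsto a).comp (hlim a))
        · exact (((hcx e).tendsto b).comp (hlim b)).sub (((hcx e).tendsto a).comp (hlim a))
    · refine tendsto_nhds_unique (((hc v).tendsto a).comp (hlim a)) ?_
      refine (tendsto_const_nhds.add (hlim a)).congr' ?_
      filter_upwards [h0 a ha, self_mem_nhdsWithin] with δ h1 h2
      have h2 : 0 < δ := h2
      have := hγ.init_ell (a - δ) h1 (by linarith) v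
      rw [(hag _ h1).1] at this
      exact this.symm
    · refine tendsto_nhds_unique (((hcx e).tendsto a).comp (hlim a)) ?_
      refine tendsto_const_nhds.congr' ?_
      filter_upwards [h0 a ha, self_mem_nhdsWithin] with δ h1 h2
      have h2 : 0 < δ := h2
      have := hγ.init_x (a - δ) h1 (by linarith) e
      rw [(hag _ h1).2] at this
      exact this.symm
    · refine hclosed.mem_of_tendsto (hlim a) ?_
      filter_upwards [h0 a ha] with δ h1 v hv
      have := hγ.enter (a - δ) h1 v hv
      simpa only [(hag _ h1).1] using this
  refine ⟨_, hin.extend_univ hK hΘ, fun ϑ hϑ => ⟨fun v => ?_, fun e => ?_⟩⟩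
  · rw [append_ell_of_le hϑ.le]; exact (hag ϑ hϑ).1 v
  · rw [append_x_of_le hϑ.le]; exact (hag ϑ hϑ).2 e

section Univ

variable (hγ : γ.IsOn N K Set.univ)
include hγ

theorem IsOn.ell_mono (v : V) : Monotone (γ.ell v) := fun a b hab =>
  sub_nonneg.1 (hγ.ell_lip v a trivial b trivial hab).1

theorem IsOn.x_mono (e : E) : Monotone (γ.x e) := fun a b hab =>
  sub_nonneg.1 (hγ.x_lip e a trivial b trivial hab).1

theorem IsOn.ell_cont (v : V) : Continuous (γ.ell v) := by
  obtain ⟨g, hg, h⟩ := exists_continuous_extension (hγ.ell_lip v)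
  rwa [(Set.eqOn_univ _ _).1 h]

theorem IsOn.x_cont (e : E) : Continuous (γ.x e) := by
  obtain ⟨g, hg, h⟩ := exists_continuous_extension (hγ.x_lip e)
  rwa [(Set.eqOn_univ _ _).1 h]

theorem IsOn.ell_source (ϑ : ℝ) : γ.ell N.s ϑ = ϑ := by
  have h0 := hγ.init_ell (min ϑ 0) trivial (min_le_right _ _) N.s
  have h1 := (hγ.incr (min ϑ 0) trivial ϑ trivial (min_le_left _ _)).source
  rw [dist_source] at h0
  linarith

theorem IsOn.le_ell (v : V) (ϑ : ℝ) : ϑ ≤ γ.ell v ϑ := by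
  obtain ⟨h, hh⟩ := N.exists_topological_numbering fun v => γ.ell v ϑ
  induction hn : h v using Nat.strong_induction_on generalizing v with
  | _ n ih =>
    by_cases hv : v = N.s
    · rw [hv, hγ.ell_source]
    · obtain ⟨e, rfl, hle⟩ := hγ.enter ϑ trivial v hv
      have := ih _ (hn ▸ hh e hle) _ rfl
      linarith [N.τ_nonneg e]

theorem IsOn.isLabel (v : V) : IsLabel (γ.ell v) where
  mono := hγ.ell_mono v
  cont := hγ.ell_cont v
  le_self := hγ.le_ell v
  unbounded θ := ⟨min 0 (θ - N.dist v), by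
    rw [hγ.init_ell _ trivial (min_le_left _ _)]; linarith [min_le_right 0 (θ - N.dist v)]⟩

end Univ

end Traj

theorem hasDerivWithinAt_of_affine {f : ℝ → ℝ} {θ s η₀ : ℝ} (hη : 0 < η₀)
    (h : ∀ η, 0 ≤ η → η < η₀ → f (θ + η) = f θ + s * η) :
    HasDerivWithinAt f s (Set.Ici θ) θ := by
  have h1 : HasDerivWithinAt (fun z => f θ + s * (z - θ)) s (Set.Ici θ) θ := by
    have := ((((hasDerivAt_id θ).sub_const θ).const_mul s).const_add (f θ)).hasDerivWithinAt
      (s := Set.Ici θ)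
    simpa using this
  refine h1.congr_of_eventuallyEq ?_ (by simp)
  filter_upwards [Ico_mem_nhdsGE (show θ < θ + η₀ by linarith)] with z hz
  have := h (z - θ) (by linarith [hz.1]) (by linarith [hz.2])
  rwa [add_sub_cancel] at this

theorem derivWithin_of_affine {f : ℝ → ℝ} {θ s η₀ : ℝ} (hη : 0 < η₀)
    (h : ∀ η, 0 ≤ η → η < η₀ → f (θ + η) = f θ + s * η) :
    derivWithin f (Set.Ici θ) θ = s :=
  (hasDerivWithinAt_of_affine hη h).derivWithin (uniqueDiffWithinAt_Ici θ)

namespace Traj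

/-- The amount of flow that has entered an arc, as a function of the time at its tail. -/
noncomputable def cumIn (γ : Traj V E) (N : SpillbackNetwork V E) (e : E) (θ : ℝ) : ℝ :=
  γ.x e (lastPreimage (γ.ell (N.tail e)) θ)

/-- The amount of flow that has left an arc. -/
noncomputable def cumOut (γ : Traj V E) (N : SpillbackNetwork V E) (e : E) (θ : ℝ) : ℝ :=
  γ.x e (lastPreimage (γ.ell (N.head e)) θ)

/-- The load of an arc at the arrival time at its tail. -/
noncomputable def load (γ : Traj V E) (N : SpillbackNetwork V E) (e : E) (ϑ : ℝ) : ℝ :=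
  γ.x e ϑ - γ.cumOut N e (γ.ell (N.tail e) ϑ)

/-- The arc is full at the arrival time at its tail. -/
def Full (γ : Traj V E) (N : SpillbackNetwork V E) (e : E) (ϑ : ℝ) : Prop :=
  N.σ e ≤ (γ.load N e ϑ : EReal)

/-- The inflow bound at the arrival time at the tail. -/
noncomputable def bound (γ : Traj V E) (N : SpillbackNetwork V E) (ϑ : ℝ) (e : E) : ℝ :=
  if γ.Full N e ϑ then min (derivWithin (γ.cumOut N e) (Set.Ici (γ.ell (N.tail e) ϑ))
    (γ.ell (N.tail e) ϑ)) (N.νin e) else N.νin e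

/-- The arcs on currently shortest paths. -/
def active (γ : Traj V E) (N : SpillbackNetwork V E) (ϑ : ℝ) : Set E :=
  {e | γ.ell (N.tail e) ϑ + N.τ e ≤ γ.ell (N.head e) ϑ}

/-- The arcs with a queue. -/
def queued (γ : Traj V E) (N : SpillbackNetwork V E) (ϑ : ℝ) : Set E :=
  {e | γ.ell (N.tail e) ϑ + N.τ e < γ.ell (N.head e) ϑ}

/-- The number of nodes that are reached after `v`. -/
noncomputable def rank (γ : Traj V E) (v : V) (ϑ : ℝ) : ℕ := #{w | γ.ell v ϑ < γ.ell w ϑ}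

/-- The trajectory is affine on `[ϑ, ϑ + ε]`, its slopes being a thin flow. -/
structure Piece (γ : Traj V E) (N : SpillbackNetwork V E) (κ ϑ ε : ℝ) (y : E → ℝ)
    (lam c : V → ℝ) : Prop where
  pos : 0 < ε
  ell_eq : ∀ v, ∀ δ ∈ Set.Icc 0 ε, γ.ell v (ϑ + δ) = γ.ell v ϑ + lam v * δ
  x_eq : ∀ e, ∀ δ ∈ Set.Icc 0 ε, γ.x e (ϑ + δ) = γ.x e ϑ + y e * δ
  thin : N.Thin (if ϑ < 0 then 0 else N.r) (γ.active N ϑ) (γ.queued N ϑ) (γ.bound N ϑ) y lam c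
  le_factor : ∀ v ≠ N.s, 0 < lam v → κ ^ (1 + γ.rank v ϑ) ≤ c v

/-- The trajectory starts an affine piece at `ϑ`. -/
def Good (γ : Traj V E) (N : SpillbackNetwork V E) (κ ϑ : ℝ) : Prop :=
  ∃ ε y lam c, γ.Piece N κ ϑ ε y lam c

variable {γ γ' : Traj V E} {K κ : ℝ}

theorem mem_active {ϑ : ℝ} {e : E} :
    e ∈ γ.active N ϑ ↔ γ.ell (N.tail e) ϑ + N.τ e ≤ γ.ell (N.head e) ϑ := Iff.rfl

theorem mem_queued {ϑ : ℝ} {e : E} :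
    e ∈ γ.queued N ϑ ↔ γ.ell (N.tail e) ϑ + N.τ e < γ.ell (N.head e) ϑ := Iff.rfl

theorem queued_subset_active {ϑ : ℝ} : γ.queued N ϑ ⊆ γ.active N ϑ := fun _ h =>
  mem_active.2 (mem_queued.1 h).le

theorem bound_le (e : E) (ϑ : ℝ) : γ.bound N ϑ e ≤ N.νin e := by
  unfold bound
  split_ifs
  · exact min_le_right _ _
  · exact le_rfl

omit [Fintype E] in
theorem rank_le (v : V) (ϑ : ℝ) : γ.rank v ϑ ≤ Fintype.card V := card_le_univ _

section Affine

variable {ϑ ε : ℝ} {y : E → ℝ} {lam : V → ℝ}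

theorem x_lastPreimage_eq (hγ : γ.IsOn N K Set.univ) {v : V} {e : E} (hlam : 0 < lam v)
    (hell : ∀ δ ∈ Set.Icc 0 ε, γ.ell v (ϑ + δ) = γ.ell v ϑ + lam v * δ)
    (hx : ∀ δ ∈ Set.Icc 0 ε, γ.x e (ϑ + δ) = γ.x e ϑ + y e * δ) {η : ℝ} (hη : 0 ≤ η)
    (hη' : η < lam v * ε) :
    γ.x e (lastPreimage (γ.ell v) (γ.ell v ϑ + η)) = γ.x e ϑ + y e / lam v * η := by
  rw [(hγ.isLabel v).apply_eq_of_affine hlam hell hη hη', hx]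
  · ring
  · exact ⟨div_nonneg hη hlam.le, by rw [div_le_iff₀ hlam]; linarith⟩

end Affine

theorem lastPreimage_lt_of_lt (hγ : γ.IsOn N K Set.univ) {v : V} {θ ϑ : ℝ} (h : θ < γ.ell v ϑ) :
    lastPreimage (γ.ell v) θ < ϑ := (hγ.isLabel v).lastPreimage_lt_iff.2 h

theorem lam_pos (hγ : γ.IsOn N K Set.univ) {v : V} {θ ε : ℝ} {lam : V → ℝ} (hε : 0 < ε)
    (hlam : 0 ≤ lam v) (hell : ∀ δ ∈ Set.Icc 0 ε, γ.ell v (lastPreimage (γ.ell v) θ + δ) =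
      γ.ell v (lastPreimage (γ.ell v) θ) + lam v * δ) : 0 < lam v := by
  refine lt_of_le_of_ne hlam fun h0 => ?_
  have h1 := hell ε ⟨hε.le, le_rfl⟩
  rw [← h0, zero_mul, add_zero, (hγ.isLabel v).apply_lastPreimage] at h1
  have := (hγ.isLabel v).le_lastPreimage_iff.2 h1.le
  linarith

theorem lastPreimage_congr (hγ : γ.IsOn N K Set.univ) (hγ' : γ'.IsOn N K Set.univ) {Θ θ : ℝ}
    {v : V} (h : ∀ ϑ ≤ Θ, γ.ell v ϑ = γ'.ell v ϑ) (hθ : θ < γ.ell v Θ) :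
    lastPreimage (γ.ell v) θ = lastPreimage (γ'.ell v) θ := by
  have h1 := lastPreimage_lt_of_lt hγ hθ
  have h2 : lastPreimage (γ'.ell v) θ < Θ := lastPreimage_lt_of_lt hγ' (h Θ le_rfl ▸ hθ)
  refine le_antisymm ?_ ?_
  · rw [(hγ'.isLabel v).le_lastPreimage_iff, ← h _ h1.le, (hγ.isLabel v).apply_lastPreimage]
  · rw [(hγ.isLabel v).le_lastPreimage_iff, h _ h2.le, (hγ'.isLabel v).apply_lastPreimage]

theorem Full.ell_lt (hγ : γ.IsOn N K Set.univ) {e : E} {ϑ : ℝ} (h : γ.Full N e ϑ) :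
    γ.ell (N.tail e) ϑ < γ.ell (N.head e) ϑ := by
  by_contra! hcon
  have h1 := (hγ.isLabel (N.head e)).le_lastPreimage_iff.2 hcon
  have h2 : γ.load N e ϑ ≤ 0 := sub_nonpos.2 (hγ.x_mono e h1)
  have h3 := (N.σ_gt e).trans_le h
  rw [EReal.coe_lt_coe_iff] at h3
  have := mul_nonneg (N.νin_pos e).le (N.τ_nonneg e)
  linarith

section Congr

variable (hγ : γ.IsOn N K Set.univ) (hγ' : γ'.IsOn N K Set.univ) {ϑ : ℝ}
  (h : ∀ ϑ' ≤ ϑ, (∀ v, γ.ell v ϑ' = γ'.ell v ϑ') ∧ ∀ e, γ.x e ϑ' = γ'.x e ϑ')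
include hγ hγ' h

theorem cumOut_congr {e : E} {θ : ℝ} (hθ : θ < γ.ell (N.head e) ϑ) :
    γ.cumOut N e θ = γ'.cumOut N e θ := by
  unfold cumOut
  rw [← lastPreimage_congr hγ hγ' (fun ϑ' h' => (h ϑ' h').1 _) hθ]
  exact (h _ (lastPreimage_lt_of_lt hγ hθ).le).2 e

theorem full_congr_of {e : E} (hf : γ.Full N e ϑ) : γ'.Full N e ϑ := by
  have h1 := hf.ell_lt hγ
  have : γ'.load N e ϑ = γ.load N e ϑ := by
    unfold load
    rw [← (h ϑ le_rfl).1, ← (h ϑ le_rfl).2, cumOut_congr hγ hγ' h h1]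
  unfold Full
  rw [this]
  exact hf

theorem full_congr {e : E} : γ.Full N e ϑ ↔ γ'.Full N e ϑ :=
  ⟨full_congr_of hγ hγ' h, full_congr_of hγ' hγ fun ϑ' h' =>
    ⟨fun v => ((h ϑ' h').1 v).symm, fun e => ((h ϑ' h').2 e).symm⟩⟩

theorem bound_congr : γ.bound N ϑ = γ'.bound N ϑ := by
  funext e
  by_cases hf : γ.Full N e ϑ
  · have hlt := hf.ell_lt hγ
    rw [bound, bound, if_pos hf, if_pos ((full_congr hγ hγ' h).1 hf), ← (h ϑ le_rfl).1]
    congr 1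
    refine Filter.EventuallyEq.derivWithin_eq ?_ (cumOut_congr hγ hγ' h hlt)
    filter_upwards [mem_nhdsWithin_of_mem_nhds (Iio_mem_nhds hlt)] with θ hθ
    exact cumOut_congr hγ hγ' h hθ
  · rw [bound, bound, if_neg hf, if_neg (mt (full_congr hγ hγ' h).2 hf)]

omit hγ hγ' in
theorem active_congr : γ.active N ϑ = γ'.active N ϑ := by
  simp only [active, (h ϑ le_rfl).1]

omit hγ hγ' in
theorem queued_congr : γ.queued N ϑ = γ'.queued N ϑ := by
  simp only [queued, (h ϑ le_rfl).1]

omit hγ hγ' [Fintype E] in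
theorem rank_congr (v : V) : γ.rank v ϑ = γ'.rank v ϑ := by
  simp only [rank, (h ϑ le_rfl).1]

end Congr

theorem Good.congr (hγ : γ.IsOn N K Set.univ) (hγ' : γ'.IsOn N K Set.univ) {Θ ϑ : ℝ}
    (h : Agree Θ γ γ') (hϑ : ϑ < Θ) (hg : γ.Good N κ ϑ) : γ'.Good N κ ϑ := by
  obtain ⟨ε, y, lam, c, hp⟩ := hg
  have h' : ∀ ϑ' ≤ ϑ, (∀ v, γ.ell v ϑ' = γ'.ell v ϑ') ∧ ∀ e, γ.x e ϑ' = γ'.x e ϑ' :=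
    fun ϑ' hle => h ϑ' (hle.trans_lt hϑ)
  have hlt : ∀ δ ∈ Set.Icc 0 (min ε ((Θ - ϑ) / 2)), ϑ + δ < Θ ∧ δ ∈ Set.Icc 0 ε := by
    intro δ hδ
    have h1 := hδ.2.trans (min_le_left _ _)
    have h2 := hδ.2.trans (min_le_right _ _)
    exact ⟨by linarith, hδ.1, h1⟩
  refine ⟨min ε ((Θ - ϑ) / 2), y, lam, c, lt_min hp.pos (by linarith), fun v δ hδ => ?_,
    fun e δ hδ => ?_, ?_, ?_⟩
  · obtain ⟨h1, h2⟩ := hlt δ hδ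
    rw [← (h _ h1).1, ← (h _ hϑ).1]
    exact hp.ell_eq v δ h2
  · obtain ⟨h1, h2⟩ := hlt δ hδ
    rw [← (h _ h1).2, ← (h _ hϑ).2]
    exact hp.x_eq e δ h2
  · rw [← active_congr h', ← queued_congr h', ← bound_congr hγ hγ' h']
    exact hp.thin
  · simp only [← rank_congr h']
    exact hp.le_factor

/-- A full arc releases flow at a constant rate, determined by an earlier affine piece. -/
theorem Full.exists_rate (hγ : γ.IsOn N K Set.univ) (hκ : 0 < κ) (hκ1 : κ ≤ 1) {Θ : ℝ}
    (hg : ∀ ϑ < Θ, γ.Good N κ ϑ) {e : E} (hf : γ.Full N e Θ) :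
    ∃ φ η₀, 0 < η₀ ∧ N.νout e * κ ^ γ.rank (N.tail e) Θ ≤ φ ∧
      ∀ η, 0 ≤ η → η < η₀ → γ.cumOut N e (γ.ell (N.tail e) Θ + η) =
        γ.cumOut N e (γ.ell (N.tail e) Θ) + φ * η := by
  have hlt := hf.ell_lt hγ
  set ϑ := lastPreimage (γ.ell (N.head e)) (γ.ell (N.tail e) Θ) with hϑ
  have hϑΘ : ϑ < Θ := lastPreimage_lt_of_lt hγ hlt
  have hell : γ.ell (N.head e) ϑ = γ.ell (N.tail e) Θ :=
    (hγ.isLabel (N.head e)).apply_lastPreimage _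
  obtain ⟨ε, y, lam, c, hp⟩ := hg ϑ hϑΘ
  have hlam : 0 < lam (N.head e) := lam_pos hγ hp.pos (hp.thin.lam_nonneg _) (hp.ell_eq _)
  have hq : e ∈ γ.queued N ϑ := by
    have h1 := (hγ.incr ϑ trivial Θ trivial hϑΘ.le).flow_le_in e
    have h2 := (N.σ_gt e).trans_le hf
    rw [EReal.coe_lt_coe_iff] at h2
    have h3 := h2.trans_le h1
    have h4 := lt_of_mul_lt_mul_left h3 (N.νin_pos e).le
    rw [mem_queued, hell]
    linarith
  have hrank : 1 + γ.rank (N.head e) ϑ ≤ γ.rank (N.tail e) Θ := by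
    rw [add_comm]
    refine card_lt_card ⟨fun u hu => ?_, fun hsub => ?_⟩
    · simp only [mem_filter, mem_univ, true_and] at hu ⊢
      rw [hell] at hu
      exact hu.trans_le (hγ.ell_mono u hϑΘ.le)
    · have := hsub (x := N.head e) (by simpa using hlt)
      simp at this
  have hkey : ∀ η, 0 ≤ η → η < lam (N.head e) * ε → γ.cumOut N e (γ.ell (N.tail e) Θ + η) =
      γ.x e ϑ + y e / lam (N.head e) * η := by
    intro η h0 h1
    rw [← hell]
    exact x_lastPreimage_eq hγ hlam (hp.ell_eq _) (hp.x_eq e) h0 h1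
  refine ⟨y e / lam (N.head e), lam (N.head e) * ε, mul_pos hlam hp.pos, ?_, fun η h0 h1 => ?_⟩
  · rw [le_div_iff₀ hlam, hp.thin.reset e hq]
    refine mul_le_mul_of_nonneg_right ?_ hlam.le
    rw [mul_comm (c _)]
    refine mul_le_mul_of_nonneg_left ?_ (N.νout_pos e).le
    exact (pow_le_pow_of_le_one hκ.le hκ1 hrank).trans
      (hp.le_factor _ (N.no_into_source e) hlam)
  · rw [hkey η h0 h1]; rfl

theorem Full.bound_eq {Θ φ η₀ : ℝ} {e : E} (hf : γ.Full N e Θ) (hη : 0 < η₀)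
    (h : ∀ η, 0 ≤ η → η < η₀ → γ.cumOut N e (γ.ell (N.tail e) Θ + η) =
        γ.cumOut N e (γ.ell (N.tail e) Θ) + φ * η) :
    γ.bound N Θ e = min φ (N.νin e) := by
  rw [bound, if_pos hf, derivWithin_of_affine hη h]

/-- Inflow bounds are bounded from below. -/
theorem le_bound (hγ : γ.IsOn N K Set.univ) (hκ : 0 < κ) (hκ1 : κ ≤ 1) {m : ℝ} (hm : 0 < m)
    (hmin : ∀ e, m ≤ N.νin e) (hmout : ∀ e, m ≤ N.νout e) {Θ : ℝ}
    (hg : ∀ ϑ < Θ, γ.Good N κ ϑ) (e : E) : m * κ ^ γ.rank (N.tail e) Θ ≤ γ.bound N Θ e := by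
  have h1 : κ ^ γ.rank (N.tail e) Θ ≤ 1 := pow_le_one₀ hκ.le hκ1
  have h2 : m * κ ^ γ.rank (N.tail e) Θ ≤ N.νin e := by nlinarith [hmin e]
  by_cases hf : γ.Full N e Θ
  · obtain ⟨φ, η₀, hη, hφ, h⟩ := hf.exists_rate hγ hκ hκ1 hg
    rw [hf.bound_eq hη h]
    refine le_min (le_trans ?_ hφ) h2
    exact mul_le_mul_of_nonneg_right (hmout e) (pow_nonneg hκ.le _)
  · rwa [bound, if_neg hf]

theorem eventually_affine_lt {a b a' b' : ℝ} (h : a < b) :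
    ∀ᶠ δ in nhdsWithin (0 : ℝ) (Set.Ici 0), a + a' * δ < b + b' * δ := by
  have h1 : Continuous fun δ : ℝ => a + a' * δ := by fun_prop
  have h2 : Continuous fun δ : ℝ => b + b' * δ := by fun_prop
  refine ((h1.tendsto 0).mono_left nhdsWithin_le_nhds).eventually_lt
    ((h2.tendsto 0).mono_left nhdsWithin_le_nhds) ?_
  simpa using h

theorem eventually_bound (hγ : γ.IsOn N K Set.univ) (hκ : 0 < κ) (hκ1 : κ ≤ 1) {Θ ε₀ : ℝ}
    (hg : ∀ ϑ < Θ, γ.Good N κ ϑ) (hε : 0 < ε₀) {y : E → ℝ} {lam : V → ℝ}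
    (hell : ∀ v, ∀ δ ∈ Set.Icc 0 ε₀, γ.ell v (Θ + δ) = γ.ell v Θ + lam v * δ)
    (hx : ∀ e, ∀ δ ∈ Set.Icc 0 ε₀, γ.x e (Θ + δ) = γ.x e Θ + y e * δ)
    (hlam : ∀ v, 0 ≤ lam v) (e : E) :
    ∀ᶠ δ in nhdsWithin (0 : ℝ) (Set.Ici 0), γ.bound N Θ e ≤ γ.bound N (Θ + δ) e ∧
      (y e = γ.bound N Θ e * lam (N.tail e) → γ.bound N (Θ + δ) e = γ.bound N Θ e) := by
  have hsmall : ∀ᶠ δ in nhdsWithin (0 : ℝ) (Set.Ici 0), δ ∈ Set.Icc 0 ε₀ :=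
    Icc_mem_nhdsGE hε
  by_cases hf : γ.Full N e Θ
  · obtain ⟨φ, η₀, hη, -, hφ⟩ := hf.exists_rate hγ hκ hκ1 hg
    filter_upwards [hsmall, eventually_affine_lt (a := 0) (a' := lam (N.tail e)) (b' := 0) hη]
      with δ hδ hlt
    have hd0 : 0 ≤ lam (N.tail e) * δ := mul_nonneg (hlam _) hδ.1
    have hφ' : ∀ η, 0 ≤ η → η < η₀ - lam (N.tail e) * δ →
        γ.cumOut N e (γ.ell (N.tail e) (Θ + δ) + η) =
        γ.cumOut N e (γ.ell (N.tail e) (Θ + δ)) + φ * η := by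
      intro η h0 h1
      rw [hell _ δ hδ, add_assoc, hφ _ (by linarith) (by linarith), hφ _ hd0 (by linarith)]
      ring
    have hle : γ.bound N Θ e ≤ γ.bound N (Θ + δ) e := by
      by_cases hf' : γ.Full N e (Θ + δ)
      · rw [hf.bound_eq hη hφ, hf'.bound_eq (by linarith) hφ']
      · rw [bound, bound, if_neg hf']
        split_ifs
        exact min_le_right _ _
    refine ⟨hle, fun hy => ?_⟩
    rw [hf.bound_eq hη hφ] at hy ⊢
    by_cases hf' : γ.Full N e (Θ + δ)
    · rw [hf'.bound_eq (by linarith) hφ']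
    · rw [bound, if_neg hf']
      rcases le_or_gt (N.νin e) φ with h | h
      · rw [min_eq_right h]
      · exfalso
        rw [min_eq_left h.le] at hy
        refine hf' ?_
        have : γ.load N e (Θ + δ) = γ.load N e Θ := by
          unfold load
          rw [hx e δ hδ, hell _ δ hδ, hφ _ hd0 (by linarith), hy]
          ring
        unfold Full
        rw [this]
        exact hf
  · have hlt : (γ.load N e Θ : EReal) < N.σ e := not_le.1 hf
    have h1 : Continuous fun δ : ℝ => ((γ.load N e Θ + y e * δ : ℝ) : EReal) :=
      continuous_coe_real_ereal.comp (by fun_prop)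
    have h2 : ∀ᶠ δ in nhdsWithin (0 : ℝ) (Set.Ici 0),
        ((γ.load N e Θ + y e * δ : ℝ) : EReal) < N.σ e :=
      ((h1.tendsto 0).mono_left nhdsWithin_le_nhds).eventually_lt_const (by simpa using hlt)
    filter_upwards [hsmall, h2] with δ hδ h2
    have hf' : ¬ γ.Full N e (Θ + δ) := by
      refine not_le.2 (lt_of_le_of_lt ?_ h2)
      rw [EReal.coe_le_coe_iff]
      unfold load
      rw [hx e δ hδ]
      have : γ.cumOut N e (γ.ell (N.tail e) Θ) ≤ γ.cumOut N e (γ.ell (N.tail e) (Θ + δ)) :=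
        hγ.x_mono e ((hγ.isLabel _).lastPreimage_mono (hγ.ell_mono _ (by linarith [hδ.1])))
      linarith
    rw [bound, bound, if_neg hf, if_neg hf']
    exact ⟨le_rfl, fun _ => rfl⟩

/-- An affine continuation along a thin flow is good for some time. -/
theorem exists_good_of_affine (hγ : γ.IsOn N K Set.univ) (hκ : 0 < κ) (hκ1 : κ ≤ 1) {Θ ε₀ : ℝ}
    (hΘ : 0 ≤ Θ) (hg : ∀ ϑ < Θ, γ.Good N κ ϑ) (hε : 0 < ε₀) {y : E → ℝ} {lam c : V → ℝ}
    (hell : ∀ v, ∀ δ ∈ Set.Icc 0 ε₀, γ.ell v (Θ + δ) = γ.ell v Θ + lam v * δ)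
    (hx : ∀ e, ∀ δ ∈ Set.Icc 0 ε₀, γ.x e (Θ + δ) = γ.x e Θ + y e * δ)
    (hT : N.Thin N.r (γ.active N Θ) (γ.queued N Θ) (γ.bound N Θ) y lam c)
    (hc : ∀ v ≠ N.s, 0 < lam v → κ ^ (1 + γ.rank v Θ) ≤ c v) :
    ∃ Θ' > Θ, ∀ ϑ < Θ', γ.Good N κ ϑ := by
  have hsmall : ∀ᶠ δ in nhdsWithin (0 : ℝ) (Set.Ici 0), δ ∈ Set.Ico 0 ε₀ :=
    Ico_mem_nhdsGE hε
  have hQ : ∀ᶠ δ in nhdsWithin (0 : ℝ) (Set.Ici 0), ∀ e, e ∈ γ.queued N Θ →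
      γ.ell (N.tail e) Θ + N.τ e + lam (N.tail e) * δ <
        γ.ell (N.head e) Θ + lam (N.head e) * δ := by
    refine Filter.eventually_all.2 fun e => ?_
    by_cases he : e ∈ γ.queued N Θ
    · filter_upwards [eventually_affine_lt (mem_queued.1 he)] with δ hδ _ using hδ
    · exact Filter.Eventually.of_forall fun δ h => absurd h he
  have hA : ∀ᶠ δ in nhdsWithin (0 : ℝ) (Set.Ici 0), ∀ e, e ∉ γ.active N Θ →
      γ.ell (N.head e) Θ + lam (N.head e) * δ <
        γ.ell (N.tail e) Θ + N.τ e + lam (N.tail e) * δ := by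
    refine Filter.eventually_all.2 fun e => ?_
    by_cases he : e ∈ γ.active N Θ
    · exact Filter.Eventually.of_forall fun δ h => absurd he h
    · rw [mem_active, not_le] at he
      filter_upwards [eventually_affine_lt he] with δ hδ _ using hδ
  have hrk : ∀ᶠ δ in nhdsWithin (0 : ℝ) (Set.Ici 0), ∀ v w, γ.ell v Θ < γ.ell w Θ →
      γ.ell v Θ + lam v * δ < γ.ell w Θ + lam w * δ := by
    refine Filter.eventually_all.2 fun v => Filter.eventually_all.2 fun w => ?_
    by_cases he : γ.ell v Θ < γ.ell w Θ
    · filter_upwards [eventually_affine_lt he] with δ hδ _ using hδ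
    · exact Filter.Eventually.of_forall fun δ h => absurd h he
  have hb := Filter.eventually_all.2 fun e => eventually_bound hγ hκ hκ1 hg hε hell hx
    hT.lam_nonneg e
  obtain ⟨ε, hε', hall⟩ := (mem_nhdsGE_iff_exists_Ico_subset
    (a := (0 : ℝ))).1 (hsmall.and (hQ.and (hA.and (hrk.and hb))))
  refine ⟨Θ + ε, by linarith [Set.mem_Ioi.1 hε'], fun ϑ hϑ => ?_⟩
  rcases lt_or_ge ϑ Θ with hlt | hge
  · exact hg ϑ hlt
  obtain ⟨δ, hδ0, rfl⟩ : ∃ δ, 0 ≤ δ ∧ ϑ = Θ + δ := ⟨ϑ - Θ, by linarith, by ring⟩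
  obtain ⟨hδ, hQ, hA, hrk, hb⟩ := hall ⟨hδ0, by linarith⟩
  have hδ' : δ ∈ Set.Icc 0 ε₀ := ⟨hδ.1, hδ.2.le⟩
  have hact : ∀ e, e ∈ γ.active N (Θ + δ) ↔ γ.ell (N.tail e) Θ + N.τ e + lam (N.tail e) * δ ≤
      γ.ell (N.head e) Θ + lam (N.head e) * δ := fun e => by
    rw [mem_active, hell _ _ hδ', hell _ _ hδ', add_right_comm]
  have hque : ∀ e, e ∈ γ.queued N (Θ + δ) ↔ γ.ell (N.tail e) Θ + N.τ e + lam (N.tail e) * δ <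
      γ.ell (N.head e) Θ + lam (N.head e) * δ := fun e => by
    rw [mem_queued, hell _ _ hδ', hell _ _ hδ', add_right_comm]
  have hactΘ : ∀ e ∈ γ.active N (Θ + δ), e ∈ γ.active N Θ := fun e he => by
    by_contra hcon
    exact absurd ((hact e).1 he) (not_le.2 (hA e hcon))
  have hqueΘ : ∀ e ∈ γ.queued N Θ, e ∈ γ.queued N (Θ + δ) := fun e he => (hque e).2 (hQ e he)
  refine ⟨ε₀ - δ, y, lam, c, by linarith [hδ.2], fun v z hz => ?_, fun e z hz => ?_, ?_, ?_⟩
  · rw [add_assoc, hell v _ ⟨by linarith [hz.1], by linarith [hz.2]⟩, hell v δ hδ']; ring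
  · rw [add_assoc, hx e _ ⟨by linarith [hz.1], by linarith [hz.2]⟩, hx e δ hδ']; ring
  · rw [if_neg (by linarith)]
    refine ⟨hT.nonneg, fun e he => ?_, hT.cons, hT.cons_source, hT.lam_nonneg, hT.lam_source,
      hT.c_mem, fun e he => ?_, hT.le_push, fun e he => hT.push e (hactΘ e he),
      fun e he hq => hT.unused e (hactΘ e he) (mt (hqueΘ e) hq), fun v hv => ?_, fun e => ?_,
      fun v hv => ?_⟩
    · by_cases h : e ∈ γ.active N Θ
      · have hq : e ∉ γ.queued N Θ := fun hq => he (queued_subset_active (hqueΘ e hq))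
        refine hT.unused e h hq ?_
        rw [hact, not_le] at he
        rw [mem_active] at h
        refine lt_of_mul_lt_mul_right (a := δ) ?_ hδ0
        linarith
      · exact hT.eq_zero e h
    · have h := hactΘ e (queued_subset_active he)
      by_cases hq : e ∈ γ.queued N Θ
      · exact hT.reset e hq
      · refine hT.push e h ?_
        rw [hque] at he
        rw [mem_queued, not_lt] at hq
        refine lt_of_mul_lt_mul_right (a := δ) ?_ hδ0
        linarith
    · obtain ⟨e, he, hev, hor⟩ := hT.stay v hv
      rcases hor with hq | hle
      · exact ⟨e, queued_subset_active (hqueΘ e hq), hev, Or.inl (hqueΘ e hq)⟩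
      · refine ⟨e, (hact e).2 ?_, hev, Or.inr hle⟩
        rw [mem_active] at he
        have := mul_le_mul_of_nonneg_right hle hδ0
        rw [hev] at he ⊢
        linarith
    · exact (hT.le_bound e).trans (mul_le_mul_of_nonneg_right (hb e).1 (hT.lam_nonneg _))
    · obtain ⟨e, he, hy⟩ := hT.tight v hv
      refine ⟨e, he, ?_⟩
      rw [(hb e).2 (by rw [he]; exact hy), hy]
  · intro v hv hlam
    refine le_trans (pow_le_pow_of_le_one hκ.le hκ1 ?_) (hc v hv hlam)
    refine Nat.add_le_add_left (card_le_card fun w hw => ?_) 1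
    simp only [mem_filter, mem_univ, true_and] at hw ⊢
    rw [hell _ _ hδ', hell _ _ hδ']
    exact hrk v w hw

/-- A trajectory that is good before time `Θ` can be modified after `Θ` so as to be good up to a
later time. -/
theorem exists_good_extension (hκ : 0 < κ) (hκ1 : κ ≤ 1) {m : ℝ} (hm : 0 < m)
    (hmin : ∀ e, m ≤ N.νin e) (hmout : ∀ e, m ≤ N.νout e) (hκm : κ * ∑ e, N.νout e ≤ m)
    (hK : K = 2 + N.r / (m * κ ^ Fintype.card V)) (hγ : γ.IsOn N K Set.univ) {Θ : ℝ}
    (hΘ : 0 ≤ Θ) (hg : ∀ ϑ < Θ, γ.Good N κ ϑ) :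
    ∃ (γ' : Traj V E) (Θ' : ℝ), Θ < Θ' ∧ γ'.IsOn N K Set.univ ∧ Agree Θ γ γ' ∧
      ∀ ϑ < Θ', γ'.Good N κ ϑ := by
  set B := m * κ ^ Fintype.card V with hB
  have hB0 : 0 < B := mul_pos hm (pow_pos hκ _)
  have hBm : B ≤ m := mul_le_of_le_one_right hm.le (pow_le_one₀ hκ.le hκ1)
  have hRB : 0 ≤ N.r / B := div_nonneg N.r_nonneg hB0.le
  have hK1 : 1 ≤ K := by rw [hK]; linarith
  obtain ⟨h, hh⟩ := N.exists_topological_numbering fun v => γ.ell v Θ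
  have hbB : ∀ e, B ≤ γ.bound N Θ e := fun e => le_trans
    (mul_le_mul_of_nonneg_left (pow_le_pow_of_le_one hκ.le hκ1 (rank_le _ _)) hm.le)
    (le_bound hγ hκ hκ1 hm hmin hmout hg e)
  have hsrc : ∀ e, N.tail e = N.s → N.r < γ.bound N Θ e := fun e he => by
    rw [bound, if_neg]
    · exact N.source_inflow e he
    · unfold Full
      rw [N.source_storage e he]
      simp
  obtain ⟨y, lam, c, hT, hlamK⟩ := exists_thin (N := N) (A := γ.active N Θ) (Q := γ.queued N Θ)
    queued_subset_active hh (fun v hv => by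
      obtain ⟨e, he, hle⟩ := hγ.enter Θ trivial v hv
      exact ⟨e, by rw [mem_active, he]; exact hle, he⟩) hB0 hbB
    (fun e => hBm.trans (hmout e)) N.r_nonneg hsrc
  have hc : ∀ v ≠ N.s, 0 < lam v → κ ^ (1 + γ.rank v Θ) ≤ c v := by
    intro v hv hlam
    rcases eq_or_lt_of_le (hT.c_mem v).2 with h1 | h1
    · rw [h1]; exact pow_le_one₀ hκ.le hκ1
    obtain ⟨e, he, hev, hle⟩ := hT.exists_bound_le N.r_nonneg (fun e => hB0.trans_le (hbB e)) hv
      hlam h1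
    have h2 := (le_bound hγ hκ hκ1 hm hmin hmout hg e).trans hle
    rw [hev] at h2
    have hsum : 0 < ∑ e, N.νout e :=
      sum_pos (fun e _ => N.νout_pos e) ⟨e, mem_univ e⟩
    refine le_of_mul_le_mul_right ?_ hsum
    refine le_trans ?_ h2
    rw [pow_add, pow_one, mul_right_comm]
    exact mul_le_mul_of_nonneg_right hκm (pow_nonneg hκ.le _)
  have hincr : N.Incr K lam y 1 :=
    { nonneg := hT.lam_nonneg
      le := fun v => by rw [hK, mul_one]; exact hlamK v
      source := hT.lam_source
      flow_nonneg := hT.nonneg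
      flow_le_in := fun e => (hT.le_bound e).trans
        (mul_le_mul_of_nonneg_right (bound_le e Θ) (hT.lam_nonneg _))
      flow_le_out := fun e => (hT.le_push e).trans (mul_le_mul_of_nonneg_right
        (mul_le_of_le_one_left (N.νout_pos e).le (hT.c_mem _).2) (hT.lam_nonneg _)) }
  have hQ : ∀ᶠ δ in nhdsWithin (0 : ℝ) (Set.Ici 0), ∀ e, e ∈ γ.queued N Θ →
      γ.ell (N.tail e) Θ + N.τ e + lam (N.tail e) * δ <
        γ.ell (N.head e) Θ + lam (N.head e) * δ := by
    refine Filter.eventually_all.2 fun e => ?_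
    by_cases he : e ∈ γ.queued N Θ
    · filter_upwards [eventually_affine_lt (mem_queued.1 he)] with δ hδ _ using hδ
    · exact Filter.Eventually.of_forall fun δ h => absurd h he
  obtain ⟨ε, hε, hall⟩ := (mem_nhdsGE_iff_exists_Ico_subset (a := (0 : ℝ))).1 hQ
  have hε : 0 < ε := hε
  have hγ1 : (γ.append Θ lam y).IsOn N K (Set.Iio (Θ + ε)) := by
    refine (hγ.mono (Set.subset_univ _)).append hincr hΘ fun δ hδ hδε v hv => ?_
    obtain ⟨e, he, hev, hor⟩ := hT.stay v hv
    refine ⟨e, hev, ?_⟩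
    rcases hor with hq | hle
    · have := hall ⟨hδ.le, by linarith [Set.mem_Iio.1 hδε]⟩ e hq
      rw [hev] at this
      linarith
    · rw [mem_active] at he
      have := mul_le_mul_of_nonneg_right hle hδ.le
      rw [hev] at he
      linarith
  obtain ⟨γ', hγ', hag⟩ := hγ1.exists_extension hK1 (by linarith)
  have hagle : ∀ ϑ ≤ Θ, (∀ v, γ.ell v ϑ = γ'.ell v ϑ) ∧ ∀ e, γ.x e ϑ = γ'.x e ϑ := by
    intro ϑ hϑ
    obtain ⟨h1, h2⟩ := hag ϑ (by linarith)
    exact ⟨fun v => by rw [← h1, append_ell_of_le hϑ], fun e => by rw [← h2, append_x_of_le hϑ]⟩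
  have hagΘ : Agree Θ γ γ' := fun ϑ hϑ => hagle ϑ hϑ.le
  obtain ⟨Θ', hΘ', hgood⟩ := exists_good_of_affine (ε₀ := ε / 2) (y := y) (lam := lam) (c := c)
    hγ' hκ hκ1 hΘ
    (fun ϑ hϑ => Good.congr hγ hγ' hagΘ hϑ (hg ϑ hϑ)) (by linarith)
    (fun v δ hδ => by
      rw [← (hag (Θ + δ) (by linarith [hδ.2])).1, append_ell_add hδ.1, (hagle Θ le_rfl).1])
    (fun e δ hδ => by
      rw [← (hag (Θ + δ) (by linarith [hδ.2])).2, append_x_add hδ.1, (hagle Θ le_rfl).2])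
    (by rwa [← active_congr hagle, ← queued_congr hagle, ← bound_congr hγ hγ' hagle])
    (by simpa only [← rank_congr hagle] using hc)
  exact ⟨γ', Θ', hΘ', hγ', hagΘ, hgood⟩

/-- The trajectory of an empty network. -/
noncomputable def initial (N : SpillbackNetwork V E) : Traj V E where
  ell v ϑ := N.dist v + ϑ
  x _ _ := 0

theorem initial_isOn (hK : 1 ≤ K) : (initial N).IsOn N K Set.univ where
  incr a _ b _ hab := by
    have := (incr_const (N := N) hK).smul (sub_nonneg.2 hab)
    unfold IncrOn
    convert this using 1
    · funext v; simp [initial]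
    · funext e; simp [initial]
    · simp
  init_ell _ _ _ _ := rfl
  init_x _ _ _ _ := rfl
  enter a _ v hv := by
    obtain ⟨e, he, hle⟩ := N.exists_le_dist hv
    exact ⟨e, he, by simp only [initial]; linarith⟩

theorem initial_bound (ϑ : ℝ) (e : E) : (initial N).bound N ϑ e = N.νin e := by
  rw [bound, if_neg]
  intro hf
  have h := (N.σ_gt e).trans_le hf
  rw [EReal.coe_lt_coe_iff] at h
  have := mul_nonneg (N.νin_pos e).le (N.τ_nonneg e)
  simp only [load, cumOut, initial] at h
  linarith

theorem initial_good (hκ : 0 < κ) (hκ1 : κ ≤ 1) {ϑ : ℝ} (hϑ : ϑ < 0) :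
    (initial N).Good N κ ϑ := by
  refine ⟨1, fun _ => 0, fun _ => 1, fun _ => 1, one_pos, fun v δ _ => ?_, fun e δ _ => ?_, ?_,
    fun v _ _ => pow_le_one₀ hκ.le hκ1⟩
  · simp only [initial]; ring
  · simp [initial]
  · rw [if_pos hϑ]
    refine ⟨fun _ => le_rfl, fun _ _ => rfl, fun v _ => ?_, fun _ => ?_, fun _ => zero_le_one, rfl,
      fun _ => ⟨one_pos, le_rfl⟩, fun e he => ?_, fun e => ?_, fun e _ h => ?_, fun _ _ _ _ => rfl,
      fun v hv => ?_, fun e => ?_, fun v h => ?_⟩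
    · simp [inSum, outSum]
    · simp [outSum]
    · exfalso
      rw [mem_queued] at he
      simp only [initial] at he
      linarith [N.dist_head_le e]
    · simpa using (N.νout_pos e).le
    · exact absurd h (lt_irrefl _)
    · obtain ⟨e, he, hle⟩ := N.exists_le_dist hv
      refine ⟨e, ?_, he, Or.inr le_rfl⟩
      rw [mem_active, he]
      simp only [initial]
      linarith
    · rw [initial_bound, mul_one]
      exact (N.νin_pos e).le
    · exact absurd h (lt_irrefl _)

omit [Fintype V] [Fintype E] in
theorem Agree.refl (Θ : ℝ) (γ : Traj V E) : Agree Θ γ γ := fun _ _ => ⟨fun _ => rfl, fun _ => rfl⟩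

omit [Fintype V] [Fintype E] in
theorem Agree.trans {Θ : ℝ} {γ γ' γ'' : Traj V E} (h : Agree Θ γ γ') (h' : Agree Θ γ' γ'') :
    Agree Θ γ γ'' := fun ϑ hϑ =>
  ⟨fun v => ((h ϑ hϑ).1 v).trans ((h' ϑ hϑ).1 v), fun e => ((h ϑ hϑ).2 e).trans ((h' ϑ hϑ).2 e)⟩

omit [Fintype V] [Fintype E] in
theorem Agree.mono {Θ Θ' : ℝ} (h : Agree Θ' γ γ') (hle : Θ ≤ Θ') : Agree Θ γ γ' :=
  fun ϑ hϑ => h ϑ (hϑ.trans_le hle)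

theorem IsOn.congr {Θ : ℝ} (hγ : γ.IsOn N K Set.univ) (h : Agree Θ γ γ') :
    γ'.IsOn N K (Set.Iio Θ) where
  incr a ha b hb hab := by
    have := hγ.incr a trivial b trivial hab
    unfold IncrOn at this ⊢
    simpa only [(h a ha).1, (h a ha).2, (h b hb).1, (h b hb).2] using this
  init_ell a ha ha0 v := by rw [← (h a ha).1]; exact hγ.init_ell a trivial ha0 v
  init_x a ha ha0 v := by rw [← (h a ha).2]; exact hγ.init_x a trivial ha0 v
  enter a ha v hv := by
    have := hγ.enter a trivial v hv
    simpa only [(h a ha).1] using this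

omit [Fintype V] [Fintype E] in
/-- A chain of partial solutions has a common continuation. -/
theorem exists_glue {C : Set (ℝ × Traj V E)} (hne : C.Nonempty)
    (hchain : ∀ p ∈ C, ∀ q ∈ C, p.1 ≤ q.1 → Agree p.1 p.2 q.2) :
    ∃ γ : Traj V E, ∀ p ∈ C, Agree p.1 p.2 γ := by
  let pick : ℝ → ℝ × Traj V E := fun ϑ =>
    if h : ∃ p ∈ C, ϑ < p.1 then h.choose else hne.some
  have hpick : ∀ p ∈ C, ∀ ϑ < p.1, pick ϑ ∈ C ∧ ϑ < (pick ϑ).1 := by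
    intro p hp ϑ hϑ
    have h : ∃ p ∈ C, ϑ < p.1 := ⟨p, hp, hϑ⟩
    simp only [pick, dif_pos h]
    exact h.choose_spec
  refine ⟨⟨fun v ϑ => (pick ϑ).2.ell v ϑ, fun e ϑ => (pick ϑ).2.x e ϑ⟩, fun p hp ϑ hϑ => ?_⟩
  obtain ⟨h1, h2⟩ := hpick p hp ϑ hϑ
  rcases le_total p.1 (pick ϑ).1 with hle | hle
  · exact hchain p hp _ h1 hle ϑ hϑ
  · have := hchain _ h1 p hp hle ϑ h2
    exact ⟨fun v => (this.1 v).symm, fun e => (this.2 e).symm⟩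

theorem isOn_univ_of_Iio (h : ∀ Θ, γ.IsOn N K (Set.Iio Θ)) : γ.IsOn N K Set.univ where
  incr a _ b _ hab := (h (b + 1)).incr a (by simp; linarith) b (by simp) hab
  init_ell a _ := (h (a + 1)).init_ell a (by simp)
  init_x a _ := (h (a + 1)).init_x a (by simp)
  enter a _ := (h (a + 1)).enter a (by simp)

end Traj

theorem exists_constants (N : SpillbackNetwork V E) : ∃ m κ : ℝ, 0 < m ∧ 0 < κ ∧ κ ≤ 1 ∧
    (∀ e, m ≤ N.νin e) ∧ (∀ e, m ≤ N.νout e) ∧ κ * ∑ e, N.νout e ≤ m := by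
  have h : ∀ f : E → ℝ, (∀ e, 0 < f e) → ∃ m, 0 < m ∧ ∀ e, m ≤ f e := by
    intro f hf
    rcases isEmpty_or_nonempty E with he | he
    · exact ⟨1, one_pos, fun e => he.elim e⟩
    · obtain ⟨e, he⟩ := Finite.exists_min f
      exact ⟨f e, hf e, he⟩
  obtain ⟨m₁, h₁, hm₁⟩ := h _ N.νin_pos
  obtain ⟨m₂, h₂, hm₂⟩ := h _ N.νout_pos
  have hs : 0 ≤ ∑ e, N.νout e := sum_nonneg fun e _ => (N.νout_pos e).le
  have hm : 0 < min m₁ m₂ := lt_min h₁ h₂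
  refine ⟨min m₁ m₂, min 1 (min m₁ m₂ / (1 + ∑ e, N.νout e)), hm, lt_min one_pos (by positivity),
    min_le_left _ _, fun e => (min_le_left _ _).trans (hm₁ e),
    fun e => (min_le_right _ _).trans (hm₂ e), ?_⟩
  refine (mul_le_mul_of_nonneg_right (min_le_right _ _) hs).trans ?_
  rw [div_mul_eq_mul_div, div_le_iff₀ (by linarith)]
  nlinarith

open Traj in
/-- There is a trajectory whose slopes are thin flows at all times. -/
theorem exists_good_traj (N : SpillbackNetwork V E) : ∃ (γ : Traj V E) (K κ : ℝ),
    γ.IsOn N K Set.univ ∧ ∀ ϑ, γ.Good N κ ϑ := by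
  obtain ⟨m, κ, hm, hκ, hκ1, hmin, hmout, hκm⟩ := N.exists_constants
  set K := 2 + N.r / (m * κ ^ Fintype.card V) with hK
  have hK1 : 1 ≤ K := by
    have : 0 ≤ N.r / (m * κ ^ Fintype.card V) :=
      div_nonneg N.r_nonneg (mul_pos hm (pow_pos hκ _)).le
    linarith
  by_contra hcon
  let P : Type := {p : ℝ × Traj V E // 0 ≤ p.1 ∧ p.2.IsOn N K Set.univ ∧
    ∀ ϑ < p.1, p.2.Good N κ ϑ}
  let R : P → P → Prop := fun p q => p.1.1 ≤ q.1.1 ∧ Agree p.1.1 p.1.2 q.1.2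
  have htrans : ∀ {a b c : P}, R a b → R b c → R a c := fun h h' =>
    ⟨h.1.trans h'.1, h.2.trans (h'.2.mono h.1)⟩
  have hbdd : ∀ C : Set P, IsChain R C → ∃ ub, ∀ a ∈ C, R a ub := by
    intro C hC
    rcases C.eq_empty_or_nonempty with rfl | hne
    · exact ⟨⟨(0, initial N), le_rfl, initial_isOn hK1, fun ϑ h => initial_good hκ hκ1 h⟩,
        by simp⟩
    have hch : ∀ p ∈ Subtype.val '' C, ∀ q ∈ Subtype.val '' C, p.1 ≤ q.1 →
        Agree p.1 p.2 q.2 := by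
      rintro _ ⟨p, hp, rfl⟩ _ ⟨q, hq, rfl⟩ hle
      by_cases hpq : p = q
      · rw [hpq]; exact Agree.refl _ _
      rcases hC hp hq hpq with h | h
      · exact h.2
      · intro ϑ hϑ
        have := h.2 ϑ (hϑ.trans_le hle)
        exact ⟨fun v => (this.1 v).symm, fun e => (this.2 e).symm⟩
    obtain ⟨γ, hγ⟩ := exists_glue (hne.image _) hch
    have hγC : ∀ p ∈ C, γ.IsOn N K (Set.Iio p.1.1) := fun p hp =>
      p.2.2.1.congr (hγ _ ⟨p, hp, rfl⟩)
    by_cases hb : BddAbove ((fun p : P => p.1.1) '' C)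
    · set Θ := sSup ((fun p : P => p.1.1) '' C) with hΘ
      have hle : ∀ p ∈ C, p.1.1 ≤ Θ := fun p hp => le_csSup hb ⟨p, hp, rfl⟩
      have hΘ0 : 0 ≤ Θ := by
        obtain ⟨p, hp⟩ := hne
        exact p.2.1.trans (hle p hp)
      have hlt : ∀ ϑ < Θ, ∃ p ∈ C, ϑ < p.1.1 := fun ϑ h => by
        obtain ⟨_, ⟨p, hp, rfl⟩, h'⟩ := exists_lt_of_lt_csSup (hne.image _) h
        exact ⟨p, hp, h'⟩
      have hγΘ : γ.IsOn N K (Set.Iio Θ) := by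
        refine ⟨fun a ha b hb' hab => ?_, fun a ha => ?_, fun a ha => ?_, fun a ha => ?_⟩
        · obtain ⟨p, hp, h⟩ := hlt b hb'
          exact (hγC p hp).incr a (lt_of_le_of_lt hab h) b h hab
        · obtain ⟨p, hp, h⟩ := hlt a ha
          exact (hγC p hp).init_ell a h
        · obtain ⟨p, hp, h⟩ := hlt a ha
          exact (hγC p hp).init_x a h
        · obtain ⟨p, hp, h⟩ := hlt a ha
          exact (hγC p hp).enter a h
      obtain ⟨γ', hγ', hag⟩ := hγΘ.exists_extension hK1 hΘ0
      have hag' : ∀ p ∈ C, Agree p.1.1 p.1.2 γ' := fun p hp =>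
        (hγ _ ⟨p, hp, rfl⟩).trans (hag.mono (hle p hp))
      refine ⟨⟨(Θ, γ'), hΘ0, hγ', fun ϑ hϑ => ?_⟩, fun p hp => ⟨hle p hp, hag' p hp⟩⟩
      obtain ⟨p, hp, h⟩ := hlt ϑ hϑ
      exact (p.2.2.2 ϑ h).congr p.2.2.1 hγ' (hag' p hp) h
    · exfalso
      have hlt : ∀ ϑ, ∃ p ∈ C, ϑ < p.1.1 := fun ϑ => by
        obtain ⟨_, ⟨p, hp, rfl⟩, h'⟩ := not_bddAbove_iff.1 hb ϑ
        exact ⟨p, hp, h'⟩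
      have hγu : γ.IsOn N K Set.univ := isOn_univ_of_Iio fun Θ => by
        obtain ⟨p, hp, h⟩ := hlt Θ
        exact (hγC p hp).mono fun ϑ hϑ => lt_trans hϑ h
      refine hcon ⟨γ, K, κ, hγu, fun ϑ => ?_⟩
      obtain ⟨p, hp, h⟩ := hlt ϑ
      exact (p.2.2.2 ϑ h).congr p.2.2.1 hγu (hγ _ ⟨p, hp, rfl⟩) h
  obtain ⟨p, hp⟩ := exists_maximal_of_chains_bounded hbdd htrans
  obtain ⟨γ', Θ', hΘ', hγ', hag, hg⟩ := exists_good_extension hκ hκ1 hm hmin hmout hκm hK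
    p.2.2.1 p.2.1 p.2.2.2
  have := (hp ⟨(Θ', γ'), p.2.1.trans hΘ'.le, hγ', hg⟩ ⟨hΘ'.le, hag⟩).1
  exact absurd hΘ' (not_lt.2 this)

namespace Traj

variable {γ : Traj V E} {K κ : ℝ}

/-- The inflow rate of an arc. -/
noncomputable def inRate (γ : Traj V E) (N : SpillbackNetwork V E) (e : E) (θ : ℝ) : ℝ :=
  derivWithin (γ.cumIn N e) (Set.Ici θ) θ

/-- The outflow rate of an arc. -/
noncomputable def outRate (γ : Traj V E) (N : SpillbackNetwork V E) (e : E) (θ : ℝ) : ℝ :=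
  derivWithin (γ.cumOut N e) (Set.Ici θ) θ

section IsOn

variable (hγ : γ.IsOn N K Set.univ)
include hγ

theorem ell_lastPreimage (v : V) (θ : ℝ) : γ.ell v (lastPreimage (γ.ell v) θ) = θ :=
  (hγ.isLabel v).apply_lastPreimage θ

theorem lastPreimage_le (v : V) (θ : ℝ) : lastPreimage (γ.ell v) θ ≤ θ :=
  (hγ.le_ell v _).trans (ell_lastPreimage hγ v θ).le

theorem x_eq_of_tail {e : E} {a b : ℝ} (h : γ.ell (N.tail e) a = γ.ell (N.tail e) b) :
    γ.x e a = γ.x e b := by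
  wlog hab : a ≤ b generalizing a b
  · exact (this h.symm (le_of_not_ge hab)).symm
  have H := hγ.incr a trivial b trivial hab
  have h1 := H.flow_nonneg e
  have h2 := H.flow_le_in e
  rw [h, sub_self, mul_zero] at h2
  linarith

theorem x_eq_of_head {e : E} {a b : ℝ} (h : γ.ell (N.head e) a = γ.ell (N.head e) b) :
    γ.x e a = γ.x e b := by
  wlog hab : a ≤ b generalizing a b
  · exact (this h.symm (le_of_not_ge hab)).symm
  have H := hγ.incr a trivial b trivial hab
  have h1 := H.flow_nonneg e
  have h2 := H.flow_le_out e
  rw [h, sub_self, mul_zero] at h2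
  linarith

theorem cumIn_ell (e : E) (ϑ : ℝ) : γ.cumIn N e (γ.ell (N.tail e) ϑ) = γ.x e ϑ :=
  x_eq_of_tail hγ (ell_lastPreimage hγ _ _)

theorem cumOut_ell (e : E) (ϑ : ℝ) : γ.cumOut N e (γ.ell (N.head e) ϑ) = γ.x e ϑ :=
  x_eq_of_head hγ (ell_lastPreimage hγ _ _)

theorem cumIn_of_nonpos {θ : ℝ} (hθ : θ ≤ 0) (e : E) : γ.cumIn N e θ = 0 :=
  hγ.init_x _ trivial ((lastPreimage_le hγ _ θ).trans hθ) e

theorem cumOut_of_nonpos {θ : ℝ} (hθ : θ ≤ 0) (e : E) : γ.cumOut N e θ = 0 :=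
  hγ.init_x _ trivial ((lastPreimage_le hγ _ θ).trans hθ) e

theorem cumIn_cont (e : E) : Continuous (γ.cumIn N e) := by
  obtain ⟨g, hg, h⟩ := exists_continuous_extension (f := γ.cumIn N e) (S := Set.univ)
    (C := N.νin e) fun a _ b _ hab => by
      have H := hγ.incr _ trivial _ trivial ((hγ.isLabel (N.tail e)).lastPreimage_mono hab)
      have h1 := H.flow_le_in e
      rw [ell_lastPreimage hγ, ell_lastPreimage hγ] at h1
      exact ⟨H.flow_nonneg e, h1⟩
  rwa [(Set.eqOn_univ _ _).1 h]

theorem cumOut_cont (e : E) : Continuous (γ.cumOut N e) := by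
  obtain ⟨g, hg, h⟩ := exists_continuous_extension (f := γ.cumOut N e) (S := Set.univ)
    (C := N.νout e) fun a _ b _ hab => by
      have H := hγ.incr _ trivial _ trivial ((hγ.isLabel (N.head e)).lastPreimage_mono hab)
      have h1 := H.flow_le_out e
      rw [ell_lastPreimage hγ, ell_lastPreimage hγ] at h1
      exact ⟨H.flow_nonneg e, h1⟩
  rwa [(Set.eqOn_univ _ _).1 h]

section Piece

variable {ϑ ε : ℝ} {y : E → ℝ} {lam c : V → ℝ} (hp : γ.Piece N κ ϑ ε y lam c)
include hp

theorem Piece.hasDerivWithinAt_cumIn {e : E} (hlam : 0 < lam (N.tail e)) :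
    HasDerivWithinAt (γ.cumIn N e) (y e / lam (N.tail e)) (Set.Ici (γ.ell (N.tail e) ϑ))
      (γ.ell (N.tail e) ϑ) := by
  refine hasDerivWithinAt_of_affine (mul_pos hlam hp.pos) fun η h0 h1 => ?_
  rw [cumIn_ell hγ]
  exact x_lastPreimage_eq hγ hlam (hp.ell_eq _) (hp.x_eq e) h0 h1

theorem Piece.hasDerivWithinAt_cumOut {e : E} (hlam : 0 < lam (N.head e)) :
    HasDerivWithinAt (γ.cumOut N e) (y e / lam (N.head e)) (Set.Ici (γ.ell (N.head e) ϑ))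
      (γ.ell (N.head e) ϑ) := by
  refine hasDerivWithinAt_of_affine (mul_pos hlam hp.pos) fun η h0 h1 => ?_
  rw [cumOut_ell hγ]
  exact x_lastPreimage_eq hγ hlam (hp.ell_eq _) (hp.x_eq e) h0 h1

theorem Piece.inRate_eq {e : E} (hlam : 0 < lam (N.tail e)) :
    γ.inRate N e (γ.ell (N.tail e) ϑ) = y e / lam (N.tail e) :=
  (hp.hasDerivWithinAt_cumIn hγ hlam).derivWithin (uniqueDiffWithinAt_Ici _)

theorem Piece.outRate_eq {e : E} (hlam : 0 < lam (N.head e)) :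
    γ.outRate N e (γ.ell (N.head e) ϑ) = y e / lam (N.head e) :=
  (hp.hasDerivWithinAt_cumOut hγ hlam).derivWithin (uniqueDiffWithinAt_Ici _)

theorem Piece.flow_eq_zero_of_neg (hϑ : ϑ < 0) (e : E) : y e = 0 := by
  have h0 : 0 < min ε (-ϑ) := lt_min hp.pos (by linarith)
  have h1 := hp.x_eq e _ ⟨h0.le, min_le_left _ _⟩
  rw [hγ.init_x _ trivial (by linarith [min_le_right ε (-ϑ)]), hγ.init_x _ trivial hϑ.le,
    zero_add] at h1
  exact (mul_eq_zero.1 h1.symm).resolve_right h0.ne'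

theorem Piece.slope_eq_zero {v : V} {b : ℝ} (hb : ϑ < b) (h : γ.ell v b ≤ γ.ell v ϑ) :
    lam v = 0 := by
  have h0 : 0 < min ε (b - ϑ) := lt_min hp.pos (by linarith)
  have h1 := hp.ell_eq v _ ⟨h0.le, min_le_left _ _⟩
  have h2 := hγ.ell_mono v (show ϑ + min ε (b - ϑ) ≤ b by linarith [min_le_right ε (b - ϑ)])
  refine le_antisymm ?_ (hp.thin.lam_nonneg v)
  by_contra! hcon
  nlinarith [mul_pos hcon h0]

theorem Piece.x_lt {e : E} {b : ℝ} (hb : ϑ < b) (hy : 0 < y e) : γ.x e ϑ < γ.x e b := by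
  have h0 : 0 < min ε (b - ϑ) := lt_min hp.pos (by linarith)
  have h1 := hp.x_eq e _ ⟨h0.le, min_le_left _ _⟩
  have h2 := hγ.x_mono e (show ϑ + min ε (b - ϑ) ≤ b by linarith [min_le_right ε (b - ϑ)])
  nlinarith [mul_pos hy h0]

theorem Piece.flow_eq_zero {e : E} {b : ℝ} (hb : ϑ < b)
    (h : γ.ell (N.head e) b ≤ γ.ell (N.tail e) ϑ + N.τ e) : y e = 0 := by
  by_cases he : e ∈ γ.active N ϑ
  · have h0 := hp.slope_eq_zero hγ hb (h.trans (mem_active.1 he))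
    have h1 := hp.thin.le_push e
    rw [h0, mul_zero] at h1
    exact le_antisymm h1 (hp.thin.nonneg e)
  · exact hp.thin.eq_zero e he

omit hγ in
theorem Piece.hasDerivWithinAt_x (e : E) :
    HasDerivWithinAt (γ.x e) (y e) (Set.Ici ϑ) ϑ :=
  hasDerivWithinAt_of_affine hp.pos fun δ h0 h1 => hp.x_eq e δ ⟨h0, h1.le⟩

end Piece

variable (hg : ∀ ϑ, γ.Good N κ ϑ)
include hg

/-- Every time is the arrival time at a node at the beginning of an affine piece on which the
arrival time is strictly increasing. -/
theorem exists_piece (v : V) (θ : ℝ) : ∃ ε y lam c,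
    γ.Piece N κ (lastPreimage (γ.ell v) θ) ε y lam c ∧ 0 < lam v := by
  obtain ⟨ε, y, lam, c, hp⟩ := hg (lastPreimage (γ.ell v) θ)
  exact ⟨ε, y, lam, c, hp, lam_pos hγ hp.pos (hp.thin.lam_nonneg v) (hp.ell_eq v)⟩

theorem exists_inRate (e : E) (θ : ℝ) : ∃ ε y lam c,
    γ.Piece N κ (lastPreimage (γ.ell (N.tail e)) θ) ε y lam c ∧ 0 < lam (N.tail e) ∧
      γ.inRate N e θ = y e / lam (N.tail e) := by
  obtain ⟨ε, y, lam, c, hp, hlam⟩ := exists_piece hγ hg (N.tail e) θ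
  have := hp.inRate_eq hγ hlam
  rw [ell_lastPreimage hγ] at this
  exact ⟨ε, y, lam, c, hp, hlam, this⟩

theorem exists_outRate (e : E) (θ : ℝ) : ∃ ε y lam c,
    γ.Piece N κ (lastPreimage (γ.ell (N.head e)) θ) ε y lam c ∧ 0 < lam (N.head e) ∧
      γ.outRate N e θ = y e / lam (N.head e) := by
  obtain ⟨ε, y, lam, c, hp, hlam⟩ := exists_piece hγ hg (N.head e) θ
  have := hp.outRate_eq hγ hlam
  rw [ell_lastPreimage hγ] at this
  exact ⟨ε, y, lam, c, hp, hlam, this⟩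

theorem inRate_nonneg (e : E) (θ : ℝ) : 0 ≤ γ.inRate N e θ := by
  obtain ⟨ε, y, lam, c, hp, hlam, h⟩ := exists_inRate hγ hg e θ
  rw [h]
  exact div_nonneg (hp.thin.nonneg e) hlam.le

theorem outRate_nonneg (e : E) (θ : ℝ) : 0 ≤ γ.outRate N e θ := by
  obtain ⟨ε, y, lam, c, hp, hlam, h⟩ := exists_outRate hγ hg e θ
  rw [h]
  exact div_nonneg (hp.thin.nonneg e) hlam.le

theorem inRate_le (e : E) (θ : ℝ) : γ.inRate N e θ ≤ N.νin e := by
  obtain ⟨ε, y, lam, c, hp, hlam, h⟩ := exists_inRate hγ hg e θ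
  rw [h, div_le_iff₀ hlam]
  exact (hp.thin.le_bound e).trans (mul_le_mul_of_nonneg_right (bound_le _ _) hlam.le)

theorem outRate_le (e : E) (θ : ℝ) : γ.outRate N e θ ≤ N.νout e := by
  obtain ⟨ε, y, lam, c, hp, hlam, h⟩ := exists_outRate hγ hg e θ
  rw [h, div_le_iff₀ hlam]
  exact (hp.thin.le_push e).trans (mul_le_mul_of_nonneg_right
    (mul_le_of_le_one_left (N.νout_pos e).le (hp.thin.c_mem _).2) hlam.le)

theorem inRate_of_neg (e : E) {θ : ℝ} (hθ : θ < 0) : γ.inRate N e θ = 0 := by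
  obtain ⟨ε, y, lam, c, hp, hlam, h⟩ := exists_inRate hγ hg e θ
  rw [h, hp.flow_eq_zero_of_neg hγ ((lastPreimage_le hγ _ θ).trans_lt hθ), zero_div]

theorem outRate_of_neg (e : E) {θ : ℝ} (hθ : θ < 0) : γ.outRate N e θ = 0 := by
  obtain ⟨ε, y, lam, c, hp, hlam, h⟩ := exists_outRate hγ hg e θ
  rw [h, hp.flow_eq_zero_of_neg hγ ((lastPreimage_le hγ _ θ).trans_lt hθ), zero_div]

theorem hasDerivWithinAt_inRate (e : E) (θ : ℝ) :
    HasDerivWithinAt (γ.cumIn N e) (γ.inRate N e θ) (Set.Ici θ) θ := by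
  obtain ⟨ε, y, lam, c, hp, hlam, h⟩ := exists_inRate hγ hg e θ
  have := hp.hasDerivWithinAt_cumIn hγ hlam
  rwa [ell_lastPreimage hγ, ← h] at this

theorem hasDerivWithinAt_outRate (e : E) (θ : ℝ) :
    HasDerivWithinAt (γ.cumOut N e) (γ.outRate N e θ) (Set.Ici θ) θ := by
  obtain ⟨ε, y, lam, c, hp, hlam, h⟩ := exists_outRate hγ hg e θ
  have := hp.hasDerivWithinAt_cumOut hγ hlam
  rwa [ell_lastPreimage hγ, ← h] at this

omit hγ hg in
theorem locallyIntegrable_of_bounds {f : ℝ → ℝ} {M : ℝ} (hm : Measurable f) (h0 : ∀ θ, 0 ≤ f θ)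
    (hM : ∀ θ, f θ ≤ M) : LocallyIntegrable f := by
  refine (locallyIntegrable_const M).mono hm.aestronglyMeasurable (Filter.Eventually.of_forall
    fun θ => ?_)
  rw [Real.norm_of_nonneg (h0 θ), Real.norm_of_nonneg ((h0 θ).trans (hM θ))]
  exact hM θ

/-- The flow over time described by a trajectory. -/
noncomputable def toFlow : N.Flow where
  fin := γ.inRate N
  fout := γ.outRate N
  fin_nonneg := inRate_nonneg hγ hg
  fout_nonneg := outRate_nonneg hγ hg
  fin_zero_neg e _ := inRate_of_neg hγ hg e
  fout_zero_neg e _ := outRate_of_neg hγ hg e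
  fin_bdd e := ⟨_, inRate_le hγ hg e⟩
  fout_bdd e := ⟨_, outRate_le hγ hg e⟩
  fin_li e := locallyIntegrable_of_bounds (measurable_derivWithin_Ici _)
    (inRate_nonneg hγ hg e) (inRate_le hγ hg e)
  fout_li e := locallyIntegrable_of_bounds (measurable_derivWithin_Ici _)
    (outRate_nonneg hγ hg e) (outRate_le hγ hg e)

theorem integral_inRate (e : E) (a b : ℝ) :
    ∫ ξ in a..b, γ.inRate N e ξ = γ.cumIn N e b - γ.cumIn N e a :=
  intervalIntegral.integral_eq_sub_of_hasDeriv_right (cumIn_cont hγ e).continuousOn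
    (fun θ _ => (hasDerivWithinAt_inRate hγ hg e θ).mono Set.Ioi_subset_Ici_self)
    ((((toFlow hγ hg).fin_li e).integrableOn_isCompact isCompact_uIcc).intervalIntegrable)

theorem integral_outRate (e : E) (a b : ℝ) :
    ∫ ξ in a..b, γ.outRate N e ξ = γ.cumOut N e b - γ.cumOut N e a :=
  intervalIntegral.integral_eq_sub_of_hasDeriv_right (cumOut_cont hγ e).continuousOn
    (fun θ _ => (hasDerivWithinAt_outRate hγ hg e θ).mono Set.Ioi_subset_Ici_self)
    ((((toFlow hγ hg).fout_li e).integrableOn_isCompact isCompact_uIcc).intervalIntegrable)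

theorem Fplus_toFlow (e : E) (θ : ℝ) : (toFlow hγ hg).Fplus e θ = γ.cumIn N e θ := by
  refine (integral_inRate hγ hg e 0 θ).trans ?_
  rw [cumIn_of_nonpos hγ le_rfl, sub_zero]

theorem Fminus_toFlow (e : E) (θ : ℝ) : (toFlow hγ hg).Fminus e θ = γ.cumOut N e θ := by
  refine (integral_outRate hγ hg e 0 θ).trans ?_
  rw [cumOut_of_nonpos hγ le_rfl, sub_zero]

theorem z_toFlow (e : E) (θ : ℝ) :
    (toFlow hγ hg).z e θ = γ.cumIn N e (θ - N.τ e) - γ.cumOut N e θ := by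
  rw [Flow.z, Fplus_toFlow, Fminus_toFlow]

/-! ### Queues -/

/-- An arc that is not queued has no queue. -/
theorem cumIn_eq_cumOut {e : E} {θ : ℝ} (h : e ∉ γ.queued N (lastPreimage (γ.ell (N.head e)) θ)) :
    γ.cumIn N e (θ - N.τ e) = γ.cumOut N e θ := by
  set ϑ := lastPreimage (γ.ell (N.head e)) θ with hϑ
  have hell : γ.ell (N.head e) ϑ = θ := ell_lastPreimage hγ _ _
  rw [mem_queued, not_lt, hell] at h
  set ϑ₁ := lastPreimage (γ.ell (N.tail e)) (θ - N.τ e) with hϑ₁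
  have hell₁ : γ.ell (N.tail e) ϑ₁ = θ - N.τ e := ell_lastPreimage hγ _ _
  show γ.x e ϑ₁ = γ.x e ϑ
  rcases le_or_gt ϑ ϑ₁ with hle | hlt
  · refine x_eq_of_tail hγ (le_antisymm ?_ (hγ.ell_mono _ hle))
    linarith
  · refine (constant_of_has_deriv_right_zero (hγ.x_cont e).continuousOn (fun a ha => ?_) ϑ
      ⟨hlt.le, le_rfl⟩).symm
    obtain ⟨ε, y, lam, c, hp⟩ := hg a
    have hy : y e = 0 := by
      refine hp.flow_eq_zero hγ ha.2 ?_
      have := hγ.ell_mono (N.tail e) ha.1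
      rw [hell]
      linarith
    rw [← hy]
    exact hp.hasDerivWithinAt_x e

theorem z_pos_iff {e : E} {θ : ℝ} : 0 < (toFlow hγ hg).z e θ ↔
    e ∈ γ.queued N (lastPreimage (γ.ell (N.head e)) θ) := by
  rw [z_toFlow]
  by_cases h : e ∈ γ.queued N (lastPreimage (γ.ell (N.head e)) θ)
  · refine iff_of_true (sub_pos.2 ?_) h
    obtain ⟨ε, y, lam, c, hp, hlam⟩ := exists_piece hγ hg (N.head e) θ
    refine hp.x_lt hγ ?_ ?_
    · rw [mem_queued, ell_lastPreimage hγ] at h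
      by_contra! hcon
      have := hγ.ell_mono (N.tail e) hcon
      rw [ell_lastPreimage hγ] at this
      linarith
    · rw [hp.thin.reset e h]
      exact mul_pos (mul_pos (hp.thin.c_mem _).1 (N.νout_pos e)) hlam
  · refine iff_of_false ?_ h
    rw [cumIn_eq_cumOut hγ hg h, sub_self]
    exact lt_irrefl _

end IsOn

section Nash

variable (hγ : γ.IsOn N K Set.univ) (hg : ∀ ϑ, γ.Good N κ ϑ)
include hγ hg

/-! ### Feasibility -/

theorem d_toFlow (e : E) (θ : ℝ) :
    (toFlow hγ hg).d e θ = γ.load N e (lastPreimage (γ.ell (N.tail e)) θ) := by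
  rw [Flow.d, Fplus_toFlow, Fminus_toFlow, load, ell_lastPreimage hγ]
  rfl

theorem full_toFlow (e : E) (θ : ℝ) :
    (toFlow hγ hg).Full e θ ↔ γ.Full N e (lastPreimage (γ.ell (N.tail e)) θ) := by
  rw [Flow.Full, d_toFlow]
  rfl

theorem bplus_toFlow (e : E) (θ : ℝ) :
    (toFlow hγ hg).bplus e θ = γ.bound N (lastPreimage (γ.ell (N.tail e)) θ) e := by
  simp only [Flow.bplus, bound, full_toFlow, ell_lastPreimage hγ]
  rfl

theorem inRate_le_bplus (e : E) (θ : ℝ) : γ.inRate N e θ ≤ (toFlow hγ hg).bplus e θ := by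
  obtain ⟨ε, y, lam, c, hp, hlam, h⟩ := exists_inRate hγ hg e θ
  rw [h, bplus_toFlow, div_le_iff₀ hlam]
  exact hp.thin.le_bound e

theorem Piece.outRate_eq_min {e : E} {θ ε : ℝ} {y : E → ℝ} {lam c : V → ℝ}
    (hp : γ.Piece N κ (lastPreimage (γ.ell (N.head e)) θ) ε y lam c) (hlam : 0 < lam (N.head e)) :
    γ.outRate N e θ = min ((toFlow hγ hg).bminus e θ) (N.νout e * c (N.head e)) := by
  set ϑ := lastPreimage (γ.ell (N.head e)) θ with hϑ
  have hell : γ.ell (N.head e) ϑ = θ := ell_lastPreimage hγ _ _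
  have hout : γ.outRate N e θ = y e / lam (N.head e) := by
    rw [← hp.outRate_eq hγ hlam, hell]
  have hc := hp.thin.c_mem (N.head e)
  have hν := N.νout_pos e
  have hcν : 0 < N.νout e * c (N.head e) := mul_pos hν hc.1
  have hcν' : N.νout e * c (N.head e) ≤ N.νout e := mul_le_of_le_one_right hν.le hc.2
  have hfull : y e = c (N.head e) * N.νout e * lam (N.head e) →
      y e / lam (N.head e) = N.νout e * c (N.head e) := fun h => by
    rw [h]; field_simp
  rw [hout, Flow.bminus]
  split_ifs with hτ hz
  · have hy : y e = 0 := by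
      rcases lt_or_ge ϑ 0 with hneg | hpos
      · exact hp.flow_eq_zero_of_neg hγ hneg e
      · refine hp.thin.eq_zero e fun hA => ?_
        rw [mem_active, hell] at hA
        linarith [hγ.le_ell (N.tail e) ϑ]
    rw [hy, zero_div, min_eq_left hcν.le]
  · rw [min_eq_right hcν']
    exact hfull (hp.thin.reset e ((z_pos_iff hγ hg).1 hz))
  · rw [z_pos_iff] at hz
    change _ = min (min (γ.inRate N e (θ - N.τ e)) _) _
    rw [min_assoc, min_eq_right hcν']
    by_cases hA : e ∈ γ.active N ϑ
    · have htail : θ - N.τ e = γ.ell (N.tail e) ϑ := by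
        rw [mem_queued, hell] at hz
        rw [mem_active, hell] at hA
        linarith
      rcases (hp.thin.lam_nonneg (N.tail e)).eq_or_lt with h0 | h0
      · exfalso
        have h1 := hp.thin.push e hA (h0 ▸ hlam)
        have h2 := hp.thin.le_bound e
        rw [← h0, mul_zero, h1] at h2
        exact absurd h2 (not_le.2 (mul_pos (mul_pos hc.1 hν) hlam))
      · rw [htail, hp.inRate_eq hγ h0]
        rcases lt_trichotomy (lam (N.tail e)) (lam (N.head e)) with hlt | heq | hgt
        · have h1 := hfull (hp.thin.push e hA hlt)
          rw [h1, min_eq_right]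
          rw [← h1]
          exact div_le_div_of_nonneg_left (hp.thin.nonneg e) h0 hlt.le
        · rw [heq, min_eq_left]
          rw [div_le_iff₀ hlam]
          linarith [hp.thin.le_push e]
        · rw [hp.thin.unused e hA hz hgt, zero_div, zero_div, min_eq_left hcν.le]
    · have hlt : lastPreimage (γ.ell (N.tail e)) (θ - N.τ e) < ϑ := by
        refine lastPreimage_lt_of_lt hγ ?_
        rw [mem_active, hell] at hA
        linarith
      obtain ⟨ε', y', lam', c', hp', hlam', h'⟩ := exists_inRate hγ hg e (θ - N.τ e)
      rw [h', hp.thin.eq_zero e hA, hp'.flow_eq_zero hγ hlt, zero_div, zero_div,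
        min_eq_left hcν.le]
      rw [hell, ell_lastPreimage hγ]
      linarith

theorem cycleFree_full (θ : ℝ) : N.CycleFree {e | (toFlow hγ hg).Full e θ} := by
  intro l hl hS hch hcyc
  have hstep : ∀ e ∈ l, lastPreimage (γ.ell (N.head e)) θ < lastPreimage (γ.ell (N.tail e)) θ := by
    intro e he
    have h1 : (toFlow hγ hg).Full e θ := hS e he
    have h2 := ((full_toFlow hγ hg e θ).1 h1).ell_lt hγ
    rw [ell_lastPreimage hγ] at h2
    exact lastPreimage_lt_of_lt hγ h2
  have key : ∀ (l : List E) (hl : l ≠ []), l.IsChain (fun e e' => N.head e = N.tail e') →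
      (∀ e ∈ l, lastPreimage (γ.ell (N.head e)) θ < lastPreimage (γ.ell (N.tail e)) θ) →
      lastPreimage (γ.ell (N.head (l.getLast hl))) θ <
        lastPreimage (γ.ell (N.tail (l.head hl))) θ := by
    intro l
    induction l with
    | nil => intro hl; exact absurd rfl hl
    | cons e l ih =>
      intro _ hch hs
      rcases eq_or_ne l [] with rfl | hne
      · exact hs e (by simp)
      · rw [List.isChain_cons] at hch
        have h1 := ih hne hch.2 fun e' he' => hs e' (List.mem_cons_of_mem _ he')
        rw [← hch.1 _ (List.head?_eq_some_head hne)] at h1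
        rw [List.getLast_cons hne]
        exact h1.trans (hs e (by simp))
  have := key l hl hch hstep
  rw [hcyc] at this
  exact lt_irrefl _ this

theorem feasible_toFlow : (toFlow hγ hg).Feasible := by
  refine ⟨inRate_le_bplus hγ hg, fun v θ => ?_, fun v θ => ?_, cycleFree_full hγ hg⟩
  · obtain ⟨ε, y, lam, c, hp, hlam⟩ := exists_piece hγ hg v θ
    refine ⟨c v, hp.thin.c_mem v, ?_⟩
    rintro e rfl
    exact hp.outRate_eq_min hγ hg hlam
  · rintro ⟨e, rfl, he⟩
    obtain ⟨ε, y, lam, c, hp, hlam⟩ := exists_piece hγ hg (N.head e) θ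
    have hmin := hp.outRate_eq_min hγ hg hlam
    have hle : (toFlow hγ hg).bminus e θ ≤ N.νout e := by
      rw [Flow.bminus]
      split_ifs
      · exact (N.νout_pos e).le
      · exact le_rfl
      · exact min_le_right _ _
    have hc : c (N.head e) < 1 := by
      have h1 : γ.outRate N e θ < (toFlow hγ hg).bminus e θ := he
      by_contra! hcon
      have h2 : N.νout e ≤ N.νout e * c (N.head e) :=
        le_mul_of_one_le_right (N.νout_pos e).le hcon
      rw [min_eq_left (hle.trans h2)] at hmin
      exact h1.ne hmin
    obtain ⟨e', he', hy⟩ := hp.thin.tight _ hc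
    refine ⟨e', he', ?_⟩
    rw [← he'] at hp hlam hy
    rw [bplus_toFlow]
    have := hp.inRate_eq hγ hlam
    rw [ell_lastPreimage hγ, hy, mul_div_assoc, div_self hlam.ne', mul_one] at this
    exact this

theorem conserves_toFlow : (toFlow hγ hg).Conserves fun _ => N.r := by
  intro v hv θ hθ
  obtain ⟨ε, y, lam, c, hp, hlam⟩ := exists_piece hγ hg v θ
  have hin : ∑ e ∈ univ.filter fun e => N.tail e = v, γ.inRate N e θ = N.outSum y v / lam v := by
    rw [outSum, sum_div]
    refine sum_congr rfl fun e he => ?_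
    obtain rfl := (mem_filter.1 he).2
    rw [← hp.inRate_eq hγ hlam, ell_lastPreimage hγ]
  have hout : ∑ e ∈ univ.filter fun e => N.head e = v, γ.outRate N e θ =
      N.inSum y v / lam v := by
    rw [inSum, sum_div]
    refine sum_congr rfl fun e he => ?_
    obtain rfl := (mem_filter.1 he).2
    rw [← hp.outRate_eq hγ hlam, ell_lastPreimage hγ]
  change (∑ e ∈ univ.filter fun e => N.tail e = v, γ.inRate N e θ)
      - (∑ e ∈ univ.filter fun e => N.head e = v, γ.outRate N e θ) = _
  rw [hin, hout, ← sub_div]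
  split_ifs with hs
  · subst hs
    have h1 : lastPreimage (γ.ell N.s) θ = θ := by
      rw [← hγ.ell_source (lastPreimage _ _), ell_lastPreimage hγ]
    have h2 : N.inSum y N.s = 0 := sum_eq_zero fun e he =>
      absurd (mem_filter.1 he).2 (N.no_into_source e)
    rw [hp.thin.cons_source hv, h1, if_neg (not_lt.2 hθ), h2, hp.thin.lam_source, sub_zero,
      div_one]
  · have := hp.thin.cons v hs
    rw [if_neg hv] at this
    rw [show N.outSum y v - N.inSum y v = 0 by linarith, zero_div]

/-! ### Arrival times -/

/-- The exit time of an arc at the arrival time at its tail. -/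
theorem T_ell (e : E) (ϑ : ℝ) : (toFlow hγ hg).T e (γ.ell (N.tail e) ϑ) =
    max (γ.ell (N.head e) ϑ) (γ.ell (N.tail e) ϑ + N.τ e) := by
  set θ := γ.ell (N.tail e) ϑ with hθ
  have hset : {q : ℝ | 0 ≤ q ∧ (∫ ξ in (θ + N.τ e)..(θ + N.τ e + q), (toFlow hγ hg).fout e ξ) =
      (toFlow hγ hg).z e (θ + N.τ e)} =
      {q : ℝ | 0 ≤ q ∧ γ.cumOut N e (θ + N.τ e + q) = γ.x e ϑ} := by
    ext q
    rw [Set.mem_ofPred_eq, Set.mem_ofPred_eq, z_toFlow, add_sub_cancel_right, hθ, cumIn_ell hγ]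
    change _ ∧ (∫ ξ in _.._, γ.outRate N e ξ) = _ ↔ _
    rw [integral_outRate hγ hg, sub_left_inj]
  have hleast : IsLeast {q : ℝ | 0 ≤ q ∧ γ.cumOut N e (θ + N.τ e + q) = γ.x e ϑ}
      (max (γ.ell (N.head e) ϑ) (θ + N.τ e) - (θ + N.τ e)) := by
    refine ⟨⟨sub_nonneg.2 (le_max_right _ _), ?_⟩, ?_⟩
    · rw [add_sub_cancel]
      rcases le_total (θ + N.τ e) (γ.ell (N.head e) ϑ) with hle | hle
      · rw [max_eq_left hle, cumOut_ell hγ]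
      · rw [max_eq_right hle, ← cumIn_eq_cumOut hγ hg, add_sub_cancel_right, hθ, cumIn_ell hγ]
        rw [mem_queued, not_lt, ell_lastPreimage hγ]
        have := hγ.ell_mono (N.tail e) ((hγ.isLabel (N.head e)).le_lastPreimage_iff.2 hle)
        linarith
    · rintro q ⟨hq0, hq⟩
      by_contra! hcon
      rcases le_or_gt (γ.ell (N.head e) ϑ) (θ + N.τ e) with hle | hlt
      · rw [max_eq_right hle] at hcon
        linarith
      · rw [max_eq_left hlt.le] at hcon
        set a := lastPreimage (γ.ell (N.head e)) (θ + N.τ e + q) with ha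
        have hella : γ.ell (N.head e) a = θ + N.τ e + q := ell_lastPreimage hγ _ _
        have haϑ : a < ϑ := lastPreimage_lt_of_lt hγ (by linarith)
        have hmono := hγ.ell_mono (N.tail e) haϑ.le
        obtain ⟨ε, y, lam, c, hp, hlam⟩ := exists_piece hγ hg (N.head e) (θ + N.τ e + q)
        have hpos : y e = c (N.head e) * N.νout e * lam (N.head e) := by
          by_cases hQ : e ∈ γ.queued N a
          · exact hp.thin.reset e hQ
          · refine hp.thin.push e (mem_active.2 (by rw [hella]; linarith)) ?_
            rw [mem_queued, not_lt, hella] at hQ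
            rwa [hp.slope_eq_zero hγ haϑ (by linarith)]
        refine (hp.x_lt hγ haϑ ?_).ne hq
        rw [hpos]
        exact mul_pos (mul_pos (hp.thin.c_mem _).1 (N.νout_pos e)) hlam
  rw [Flow.T, Flow.q, hset, hleast.csInf_eq]
  ring

theorem T_mono (e : E) : Monotone ((toFlow hγ hg).T e) := by
  intro a b hab
  rw [← ell_lastPreimage hγ (N.tail e) a, ← ell_lastPreimage hγ (N.tail e) b, T_ell, T_ell,
    ell_lastPreimage hγ, ell_lastPreimage hγ]
  exact max_le_max (hγ.ell_mono _ ((hγ.isLabel _).lastPreimage_mono hab)) (by linarith)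

theorem ell_toFlow (v : V) (ϑ : ℝ) : (toFlow hγ hg).ell v ϑ = γ.ell v ϑ := by
  have hlow : ∀ (l : List E) (v : V), N.IsWalk N.s v l →
      γ.ell v ϑ ≤ (toFlow hγ hg).TWalk l ϑ := by
    intro l
    induction l using List.reverseRecOn with
    | nil =>
      rintro v rfl
      exact (hγ.ell_source ϑ).le
    | append_singleton l e ih =>
      intro v hw
      obtain ⟨h1, rfl⟩ := isWalk_concat.1 hw
      have h2 := T_mono hγ hg e (ih _ h1)
      rw [T_ell] at h2
      rw [Flow.TWalk, List.foldl_append]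
      exact (le_max_left _ _).trans h2
  have hatt : ∃ l, N.IsWalk N.s v l ∧ (toFlow hγ hg).TWalk l ϑ = γ.ell v ϑ := by
    obtain ⟨h, hh⟩ := N.exists_topological_numbering fun v => γ.ell v ϑ
    induction hn : h v using Nat.strong_induction_on generalizing v with
    | _ n ih =>
      rcases eq_or_ne v N.s with rfl | hv
      · exact ⟨[], rfl, (hγ.ell_source ϑ).symm⟩
      · obtain ⟨e, rfl, hle⟩ := hγ.enter ϑ trivial v hv
        obtain ⟨l, hl, hT⟩ := ih _ (hn ▸ hh e hle) (N.tail e) rfl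
        refine ⟨l ++ [e], isWalk_concat.2 ⟨hl, rfl⟩, ?_⟩
        rw [Flow.TWalk, List.foldl_append]
        change (toFlow hγ hg).T e ((toFlow hγ hg).TWalk l ϑ) = _
        rw [hT, T_ell, max_eq_left hle]
  exact IsLeast.csInf_eq ⟨hatt, by rintro _ ⟨l, hl, rfl⟩; exact hlow l v hl⟩

theorem isNash_toFlow : (toFlow hγ hg).IsNash := by
  refine ⟨conserves_toFlow hγ hg, feasible_toFlow hγ hg, ?_⟩
  refine Filter.Eventually.of_forall fun θ _ e he => ?_
  change 0 < γ.inRate N e θ at he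
  obtain ⟨ε, y, lam, c, hp, hlam, h⟩ := exists_inRate hγ hg e θ
  have hy : y e ≠ 0 := by
    rintro h0
    rw [h, h0, zero_div] at he
    exact lt_irrefl _ he
  refine ⟨lastPreimage (γ.ell (N.tail e)) θ, ?_, ?_, ?_⟩
  · by_contra! hneg
    exact hy (hp.flow_eq_zero_of_neg hγ hneg e)
  · have hA : e ∈ γ.active N (lastPreimage (γ.ell (N.tail e)) θ) := by
      by_contra hA
      exact hy (hp.thin.eq_zero e hA)
    rw [Flow.Active, ell_toFlow, ell_toFlow, T_ell, max_eq_left (mem_active.1 hA)]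
  · rw [ell_toFlow, ell_lastPreimage hγ]

end Nash

end Traj

/-- **Existence of Nash flows over time with spillback.** Every flow network with
spillback admits a Nash flow over time: a feasible flow over time (with network
inflow rate `r`) such that for almost all `θ ≥ 0` and every arc `e = uv`,
`f⁺_e(θ) > 0` implies `θ ∈ {ℓ_u(ϑ) | ϑ ≥ 0, e ∈ E'_ϑ}`. -/
theorem exists_nash_flow
    {V E : Type} [Fintype V] [Fintype E] (N : SpillbackNetwork V E) :
    ∃ f : N.Flow, f.IsNash := by
  obtain ⟨γ, K, κ, hγ, hg⟩ := exists_good_traj N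
  exact ⟨Traj.toFlow hγ hg, Traj.isNash_toFlow hγ hg⟩

end SpillbackNetwork
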